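/- Let P ∈ ℤ[n] be a polynomial of degree k. There exists a constant C₀ depending only on P such that for every M ∈ ℕ and every natural number K ≥ C·k²·log k, the number of 2K-tuples (n₁, ..., n_K, m₁, ..., m_K) ∈ [1,M]^{2K} satisfying P(n₁) + ... + P(n_K) = P(m₁) + ... + P(m_K) is at most C₀ · M^{2K−k}. -/

import Mathlib

namespace VMV

/-- Additive energy of a finite set along a map. -/
def en {ι G : Type*} [DecidableEq G] (T : Finset ι) (φ : ι → G) : ℕ :=
  ((T ×ˢ T).filter (fun p => φ p.1 = φ p.2)).card

/-- Number of representations. -/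
def rp {ι G : Type*} [DecidableEq G] (T : Finset ι) (φ : ι → G) (v : G) : ℕ :=
  (T.filter (fun x => φ x = v)).card

section energy
variable {ι κ G : Type*} [DecidableEq G]

lemma card_pairs_eq_sum (T : Finset ι) (S : Finset κ) (φ : ι → G) (χ : κ → G) (V : Finset G)
    (hV : ∀ x ∈ T, φ x ∈ V) :
    ((T ×ˢ S).filter (fun p => φ p.1 = χ p.2)).card = ∑ v ∈ V, rp T φ v * rp S χ v := by
  classical
  rw [Finset.card_eq_sum_card_fiberwise (f := fun p => φ p.1) (t := V)]
  · refine Finset.sum_congr rfl fun v _ => ?_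
    unfold rp
    rw [← Finset.card_product]
    congr 1
    ext ⟨x, y⟩
    simp only [Finset.mem_filter, Finset.mem_product]
    constructor
    · rintro ⟨⟨⟨h1, h2⟩, h3⟩, h4⟩
      exact ⟨⟨h1, h4⟩, h2, h3 ▸ h4⟩
    · rintro ⟨⟨h1, h4⟩, h2, h3⟩
      exact ⟨⟨⟨h1, h2⟩, h4.trans h3.symm⟩, h4⟩
  · intro p hp
    simp only [Finset.coe_filter, Finset.mem_product, Set.mem_ofPred_eq] at hp
    exact hV _ hp.1.1

lemma en_eq_sum (T : Finset ι) (φ : ι → G) (V : Finset G) (hV : ∀ x ∈ T, φ x ∈ V) :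
    en T φ = ∑ v ∈ V, rp T φ v ^ 2 := by
  unfold en
  rw [card_pairs_eq_sum T T φ φ V hV]
  simp [sq]

lemma sum_rp_sq_le (T : Finset ι) (φ : ι → G) (V : Finset G) :
    ∑ v ∈ V, rp T φ v ^ 2 ≤ en T φ := by
  classical
  rw [en_eq_sum T φ (V ∪ T.image φ) (fun x hx =>
    Finset.mem_union_right _ (Finset.mem_image_of_mem _ hx))]
  exact Finset.sum_le_sum_of_subset Finset.subset_union_left

lemma en_mono {T S : Finset ι} (h : T ⊆ S) (φ : ι → G) : en T φ ≤ en S φ := by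
  unfold en
  exact Finset.card_le_card (Finset.filter_subset_filter _ (Finset.product_subset_product h h))

lemma en_biUnion_le {σ : Type*} (I : Finset σ) (T : Finset ι) (F : σ → Finset ι) (φ : ι → G)
    (h : ∀ x ∈ T, ∃ i ∈ I, x ∈ F i) : en T φ ≤ I.card * ∑ i ∈ I, en (F i) φ := by
  classical
  rw [en_eq_sum T φ (T.image φ) (fun x hx => Finset.mem_image_of_mem _ hx)]
  calc ∑ v ∈ T.image φ, rp T φ v ^ 2
      ≤ ∑ v ∈ T.image φ, (I.card * ∑ i ∈ I, rp (F i) φ v ^ 2) := by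
        refine Finset.sum_le_sum fun v _ => ?_
        have h1 : rp T φ v ≤ ∑ i ∈ I, rp (F i) φ v := by
          unfold rp
          refine le_trans (Finset.card_le_card ?_)
            (Finset.card_biUnion_le (s := I) (t := fun i => (F i).filter (fun x => φ x = v)))
          intro x hx
          simp only [Finset.mem_filter] at hx
          obtain ⟨i, hi, hxi⟩ := h x hx.1
          simp only [Finset.mem_biUnion, Finset.mem_filter]
          exact ⟨i, hi, hxi, hx.2⟩
        calc rp T φ v ^ 2 ≤ (∑ i ∈ I, rp (F i) φ v) ^ 2 := Nat.pow_le_pow_left h1 2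
          _ ≤ _ := by
            have := sq_sum_le_card_mul_sum_sq (s := I) (f := fun i => rp (F i) φ v)
            simpa using this
    _ = I.card * ∑ i ∈ I, ∑ v ∈ T.image φ, rp (F i) φ v ^ 2 := by
        rw [← Finset.mul_sum, Finset.sum_comm]
    _ ≤ _ := by
        gcongr with i hi
        exact sum_rp_sq_le _ _ _

lemma card_shift_le [AddCommGroup G] (T : Finset ι) (φ : ι → G) (h : G) :
    ((T ×ˢ T).filter (fun p => φ p.1 = φ p.2 + h)).card ≤ en T φ := by
  classical
  rw [card_pairs_eq_sum T T φ (fun x => φ x + h) (T.image φ)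
    (fun x hx => Finset.mem_image_of_mem _ hx)]
  have h2 : ∑ v ∈ T.image φ, rp T (fun x => φ x + h) v ^ 2 ≤ en T φ := by
    refine (sum_rp_sq_le _ _ _).trans ?_
    unfold en
    simp
  have h1 : ∑ v ∈ T.image φ, rp T φ v ^ 2 ≤ en T φ := sum_rp_sq_le _ _ _
  have h3 : ∑ v ∈ T.image φ, 2 * (rp T φ v * rp T (fun x => φ x + h) v) ≤
      ∑ v ∈ T.image φ, (rp T φ v ^ 2 + rp T (fun x => φ x + h) v ^ 2) := by
    refine Finset.sum_le_sum fun v _ => ?_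
    have := two_mul_le_add_sq (rp T φ v) (rp T (fun x => φ x + h) v)
    nlinarith
  rw [Finset.sum_add_distrib, ← Finset.mul_sum] at h3
  omega

/-- transport along a map -/
lemma en_le_of_map {κ : Type*} (T : Finset ι) (S : Finset κ) (φ : ι → G) (χ : κ → G) (e : ι → κ)
    (he : Set.InjOn e T) (hm : ∀ x ∈ T, e x ∈ S) (hφ : ∀ x ∈ T, χ (e x) = φ x) :
    en T φ ≤ en S χ := by
  unfold en
  refine Finset.card_le_card_of_injOn (fun p => (e p.1, e p.2)) ?_ ?_
  · intro p hp
    simp only [Finset.coe_filter, Finset.mem_product, Set.mem_ofPred_eq] at hp ⊢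
    refine ⟨⟨hm _ hp.1.1, hm _ hp.1.2⟩, ?_⟩
    rw [hφ _ hp.1.1, hφ _ hp.1.2, hp.2]
  · intro p hp q hq hpq
    simp only [Finset.coe_filter, Finset.mem_product, Set.mem_ofPred_eq] at hp hq
    simp only [Prod.mk.injEq] at hpq
    exact Prod.ext (he hp.1.1 hq.1.1 hpq.1) (he hp.1.2 hq.1.2 hpq.2)

/-- change of the target group -/
lemma en_le_of_imp {G' : Type*} [DecidableEq G'] (T : Finset ι) (φ : ι → G) (χ : ι → G')
    (h : ∀ x ∈ T, ∀ y ∈ T, φ x = φ y → χ x = χ y) : en T φ ≤ en T χ := by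
  unfold en
  refine Finset.card_le_card ?_
  intro p hp
  simp only [Finset.mem_filter, Finset.mem_product] at hp ⊢
  exact ⟨hp.1, h _ hp.1.1 _ hp.1.2 hp.2⟩

end energy

section fourier
variable {G : Type*} [AddCommGroup G] [Fintype G] [DecidableEq G]

lemma fourier_en {ι : Type*} (T : Finset ι) (φ : ι → G) :
    ∑ ψ : AddChar G ℂ, ‖∑ x ∈ T, ψ (φ x)‖ ^ 2 = (Fintype.card G : ℝ) * en T φ := by
  have key : ((∑ ψ : AddChar G ℂ, ‖∑ x ∈ T, ψ (φ x)‖ ^ 2 : ℝ) : ℂ)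
      = ((Fintype.card G : ℝ) * en T φ : ℝ) := by
    push_cast
    have : ∀ ψ : AddChar G ℂ, ((‖∑ x ∈ T, ψ (φ x)‖ : ℝ) : ℂ) ^ 2
        = ∑ x ∈ T, ∑ y ∈ T, ψ (φ x - φ y) := by
      intro ψ
      rw [← Complex.mul_conj']
      rw [map_sum, Finset.sum_mul_sum]
      refine Finset.sum_congr rfl fun x _ => Finset.sum_congr rfl fun y _ => ?_
      rw [← AddChar.map_neg_eq_conj, ← AddChar.map_add_eq_mul, sub_eq_add_neg]
    simp_rw [this]
    rw [Finset.sum_comm]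
    simp_rw [Finset.sum_comm (s := (Finset.univ : Finset (AddChar G ℂ))), AddChar.sum_apply_eq_ite,
      sub_eq_zero]
    unfold en
    rw [Finset.card_filter, Finset.sum_product]
    push_cast
    rw [Finset.mul_sum]
    simp_rw [Finset.mul_sum]
    refine Finset.sum_congr rfl fun x _ => Finset.sum_congr rfl fun y _ => ?_
    split_ifs <;> simp
  exact_mod_cast key

lemma map_sum_char {ι G : Type*} [AddCommGroup G] (ψ : AddChar G ℂ) (s : Finset ι) (f : ι → G) :
    ψ (∑ i ∈ s, f i) = ∏ i ∈ s, ψ (f i) := by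
  classical
  induction s using Finset.induction_on with
  | empty => simp
  | insert a s ha ih => rw [Finset.sum_insert ha, Finset.prod_insert ha, AddChar.map_add_eq_mul, ih]

lemma fourier_en_prod {ι κ α : Type*} [Fintype ι] [DecidableEq ι] (U : Finset κ) (X : Finset α)
    (φ : κ → G) (w : α → G) :
    ∑ ψ : AddChar G ℂ, ‖∑ u ∈ U, ψ (φ u)‖ ^ 2 * ‖∑ x ∈ X, ψ (w x)‖ ^ (2 * Fintype.card ι) =
      (Fintype.card G : ℝ) * en (U ×ˢ Fintype.piFinset (fun _ : ι => X))
        (fun p => φ p.1 + ∑ i, w (p.2 i)) := by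
  rw [← fourier_en]
  refine Finset.sum_congr rfl fun ψ _ => ?_
  have : ∑ p ∈ U ×ˢ Fintype.piFinset (fun _ : ι => X), ψ (φ p.1 + ∑ i, w (p.2 i))
      = (∑ u ∈ U, ψ (φ u)) * (∑ x ∈ X, ψ (w x)) ^ (Fintype.card ι) := by
    rw [Finset.sum_product]
    simp_rw [AddChar.map_add_eq_mul, map_sum_char]
    rw [Finset.sum_mul]
    refine Finset.sum_congr rfl fun u _ => ?_
    rw [← Finset.mul_sum]
    congr 1
    have := Finset.sum_prod_piFinset (ι := ι) X (fun _ x => ψ (w x))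
    rw [this]
    simp
  rw [this, norm_mul, norm_pow, mul_pow, ← pow_mul, mul_comm 2]

lemma holder_fin {ι κ α σ : Type*} [Fintype ι] [DecidableEq ι] [Nonempty ι] [DecidableEq σ]
    (U : Finset κ) (X : Finset α)
    (φ : κ → G) (w : α → G) (C : Finset σ) (c : α → σ) (hc : ∀ x ∈ X, c x ∈ C) (B : ℕ)
    (hB : ∀ a ∈ C, en (U ×ˢ Fintype.piFinset (fun _ : ι => X.filter (fun x => c x = a)))
        (fun p => φ p.1 + ∑ i, w (p.2 i)) ≤ B) :
    en (U ×ˢ Fintype.piFinset (fun _ : ι => X))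
        (fun p => φ p.1 + ∑ i, w (p.2 i)) ≤ C.card ^ (2 * Fintype.card ι) * B := by
  have hG : (0 : ℝ) < Fintype.card G := by exact_mod_cast Fintype.card_pos
  have hι : 0 < Fintype.card ι := Fintype.card_pos
  obtain ⟨n, hn⟩ : ∃ n, 2 * Fintype.card ι = n + 1 := ⟨2 * Fintype.card ι - 1, by omega⟩
  have key : (Fintype.card G : ℝ) * en (U ×ˢ Fintype.piFinset (fun _ : ι => X))
        (fun p => φ p.1 + ∑ i, w (p.2 i)) ≤
      (Fintype.card G : ℝ) * ((C.card : ℝ) ^ n * ∑ a ∈ C, (en (U ×ˢ Fintype.piFinset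
        (fun _ : ι => X.filter (fun x => c x = a))) (fun p => φ p.1 + ∑ i, w (p.2 i)) : ℝ)) := by
    rw [mul_left_comm, Finset.mul_sum]
    rw [← fourier_en_prod]
    simp_rw [← fourier_en_prod]
    rw [Finset.sum_comm, Finset.mul_sum]
    refine Finset.sum_le_sum fun ψ _ => ?_
    rw [← Finset.mul_sum, mul_left_comm]
    refine mul_le_mul_of_nonneg_left ?_ (by positivity)
    rw [← Finset.sum_fiberwise_of_maps_to hc]
    rw [hn]
    have h1 := pow_sum_div_card_le_sum_pow (s := C)
      (f := fun a => ‖∑ x ∈ X with c x = a, ψ (w x)‖) (fun _ _ => norm_nonneg _) n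
    by_cases hC : C.card = 0
    · have : C = ∅ := Finset.card_eq_zero.mp hC
      subst this
      simp
    have hC' : (0 : ℝ) < (C.card : ℝ) := by exact_mod_cast Nat.pos_of_ne_zero hC
    rw [div_le_iff₀ (by positivity)] at h1
    calc _ ≤ (∑ a ∈ C, ‖∑ x ∈ X with c x = a, ψ (w x)‖) ^ (n + 1) := by
          gcongr
          exact norm_sum_le _ _
      _ ≤ _ := by linarith
  have key2 := le_of_mul_le_mul_left key hG
  have key3 : ∑ a ∈ C, (en (U ×ˢ Fintype.piFinset
        (fun _ : ι => X.filter (fun x => c x = a))) (fun p => φ p.1 + ∑ i, w (p.2 i)) : ℝ) ≤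
        C.card * B := by
    rw [← nsmul_eq_mul]
    refine Finset.sum_le_card_nsmul _ _ _ fun a ha => ?_
    exact_mod_cast hB a ha
  have : (en (U ×ˢ Fintype.piFinset (fun _ : ι => X))
        (fun p => φ p.1 + ∑ i, w (p.2 i)) : ℝ) ≤ (C.card : ℝ) ^ (2 * Fintype.card ι) * B := by
    rw [hn, pow_succ, mul_assoc]
    exact key2.trans (by gcongr)
  exact_mod_cast this

end fourier

lemma exists_modulus {ι : Type*} {k : ℕ} (T : Finset ι) (φ : ι → (Fin k → ℤ)) :
    ∃ N : ℕ, N ≠ 0 ∧ ∀ x ∈ T, ∀ y ∈ T,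
      (fun j => ((φ x j : ℤ) : ZMod N)) = (fun j => ((φ y j : ℤ) : ZMod N)) → φ x = φ y := by
  refine ⟨1 + ∑ x ∈ T, ∑ y ∈ T, ∑ j, (φ x j - φ y j).natAbs, by omega, ?_⟩
  intro x hx y hy h
  funext j
  have h1 := congrFun h j
  rw [ZMod.intCast_eq_intCast_iff_dvd_sub] at h1
  have h2 : (φ x j - φ y j).natAbs ≤ ∑ x ∈ T, ∑ y ∈ T, ∑ j, (φ x j - φ y j).natAbs := by
    calc (φ x j - φ y j).natAbs ≤ ∑ j, (φ x j - φ y j).natAbs :=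
          Finset.single_le_sum (f := fun j => (φ x j - φ y j).natAbs) (fun _ _ => Nat.zero_le _)
            (Finset.mem_univ j)
      _ ≤ ∑ y ∈ T, ∑ j, (φ x j - φ y j).natAbs :=
          Finset.single_le_sum (f := fun y => ∑ j, (φ x j - φ y j).natAbs)
            (fun _ _ => Nat.zero_le _) hy
      _ ≤ _ := Finset.single_le_sum (f := fun x => ∑ y ∈ T, ∑ j, (φ x j - φ y j).natAbs)
            (fun _ _ => Nat.zero_le _) hx
  have h3 := Int.natAbs_dvd_natAbs.mpr h1
  have h6 : (φ y j - φ x j).natAbs = (φ x j - φ y j).natAbs := by omega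
  rw [Int.natAbs_natCast, h6] at h3
  by_contra hne
  have h4 : 0 < (φ x j - φ y j).natAbs := Int.natAbs_pos.mpr (sub_ne_zero.mpr hne)
  have h5 := Nat.le_of_dvd h4 h3
  omega

/-- Hölder-type inequality for energies in `ℤ^k`. -/
lemma holder_int {ι κ α σ : Type*} {k : ℕ} [Fintype ι] [DecidableEq ι] [Nonempty ι] [DecidableEq σ]
    (U : Finset κ) (X : Finset α)
    (φ : κ → (Fin k → ℤ)) (w : α → (Fin k → ℤ)) (C : Finset σ) (c : α → σ)
    (hc : ∀ x ∈ X, c x ∈ C) (B : ℕ)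
    (hB : ∀ a ∈ C, en (U ×ˢ Fintype.piFinset (fun _ : ι => X.filter (fun x => c x = a)))
        (fun p => φ p.1 + ∑ i, w (p.2 i)) ≤ B) :
    en (U ×ˢ Fintype.piFinset (fun _ : ι => X))
        (fun p => φ p.1 + ∑ i, w (p.2 i)) ≤ C.card ^ (2 * Fintype.card ι) * B := by
  obtain ⟨N, hN, hinj⟩ := exists_modulus (U ×ˢ Fintype.piFinset (fun _ : ι => X))
        (fun p => φ p.1 + ∑ i, w (p.2 i))
  have : NeZero N := ⟨hN⟩
  have hcast : ∀ p : κ × (ι → α), (fun j => (((φ p.1 + ∑ i, w (p.2 i)) j : ℤ) : ZMod N)) =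
      (fun j => ((φ p.1 j : ℤ) : ZMod N)) + ∑ i, (fun j => ((w (p.2 i) j : ℤ) : ZMod N)) := by
    intro p
    funext j
    simp
  refine (en_le_of_imp _ _ (fun p => (fun j => ((φ p.1 j : ℤ) : ZMod N)) +
    ∑ i, (fun j => ((w (p.2 i) j : ℤ) : ZMod N))) ?_).trans
    (holder_fin (G := Fin k → ZMod N) U X (fun u j => ((φ u j : ℤ) : ZMod N))
      (fun x j => ((w x j : ℤ) : ZMod N)) C c hc B ?_)
  · intro x _ y _ h
    rw [← hcast, ← hcast, h]
  · intro a ha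
    refine (en_le_of_imp _ _ _ ?_).trans (hB a ha)
    intro x hx y hy h
    rw [← hcast, ← hcast] at h
    have hsub : U ×ˢ Fintype.piFinset (fun _ : ι => X.filter (fun x => c x = a)) ⊆
        U ×ˢ Fintype.piFinset (fun _ : ι => X) := by
      refine Finset.product_subset_product subset_rfl ?_
      exact Fintype.piFinset_subset _ _ (fun _ => Finset.filter_subset _ _)
    exact hinj x (hsub hx) y (hsub hy) h

end VMV

namespace VMV

lemma aeval_esymm_eq {k : ℕ} {R : Type*} [CommRing R]
    (hinv : ∀ j : ℕ, 1 ≤ j → j ≤ k → IsUnit (j : R)) (x y : Fin k → R)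
    (h : ∀ j : ℕ, 1 ≤ j → j ≤ k → ∑ i, x i ^ j = ∑ i, y i ^ j) (j : ℕ) (hj : j ≤ k) :
    MvPolynomial.aeval x (MvPolynomial.esymm (Fin k) R j) =
      MvPolynomial.aeval y (MvPolynomial.esymm (Fin k) R j) := by
  induction j using Nat.strong_induction_on with
  | _ j ih =>
    rcases Nat.eq_zero_or_pos j with rfl | hpos
    · simp
    · have hx := congrArg (MvPolynomial.aeval x) (MvPolynomial.mul_esymm_eq_sum (Fin k) R j)
      have hy := congrArg (MvPolynomial.aeval y) (MvPolynomial.mul_esymm_eq_sum (Fin k) R j)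
      refine (hinv j hpos hj).mul_left_cancel ?_
      simp only [map_mul, map_natCast, map_sum, map_pow, map_neg, map_one] at hx hy
      rw [hx, hy]
      congr 1
      refine Finset.sum_congr rfl fun a ha => ?_
      simp only [Finset.mem_filter, Finset.HasAntidiagonal.mem_antidiagonal] at ha
      rw [ih a.1 ha.2 (by omega)]
      congr 1
      simp only [MvPolynomial.psum, map_sum, map_pow, MvPolynomial.aeval_X]
      exact h a.2 (by omega) (by omega)

lemma prod_add_eq_sum_esymm {k : ℕ} {R : Type*} [CommRing R] (z : Fin k → R) (t : R) :
    ∏ i, (t + z i) = ∑ j ∈ Finset.range (k + 1),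
      MvPolynomial.aeval z (MvPolynomial.esymm (Fin k) R j) * t ^ (k - j) := by
  have := congrArg (fun q => (Polynomial.map (MvPolynomial.aeval z).toRingHom q).eval t)
    (MvPolynomial.prod_C_add_X_eq_sum_esymm R (Fin k))
  simpa [Polynomial.map_prod, Polynomial.eval_prod, Polynomial.map_sum, Polynomial.eval_finsetSum]
    using this

lemma prod_sub_eq_of_psum {k : ℕ} {R : Type*} [CommRing R]
    (hinv : ∀ j : ℕ, 1 ≤ j → j ≤ k → IsUnit (j : R)) (x y : Fin k → R)
    (h : ∀ j : ℕ, 1 ≤ j → j ≤ k → ∑ i, x i ^ j = ∑ i, y i ^ j) (t : R) :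
    ∏ i, (t - x i) = ∏ i, (t - y i) := by
  have h1 : ∏ i, (-t + x i) = ∏ i, (-t + y i) := by
    rw [prod_add_eq_sum_esymm, prod_add_eq_sum_esymm]
    refine Finset.sum_congr rfl fun j hj => ?_
    rw [aeval_esymm_eq hinv x y h j (by simpa [Nat.lt_succ_iff] using hj)]
  have h2 : ∀ z : Fin k → R, ∏ i, (t - z i) = (-1) ^ k * ∏ i, (-t + z i) := by
    intro z
    have : ∀ i, t - z i = (-1) * (-t + z i) := fun i => by ring
    simp_rw [this, Finset.prod_mul_distrib]
    simp
  rw [h2, h2, h1]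

lemma linnik_fiber {p k : ℕ} (hp : p.Prime) (hpk : k < p) {X : ℕ} (hX : X ≤ p ^ k) (a : ℤ)
    (u u' : Fin k → ℕ) (hu : ∀ i, u i < X) (hu' : ∀ i, u' i < X)
    (hd' : ∀ i j, u' i % p = u' j % p → i = j)
    (h : ∀ j : ℕ, 1 ≤ j → j ≤ k →
      (p : ℤ) ^ k ∣ ∑ i, ((u i : ℤ) - a) ^ j - ∑ i, ((u' i : ℤ) - a) ^ j) (i : Fin k) :
    ∃ l, u i = u' l := by
  have hpz : Prime (p : ℤ) := Nat.prime_iff_prime_int.mp hp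
  have hunit : ∀ j : ℕ, 1 ≤ j → j ≤ k → IsUnit (j : ZMod (p ^ k)) := by
    intro j h1 h2
    rw [ZMod.isUnit_iff_coprime]
    refine Nat.Coprime.pow_right _ ?_
    rw [Nat.coprime_comm, hp.coprime_iff_not_dvd]
    intro hd
    have := Nat.le_of_dvd (by omega) hd
    omega
  have key := prod_sub_eq_of_psum (R := ZMod (p ^ k)) hunit
    (fun i => (((u i : ℤ) - a : ℤ) : ZMod (p ^ k))) (fun i => (((u' i : ℤ) - a : ℤ) : ZMod (p ^ k)))
    (by
      intro j h1 h2
      have := h j h1 h2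
      have h3 : ((p ^ k : ℕ) : ℤ) ∣ ∑ i, ((u i : ℤ) - a) ^ j - ∑ i, ((u' i : ℤ) - a) ^ j := by
        exact_mod_cast this
      have h4 := (ZMod.intCast_zmod_eq_zero_iff_dvd _ _).mpr h3
      rw [Int.cast_sub, sub_eq_zero] at h4
      simpa using h4) ((((u i : ℤ) - a : ℤ) : ZMod (p ^ k)))
  rw [Finset.prod_eq_zero (Finset.mem_univ i) (by simp)] at key
  have hdvd : (p : ℤ) ^ k ∣ ∏ l, ((u i : ℤ) - u' l) := by
    have h3 : ((p ^ k : ℕ) : ℤ) ∣ ∏ l, ((u i : ℤ) - u' l) := by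
      rw [← ZMod.intCast_zmod_eq_zero_iff_dvd]
      push_cast
      rw [key]
      refine Finset.prod_congr rfl fun l _ => ?_
      push_cast
      ring
    exact_mod_cast h3
  have hk : k ≠ 0 := fun h0 => by subst h0; exact i.elim0
  have hp1 : (p : ℤ) ∣ ∏ l, ((u i : ℤ) - u' l) := (dvd_pow_self _ hk).trans hdvd
  obtain ⟨l, -, hl⟩ := (hpz.dvd_finsetProd_iff _).mp hp1
  refine ⟨l, ?_⟩
  rw [← Finset.mul_prod_erase _ _ (Finset.mem_univ l)] at hdvd
  have hcop : IsCoprime ((p : ℤ) ^ k) (∏ l' ∈ Finset.univ.erase l, ((u i : ℤ) - u' l')) := by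
    refine IsCoprime.pow_left ?_
    refine IsCoprime.prod_right fun l' hl' => ?_
    rw [Prime.coprime_iff_not_dvd hpz]
    intro hd
    have hne : l' ≠ l := (Finset.mem_erase.mp hl').1
    apply hne
    apply hd'
    have h5 : (p : ℤ) ∣ (u' l : ℤ) - u' l' := by
      have := dvd_sub hd hl
      simpa using this
    have h6 : (u' l' : ℤ) ≡ u' l [ZMOD p] := Int.modEq_iff_dvd.mpr h5
    exact (Int.natCast_modEq_iff.mp h6)
  have h7 := hcop.dvd_of_dvd_mul_right hdvd
  have h8 : (p : ℤ) ^ k = ((p ^ k : ℕ) : ℤ) := by push_cast; rfl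
  have h9 : |(u i : ℤ) - u' l| < (p : ℤ) ^ k := by
    have := hu i
    have := hu' l
    rw [h8, abs_lt]
    constructor <;> omega
  have h10 := Int.eq_zero_of_abs_lt_dvd h7 h9
  omega

/-- The lemma of Linnik. -/
lemma linnik {p k : ℕ} (hp : p.Prime) (hpk : k < p) {X : ℕ} (hX : X ≤ p ^ k) (a : ℤ)
    (t : Fin k → ℤ) :
    ((Fintype.piFinset (fun _ : Fin k => Finset.range X)).filter (fun u =>
      (∀ i j, u i % p = u j % p → i = j) ∧
      ∀ j : Fin k, (p : ℤ) ^ ((j : ℕ) + 1) ∣ ∑ i, ((u i : ℤ) - a) ^ ((j : ℕ) + 1) - t j)).card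
      ≤ k ^ k * p ^ (k * (k - 1) / 2) := by
  classical
  set S := (Fintype.piFinset (fun _ : Fin k => Finset.range X)).filter (fun u =>
      (∀ i j, u i % p = u j % p → i = j) ∧
      ∀ j : Fin k, (p : ℤ) ^ ((j : ℕ) + 1) ∣ ∑ i, ((u i : ℤ) - a) ^ ((j : ℕ) + 1) - t j) with hS
  let F : (Fin k → ℕ) → (Fin k → ℤ) := fun u j =>
    ((∑ i, ((u i : ℤ) - a) ^ ((j : ℕ) + 1) - t j) / (p : ℤ) ^ ((j : ℕ) + 1)) %
      ((p ^ (k - 1 - (j : ℕ)) : ℕ) : ℤ)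
  have hppos : 0 < p := hp.pos
  have himg : (S.image F).card ≤ p ^ (k * (k - 1) / 2) := by
    have hsub : S.image F ⊆ Fintype.piFinset
        (fun j : Fin k => Finset.Ico (0 : ℤ) ((p ^ (k - 1 - (j : ℕ)) : ℕ) : ℤ)) := by
      intro v hv
      obtain ⟨u, _, rfl⟩ := Finset.mem_image.mp hv
      rw [Fintype.mem_piFinset]
      intro j
      rw [Finset.mem_Ico]
      have hpos : (0 : ℤ) < ((p ^ (k - 1 - (j : ℕ)) : ℕ) : ℤ) := by positivity
      exact ⟨Int.emod_nonneg _ hpos.ne', Int.emod_lt_of_pos _ hpos⟩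
    refine (Finset.card_le_card hsub).trans (le_of_eq ?_)
    rw [Fintype.card_piFinset]
    simp only [Int.card_Ico, sub_zero, Int.toNat_natCast]
    rw [Finset.prod_pow_eq_pow_sum]
    congr 1
    rw [Fin.sum_univ_eq_sum_range (fun j => k - 1 - j) k, Finset.sum_range_reflect (fun j => j) k,
      Finset.sum_range_id]
  refine (Finset.card_le_mul_card_image (f := F) S (k ^ k) ?_).trans
    (Nat.mul_le_mul_left _ himg)
  intro b hb
  obtain ⟨u', hu', rfl⟩ := Finset.mem_image.mp hb
  have hsub : S.filter (fun u => F u = F u') ⊆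
      (Finset.univ : Finset (Fin k → Fin k)).image (fun τ => u' ∘ τ) := by
    intro u hu
    rw [Finset.mem_filter] at hu
    have h1 := hu.1
    rw [hS, Finset.mem_filter, Fintype.mem_piFinset] at h1 hu'
    have h2 : ∀ i, ∃ l, u i = u' l := by
      refine linnik_fiber hp hpk hX a u u' (fun i => Finset.mem_range.mp (h1.1 i))
        (fun i => Finset.mem_range.mp (hu'.1 i)) hu'.2.1 ?_
      intro j hj1 hj2
      have h3 := congrFun hu.2 ⟨j - 1, by omega⟩
      have h4 := h1.2.2 ⟨j - 1, by omega⟩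
      have h5 := hu'.2.2 ⟨j - 1, by omega⟩
      simp only [F] at h3
      simp only [Nat.sub_add_cancel hj1] at h3 h4 h5
      obtain ⟨c, hc⟩ := h4
      obtain ⟨c', hc'⟩ := h5
      have hpj : (p : ℤ) ^ j ≠ 0 := by positivity
      rw [hc, hc', Int.mul_ediv_cancel_left _ hpj, Int.mul_ediv_cancel_left _ hpj] at h3
      have h7 : ((p ^ (k - 1 - (j - 1)) : ℕ) : ℤ) ∣ c - c' := Int.ModEq.dvd h3.symm
      have h8 : ∑ i, ((u i : ℤ) - a) ^ j - ∑ i, ((u' i : ℤ) - a) ^ j = (p : ℤ) ^ j * (c - c') := by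
        linarith
      rw [h8]
      have h9 : (p : ℤ) ^ k = (p : ℤ) ^ j * ((p ^ (k - 1 - (j - 1)) : ℕ) : ℤ) := by
        push_cast
        rw [← pow_add]
        congr 1
        omega
      rw [h9]
      exact mul_dvd_mul_left _ h7
    choose τ hτ using h2
    exact Finset.mem_image.mpr ⟨τ, Finset.mem_univ _, (funext hτ).symm⟩
  refine (Finset.card_le_card hsub).trans (Finset.card_image_le.trans ?_)
  simp

end VMV

namespace VMV

/-- The moment curve. -/
def mom (k : ℕ) (n : ℕ) : Fin k → ℤ := fun j => (n : ℤ) ^ ((j : ℕ) + 1)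

/-- The Vinogradov mean value. -/
def J (k : ℕ) (ι : Type*) [Fintype ι] [DecidableEq ι] (X : ℕ) : ℕ :=
  en (Fintype.piFinset (fun _ : ι => Finset.range X)) (fun z => ∑ i, mom k (z i))

lemma en_le_of_inj {ι κ G G' : Type*} [DecidableEq G] [DecidableEq G'] (T : Finset ι)
    (S : Finset κ) (φ : ι → G) (χ : κ → G') (e : ι → κ)
    (he : Set.InjOn e T) (hm : ∀ x ∈ T, e x ∈ S)
    (hφ : ∀ x ∈ T, ∀ y ∈ T, φ x = φ y → χ (e x) = χ (e y)) :
    en T φ ≤ en S χ :=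
  (en_le_of_imp T φ (fun x => χ (e x)) hφ).trans
    (en_le_of_map T S _ χ e he hm (fun _ _ => rfl))

lemma J_congr {k : ℕ} {ι κ : Type*} [Fintype ι] [DecidableEq ι] [Fintype κ] [DecidableEq κ]
    (e : ι ≃ κ) (X : ℕ) : J k ι X ≤ J k κ X := by
  unfold J
  refine en_le_of_map _ _ _ _ (fun z => z ∘ e.symm) ?_ ?_ ?_
  · intro x _ y _ h
    funext i
    have := congrFun h (e i)
    simpa using this
  · intro x hx
    rw [Fintype.mem_piFinset] at hx ⊢
    intro i
    exact hx _
  · intro x _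
    exact Equiv.sum_comp e.symm (fun i => mom k (x i))

lemma shift_pow {ι : Type*} [Fintype ι] (k : ℕ) (x y : ι → ℤ)
    (h : ∀ j : Fin k, ∑ i, x i ^ ((j : ℕ) + 1) = ∑ i, y i ^ ((j : ℕ) + 1)) (a : ℤ) (j : ℕ)
    (hj : j ≤ k) : ∑ i, (x i - a) ^ j = ∑ i, (y i - a) ^ j := by
  simp_rw [sub_eq_add_neg, add_pow]
  rw [Finset.sum_comm]
  conv_rhs => rw [Finset.sum_comm]
  refine Finset.sum_congr rfl fun m hm => ?_
  rw [Finset.mem_range] at hm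
  simp_rw [mul_assoc]
  rw [← Finset.sum_mul, ← Finset.sum_mul]
  congr 1
  rcases Nat.eq_zero_or_pos m with rfl | hpos
  · simp
  · have := h ⟨m - 1, by omega⟩
    simpa [Nat.sub_add_cancel hpos] using this

lemma mom_sum_apply {ι : Type*} [Fintype ι] (k : ℕ) (z : ι → ℕ) (j : Fin k) :
    (∑ i, mom k (z i)) j = ∑ i, (z i : ℤ) ^ ((j : ℕ) + 1) := by
  simp [mom, Finset.sum_apply]

lemma en_class_le {k p X a : ℕ} (hp : 0 < p) {ι : Type*} [Fintype ι] [DecidableEq ι] :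
    en (Fintype.piFinset (fun _ : ι => (Finset.range X).filter (fun x => x % p = a)))
      (fun z => ∑ i, mom k (z i)) ≤ J k ι (X / p + 1) := by
  unfold J
  have hz : ∀ z ∈ Fintype.piFinset
      (fun _ : ι => (Finset.range X).filter (fun x => x % p = a)),
      ∀ i, (z i : ℤ) - a = p * ((z i / p : ℕ) : ℤ) := by
    intro z hz i
    rw [Fintype.mem_piFinset] at hz
    have h1 := hz i
    rw [Finset.mem_filter] at h1
    have h2 := Nat.div_add_mod (z i) p
    rw [h1.2] at h2
    have : ((p * (z i / p) + a : ℕ) : ℤ) = z i := by rw [h2]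
    push_cast at this ⊢
    linarith
  refine en_le_of_inj _ _ _ _ (fun z i => z i / p) ?_ ?_ ?_
  · intro x hx y hy h
    funext i
    have h1 := hz x hx i
    have h2 := hz y hy i
    have h3 := congrFun h i
    simp only at h3
    rw [h3] at h1
    omega
  · intro x hx
    rw [Fintype.mem_piFinset] at hx ⊢
    intro i
    have h1 := hx i
    rw [Finset.mem_filter, Finset.mem_range] at h1
    rw [Finset.mem_range]
    exact Nat.lt_succ_of_le (Nat.div_le_div_right h1.1.le)
  · intro x hx y hy h
    funext j
    rw [mom_sum_apply, mom_sum_apply]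
    have h1 := shift_pow k (fun i => (x i : ℤ)) (fun i => (y i : ℤ)) (by
      intro j
      rw [← mom_sum_apply, ← mom_sum_apply, h]) a (j + 1) j.2
    simp only [hz x hx, hz y hy, mul_pow] at h1
    rw [← Finset.mul_sum, ← Finset.mul_sum] at h1
    exact mul_left_cancel₀ (by positivity) h1

lemma en_good_le {k p X a : ℕ} (hp : p.Prime) (hpk : k < p) (hX : X ≤ p ^ k)
    {ι : Type*} [Fintype ι] [DecidableEq ι] :
    en (((Fintype.piFinset (fun _ : Fin k => Finset.range X)).filter
        (fun u => ∀ i j, u i % p = u j % p → i = j)) ×ˢ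
      (Fintype.piFinset (fun _ : ι => (Finset.range X).filter (fun x => x % p = a))))
      (fun q => ∑ i, mom k (q.1 i) + ∑ i, mom k (q.2 i))
      ≤ J k ι (X / p + 1) * ((k ^ k * p ^ (k * (k - 1) / 2)) * X ^ k) := by
  classical
  have hp0 : 0 < p := hp.pos
  set U := (Fintype.piFinset (fun _ : Fin k => Finset.range X)).filter
        (fun u => ∀ i j, u i % p = u j % p → i = j) with hU
  set Z := Fintype.piFinset (fun _ : ι => (Finset.range X).filter (fun x => x % p = a)) with hZ
  have hz : ∀ z ∈ Z, ∀ i, (z i : ℤ) - a = p * ((z i / p : ℕ) : ℤ) := by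
    intro z hz i
    rw [hZ, Fintype.mem_piFinset] at hz
    have h1 := hz i
    rw [Finset.mem_filter] at h1
    have h2 := Nat.div_add_mod (z i) p
    rw [h1.2] at h2
    have : ((p * (z i / p) + a : ℕ) : ℤ) = z i := by rw [h2]
    push_cast at this ⊢
    linarith
  set V := (U ×ˢ U).filter (fun q => ∀ j : Fin k, (p : ℤ) ^ ((j : ℕ) + 1) ∣
    ∑ i, ((q.1 i : ℤ) - a) ^ ((j : ℕ) + 1) - ∑ i, ((q.2 i : ℤ) - a) ^ ((j : ℕ) + 1)) with hV
  have hVcard : V.card ≤ (k ^ k * p ^ (k * (k - 1) / 2)) * X ^ k := by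
    have hUc : U.card ≤ X ^ k := by
      refine (Finset.card_filter_le _ _).trans ?_
      simp [Fintype.card_piFinset]
    refine (Finset.card_le_mul_card_image_of_maps_to (f := Prod.snd) (t := U) ?_
      (k ^ k * p ^ (k * (k - 1) / 2)) ?_).trans (Nat.mul_le_mul_left _ hUc)
    · intro q hq
      rw [hV, Finset.mem_filter, Finset.mem_product] at hq
      exact hq.1.2
    · intro u' hu'
      refine le_trans (Finset.card_le_card_of_injOn Prod.fst ?_ ?_) (linnik hp hpk hX a
        (fun j => ∑ i, ((u' i : ℤ) - a) ^ ((j : ℕ) + 1)))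
      · intro q hq
        simp only [hV, hU, Finset.coe_filter, Finset.mem_filter, Finset.mem_product,
          Set.mem_ofPred_eq] at hq ⊢
        obtain ⟨⟨⟨h1, h2⟩, h3⟩, h4⟩ := hq
        subst h4
        exact ⟨h1.1, h1.2, h3⟩
      · intro q hq q' hq' h
        simp only [Finset.coe_filter, Set.mem_ofPred_eq] at hq hq'
        exact Prod.ext h (hq.2.trans hq'.2.symm)
  have hshift : ∀ u ∈ U, ∀ u' ∈ U, ∀ z ∈ Z, ∀ z' ∈ Z,
      ∑ i, mom k (u i) + ∑ i, mom k (z i) = ∑ i, mom k (u' i) + ∑ i, mom k (z' i) →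
      ∀ j : Fin k, ∑ i, ((u i : ℤ) - a) ^ ((j : ℕ) + 1) - ∑ i, ((u' i : ℤ) - a) ^ ((j : ℕ) + 1) =
        (p : ℤ) ^ ((j : ℕ) + 1) * (∑ i, ((z' i / p : ℕ) : ℤ) ^ ((j : ℕ) + 1) -
          ∑ i, ((z i / p : ℕ) : ℤ) ^ ((j : ℕ) + 1)) := by
    intro u _ u' _ z hz1 z' hz1' h j
    have h1 := shift_pow k (Sum.elim (fun i => (u i : ℤ)) (fun i => (z i : ℤ)))
      (Sum.elim (fun i => (u' i : ℤ)) (fun i => (z' i : ℤ))) (by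
        intro j
        have := congrFun h j
        simp only [Pi.add_apply, mom_sum_apply] at this
        simpa [Fintype.sum_sum_type] using this) a (j + 1) j.2
    simp only [Fintype.sum_sum_type, Sum.elim_inl, Sum.elim_inr, hz z hz1, hz z' hz1', mul_pow] at h1
    rw [← Finset.mul_sum, ← Finset.mul_sum] at h1
    linarith
  unfold en
  refine (Finset.card_le_mul_card_image_of_maps_to (f := fun q => (q.1.1, q.2.1)) (t := V) ?_
      (J k ι (X / p + 1)) ?_).trans (Nat.mul_le_mul_left _ hVcard)
  · rintro ⟨⟨u, z⟩, ⟨u', z'⟩⟩ hq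
    simp only [Finset.mem_filter, Finset.mem_product] at hq
    obtain ⟨⟨⟨h1, h2⟩, h3, h4⟩, h5⟩ := hq
    rw [hV, Finset.mem_filter, Finset.mem_product]
    refine ⟨⟨h1, h3⟩, fun j => ?_⟩
    simp only
    rw [hshift u h1 u' h3 z h2 z' h4 h5 j]
    exact dvd_mul_right _ _
  · rintro ⟨u, u'⟩ huu
    unfold J
    refine le_trans (Finset.card_le_card_of_injOn
      (fun q => ((fun i => q.1.2 i / p), (fun i => q.2.2 i / p))) ?_ ?_)
      (card_shift_le (Fintype.piFinset (fun _ : ι => Finset.range (X / p + 1)))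
        (fun z => ∑ i, mom k (z i)) (fun j => - ((∑ i, ((u i : ℤ) - a) ^ ((j : ℕ) + 1) -
          ∑ i, ((u' i : ℤ) - a) ^ ((j : ℕ) + 1)) / (p : ℤ) ^ ((j : ℕ) + 1))))
    · have hr : ∀ z ∈ Z, (fun i => z i / p) ∈
          Fintype.piFinset (fun _ : ι => Finset.range (X / p + 1)) := by
        intro z hz
        rw [hZ, Fintype.mem_piFinset] at hz
        rw [Fintype.mem_piFinset]
        intro i
        have h1 := hz i
        rw [Finset.mem_filter, Finset.mem_range] at h1
        rw [Finset.mem_range]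
        exact Nat.lt_succ_of_le (Nat.div_le_div_right h1.1.le)
      rintro ⟨⟨v, z⟩, ⟨v', z'⟩⟩ hq
      simp only [Finset.coe_filter, Finset.mem_filter, Finset.mem_product,
          Set.mem_ofPred_eq, Prod.mk.injEq] at hq ⊢
      obtain ⟨⟨⟨⟨h1, h2⟩, h3, h4⟩, h5⟩, rfl, rfl⟩ := hq
      refine ⟨⟨hr z h2, hr z' h4⟩, ?_⟩
      funext j
      rw [Pi.add_apply, mom_sum_apply, mom_sum_apply, hshift v h1 v' h3 z h2 z' h4 h5 j,
        Int.mul_ediv_cancel_left _ (by positivity)]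
      ring
    · have hinj : ∀ z ∈ Z, ∀ z' ∈ Z, (fun i => z i / p) = (fun i => z' i / p) → z = z' := by
        intro x hx y hy h
        funext i
        have h1 := hz x hx i
        have h2 := hz y hy i
        have h3 := congrFun h i
        rw [h3] at h1
        omega
      rintro ⟨⟨v, z⟩, ⟨v', z'⟩⟩ hq ⟨⟨y, w⟩, ⟨y', w'⟩⟩ hq' h
      simp only [Finset.coe_filter, Finset.mem_filter, Finset.mem_product,
          Set.mem_ofPred_eq, Prod.mk.injEq] at hq hq' h
      obtain ⟨⟨⟨⟨_, h2⟩, _, h4⟩, _⟩, rfl, rfl⟩ := hq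
      obtain ⟨⟨⟨⟨_, h2'⟩, _, h4'⟩, _⟩, rfl, rfl⟩ := hq'
      rw [hinj z h2 w h2' h.1, hinj z' h4 w' h4' h.2]

lemma J_sum_le {k Y : ℕ} {ι : Type*} [Fintype ι] [DecidableEq ι] :
    J k (Fin k ⊕ ι) Y ≤ J k ι Y * Y ^ (2 * k) := by
  classical
  set U := Fintype.piFinset (fun _ : Fin k => Finset.range Y) with hU
  have hUc : (U ×ˢ U).card = Y ^ (2 * k) := by
    rw [Finset.card_product, hU, Fintype.card_piFinset]
    simp [two_mul, pow_add]
  rw [← hUc]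
  unfold J
  conv_lhs => unfold en
  refine Finset.card_le_mul_card_image_of_maps_to
    (f := fun q => (fun i => q.1 (Sum.inl i), fun i => q.2 (Sum.inl i))) ?_ _ ?_
  · rintro ⟨x, y⟩ hq
    simp only [Finset.mem_filter, Finset.mem_product, Fintype.mem_piFinset, hU] at hq ⊢
    exact ⟨fun i => hq.1.1 _, fun i => hq.1.2 _⟩
  · rintro ⟨u, u'⟩ _
    refine le_trans (Finset.card_le_card_of_injOn
      (fun q => ((fun i => q.1 (Sum.inr i)), (fun i => q.2 (Sum.inr i)))) ?_ ?_)
      (card_shift_le (Fintype.piFinset (fun _ : ι => Finset.range Y))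
        (fun z => ∑ i, mom k (z i)) (∑ i, mom k (u' i) - ∑ i, mom k (u i)))
    · rintro ⟨x, y⟩ hq
      simp only [Finset.coe_filter, Finset.mem_filter, Finset.mem_product,
          Set.mem_ofPred_eq, Prod.mk.injEq, Fintype.mem_piFinset, Fintype.sum_sum_type] at hq ⊢
      obtain ⟨⟨⟨h1, h2⟩, h5⟩, rfl, rfl⟩ := hq
      refine ⟨⟨fun i => h1 _, fun i => h2 _⟩, ?_⟩
      rw [add_sub, eq_sub_iff_add_eq, add_comm, h5, add_comm]
    · rintro ⟨x, y⟩ hq ⟨x', y'⟩ hq' h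
      simp only [Finset.coe_filter, Finset.mem_filter, 
          Set.mem_ofPred_eq, Prod.mk.injEq] at hq hq' h ⊢
      constructor
      · funext i
        rcases i with i | i
        · exact congrFun (hq.2.1.trans hq'.2.1.symm) i
        · exact congrFun h.1 i
      · funext i
        rcases i with i | i
        · exact congrFun (hq.2.2.trans hq'.2.2.symm) i
        · exact congrFun h.2 i

end VMV

namespace VMV

lemma good_perm_le {k p X : ℕ} (hp : p.Prime) (hpk : k < p) (hX : X ≤ p ^ k)
    {ι : Type*} [Fintype ι] [DecidableEq ι] [Nonempty ι] (π : Equiv.Perm (Fin k ⊕ ι)) :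
    en ((Fintype.piFinset (fun _ : Fin k ⊕ ι => Finset.range X)).filter
        (fun x => ∀ i j : Fin k, x (π (Sum.inl i)) % p = x (π (Sum.inl j)) % p → i = j))
      (fun z => ∑ i, mom k (z i)) ≤
      p ^ (2 * Fintype.card ι) *
        (J k ι (X / p + 1) * ((k ^ k * p ^ (k * (k - 1) / 2)) * X ^ k)) := by
  classical
  have h1 := holder_int (ι := ι) ((Fintype.piFinset (fun _ : Fin k => Finset.range X)).filter
        (fun u => ∀ i j, u i % p = u j % p → i = j)) (Finset.range X)
      (fun u => ∑ i, mom k (u i)) (mom k) (Finset.range p) (fun x => x % p)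
      (fun x _ => Finset.mem_range.2 (Nat.mod_lt _ hp.pos)) _
      (fun a _ => en_good_le (a := a) hp hpk hX)
  rw [Finset.card_range] at h1
  refine le_trans ?_ h1
  refine en_le_of_map _ _ _ _ (fun x => (fun i => x (π (Sum.inl i)), fun i => x (π (Sum.inr i))))
    ?_ ?_ ?_
  · intro x _ y _ h
    simp only [Prod.mk.injEq] at h
    funext i
    obtain ⟨i, rfl⟩ := π.surjective i
    rcases i with i | i
    · exact congrFun h.1 i
    · exact congrFun h.2 i
  · intro x hx
    rw [Finset.mem_filter, Fintype.mem_piFinset] at hx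
    rw [Finset.mem_product, Finset.mem_filter, Fintype.mem_piFinset, Fintype.mem_piFinset]
    exact ⟨⟨fun i => hx.1 _, hx.2⟩, fun i => hx.1 _⟩
  · intro x _
    rw [← Equiv.sum_comp π (fun i => mom k (x i)), Fintype.sum_sum_type]

lemma bad_le {k p X : ℕ} (hk : 1 ≤ k) (hp : 0 < p) (hpk : k - 1 ≤ p)
    {ι : Type*} [Fintype ι] [DecidableEq ι] :
    en ((Fintype.piFinset (fun _ : Fin k ⊕ ι => Finset.range X)).filter
        (fun x => (Finset.univ.image (fun i => x i % p)).card < k ))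
      (fun z => ∑ i, mom k (z i)) ≤
      p ^ (2 * (k - 1)) * ((k - 1) ^ (2 * (k + Fintype.card ι)) *
        (J k ι (X / p + 1) * (X / p + 1) ^ (2 * k))) := by
  classical
  have hI : ∀ T' ∈ Finset.powersetCard (k - 1) (Finset.range p),
      en ((Fintype.piFinset (fun _ : Fin k ⊕ ι => (Finset.range X).filter
        (fun x => x % p ∈ T')))) (fun z => ∑ i, mom k (z i)) ≤
        (k - 1) ^ (2 * (k + Fintype.card ι)) *
        (J k ι (X / p + 1) * (X / p + 1) ^ (2 * k)) := by
    intro T' hT'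
    rw [Finset.mem_powersetCard] at hT'
    have : Nonempty (Fin k ⊕ ι) := ⟨Sum.inl ⟨0, hk⟩⟩
    have h1 := holder_int (ι := Fin k ⊕ ι) (k := k) (Finset.univ : Finset Unit)
      ((Finset.range X).filter (fun x => x % p ∈ T'))
      (fun _ => 0) (mom k) T' (fun x => x % p)
      (fun x hx => (Finset.mem_filter.1 hx).2) (J k (Fin k ⊕ ι) (X / p + 1)) ?_
    · rw [hT'.2, Fintype.card_sum, Fintype.card_fin] at h1
      refine le_trans ?_ (h1.trans (Nat.mul_le_mul_left _ J_sum_le))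
      refine en_le_of_map _ _ _ _ (fun x => ((), x)) ?_ ?_ ?_
      · intro x _ y _ h
        simpa using h
      · intro x hx
        simpa using hx
      · intro x _
        simp
    · intro a _
      refine le_trans ?_ (en_class_le (a := a) hp)
      refine en_le_of_map _ _ _ _ (fun x => x.2) ?_ ?_ ?_
      · intro x _ y _ h
        ext1
        · rfl
        · exact h
      · intro x hx
        rw [Finset.mem_product, Fintype.mem_piFinset] at hx
        rw [Fintype.mem_piFinset]
        intro i
        have := hx.2 i
        rw [Finset.mem_filter, Finset.mem_filter] at this
        rw [Finset.mem_filter]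
        exact ⟨this.1.1, this.2⟩
      · intro x _
        simp
  refine (en_biUnion_le (Finset.powersetCard (k - 1) (Finset.range p)) _
    (fun T' => (Fintype.piFinset (fun _ : Fin k ⊕ ι => (Finset.range X).filter
        (fun x => x % p ∈ T')))) _ ?_).trans ?_
  · intro x hx
    rw [Finset.mem_filter, Fintype.mem_piFinset] at hx
    obtain ⟨T', h1, h2, h3⟩ := Finset.exists_subsuperset_card_eq
      (s := Finset.univ.image (fun i => x i % p)) (t := Finset.range p) (n := k - 1)
      (by
        intro a ha
        rw [Finset.mem_image] at ha
        obtain ⟨i, _, rfl⟩ := ha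
        exact Finset.mem_range.2 (Nat.mod_lt _ hp)) (by have := hx.2; omega)
      (by rw [Finset.card_range]; exact hpk)
    refine ⟨T', Finset.mem_powersetCard.2 ⟨h2, h3⟩, ?_⟩
    rw [Fintype.mem_piFinset]
    intro i
    rw [Finset.mem_filter]
    exact ⟨hx.1 i, h1 (Finset.mem_image_of_mem _ (Finset.mem_univ i))⟩
  · have hc : (Finset.powersetCard (k - 1) (Finset.range p)).card ≤ p ^ (k - 1) := by
      rw [Finset.card_powersetCard, Finset.card_range]
      exact Nat.choose_le_pow _ _
    refine (Nat.mul_le_mul_left _ (Finset.sum_le_card_nsmul _ _ _ hI)).trans ?_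
    rw [smul_eq_mul, ← mul_assoc]
    refine Nat.mul_le_mul_right _ ?_
    rw [two_mul, pow_add]
    exact Nat.mul_le_mul hc hc

lemma exists_perm {k p : ℕ} {ι : Type*} [Fintype ι] [DecidableEq ι] (x : Fin k ⊕ ι → ℕ)
    (h : k ≤ (Finset.univ.image (fun i => x i % p)).card) :
    ∃ π : Equiv.Perm (Fin k ⊕ ι),
      ∀ i j : Fin k, x (π (Sum.inl i)) % p = x (π (Sum.inl j)) % p → i = j := by
  classical
  obtain ⟨R, hR, hRc⟩ := Finset.exists_subset_card_eq h
  let e : Fin k ≃ R := (Fin.castOrderIso hRc.symm).toEquiv.trans R.equivFin.symm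
  have hpre : ∀ i : Fin k, ∃ y : Fin k ⊕ ι, x y % p = (e i : ℕ) := by
    intro i
    have := hR (e i).2
    rw [Finset.mem_image] at this
    obtain ⟨y, _, hy⟩ := this
    exact ⟨y, hy⟩
  choose g hg using hpre
  have hginj : Function.Injective g := by
    intro i j hij
    apply e.injective
    apply Subtype.ext
    rw [← hg, ← hg, hij]
  let e1 : {y : Fin k ⊕ ι // y ∈ Set.range (Sum.inl : Fin k → Fin k ⊕ ι)} ≃
      {y : Fin k ⊕ ι // y ∈ Set.range g} :=
    (Equiv.ofInjective _ Sum.inl_injective).symm.trans (Equiv.ofInjective g hginj)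
  refine ⟨e1.extendSubtype, ?_⟩
  have key : ∀ i : Fin k, e1.extendSubtype (Sum.inl i) = g i := by
    intro i
    rw [Equiv.extendSubtype_apply_of_mem e1 _ ⟨i, rfl⟩]
    have : (Equiv.ofInjective (Sum.inl : Fin k → Fin k ⊕ ι) Sum.inl_injective).symm
      ⟨Sum.inl i, ⟨i, rfl⟩⟩ = i := by
      rw [Equiv.symm_apply_eq]
      rfl
    simp only [e1, Equiv.trans_apply, this]
    rfl
  intro i j hij
  rw [key, key, hg, hg] at hij
  exact e.injective (Subtype.ext hij)

theorem recursion {k p X : ℕ} (hk : 1 ≤ k) (hp : p.Prime) (hpk : k < p) (hX : X ≤ p ^ k)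
    {ι : Type*} [Fintype ι] [DecidableEq ι] [Nonempty ι] :
    J k (Fin k ⊕ ι) X ≤
      2 * (((k + Fintype.card ι).factorial ^ 2 * (p ^ (2 * Fintype.card ι) *
        (J k ι (X / p + 1) * ((k ^ k * p ^ (k * (k - 1) / 2)) * X ^ k)))) +
      p ^ (2 * (k - 1)) * ((k - 1) ^ (2 * (k + Fintype.card ι)) *
        (J k ι (X / p + 1) * (X / p + 1) ^ (2 * k)))) := by
  classical
  set T := Fintype.piFinset (fun _ : Fin k ⊕ ι => Finset.range X) with hT
  have hmain := en_biUnion_le (Finset.univ : Finset Bool) T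
    (fun b => if b then T.filter (fun x => k ≤ (Finset.univ.image (fun i => x i % p)).card)
      else T.filter (fun x => (Finset.univ.image (fun i => x i % p)).card < k))
    (fun z => ∑ i, mom k (z i)) (by
      intro x hx
      by_cases h : k ≤ (Finset.univ.image (fun i => x i % p)).card
      · exact ⟨true, Finset.mem_univ _, by simp only [if_true, Finset.mem_filter]; exact ⟨hx, h⟩⟩
      · refine ⟨false, Finset.mem_univ _, ?_⟩
        simp only [Bool.false_eq_true, if_false, Finset.mem_filter]
        exact ⟨hx, not_le.1 h⟩)
  rw [Fintype.sum_bool, Finset.card_univ, Fintype.card_bool] at hmain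
  simp only [if_true, Bool.false_eq_true, if_false] at hmain
  unfold J
  refine hmain.trans (Nat.mul_le_mul_left _ (Nat.add_le_add ?_ (bad_le hk hp.pos (by omega))))
  refine (en_biUnion_le (Finset.univ : Finset (Equiv.Perm (Fin k ⊕ ι))) _
    (fun π => T.filter
        (fun x => ∀ i j : Fin k, x (π (Sum.inl i)) % p = x (π (Sum.inl j)) % p → i = j)) _ ?_).trans ?_
  · intro x hx
    rw [Finset.mem_filter] at hx
    obtain ⟨π, hπ⟩ := exists_perm x hx.2
    exact ⟨π, Finset.mem_univ _, Finset.mem_filter.2 ⟨hx.1, hπ⟩⟩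
  · refine (Nat.mul_le_mul_left _ (Finset.sum_le_card_nsmul _ _ _
      (fun π _ => good_perm_le hp hpk hX π))).trans ?_
    rw [smul_eq_mul, ← mul_assoc, Finset.card_univ, Fintype.card_perm, Fintype.card_sum,
      Fintype.card_fin, sq]
    exact le_rfl

end VMV

namespace VMV

lemma exists_p {k X : ℕ} (hk : 2 ≤ k) (hX : 1 ≤ X) : ∃ p : ℕ, p.Prime ∧ k < p ∧ X ≤ p ^ k ∧
    (p : ℝ) ≤ 2 * k * (X : ℝ) ^ (1 / (k : ℝ)) := by
  have hx1 : (1 : ℝ) ≤ X := by exact_mod_cast hX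
  have hk2 : (2 : ℝ) ≤ k := by exact_mod_cast hk
  set x : ℝ := (X : ℝ) ^ (1 / (k : ℝ)) with hx
  have hx0 : 1 ≤ x := Real.one_le_rpow hx1 (by positivity)
  have hxk : x ^ k = X := by
    rw [hx, ← Real.rpow_natCast, ← Real.rpow_mul (by positivity)]
    rw [one_div, inv_mul_cancel₀ (by positivity), Real.rpow_one]
  obtain ⟨p, hp, h1, h2⟩ := Nat.exists_prime_lt_and_le_two_mul (max ⌈x⌉₊ k) (by
    have : k ≤ max ⌈x⌉₊ k := le_max_right _ _
    omega)
  have h3 : ⌈x⌉₊ ≤ max ⌈x⌉₊ k := le_max_left _ _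
  have h4 : k ≤ max ⌈x⌉₊ k := le_max_right _ _
  refine ⟨p, hp, by omega, ?_, ?_⟩
  · have h5 : x ≤ p := (Nat.le_ceil x).trans (by exact_mod_cast (by omega))
    have h6 : x ^ k ≤ (p : ℝ) ^ k := pow_le_pow_left₀ (by linarith) h5 k
    rw [hxk] at h6
    exact_mod_cast h6
  · have h5 : ((max ⌈x⌉₊ k : ℕ) : ℝ) ≤ k * x := by
      rw [Nat.cast_max]
      apply max_le
      · have := Nat.ceil_lt_add_one (show 0 ≤ x by linarith)
        nlinarith
      · nlinarith
    have h6 : (p : ℝ) ≤ 2 * ((max ⌈x⌉₊ k : ℕ) : ℝ) := by exact_mod_cast h2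
    linarith

lemma tri_cast (k : ℕ) : ((k * (k - 1) / 2 : ℕ) : ℝ) = k * ((k : ℝ) - 1) / 2 := by
  rw [← Finset.sum_range_id, Nat.cast_sum]
  induction k with
  | zero => simp
  | succ n ih =>
    rw [Finset.sum_range_succ, ih]
    push_cast
    ring

/-- The recursion in a clean form. -/
lemma recursion' {k s : ℕ} (hk : 2 ≤ k) (hs : k * (k + 1) ≤ 4 * s) : ∃ D : ℝ, 0 < D ∧
    ∀ X p : ℕ, 1 ≤ X → p.Prime → k < p → X ≤ p ^ k →
    ((X / p + 1 : ℕ) : ℝ) ≤ 5 * k * X / p →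
    (J k (Fin (s + k)) X : ℝ) ≤ D * (J k (Fin s) (X / p + 1) * (p : ℝ) ^ (2 * s + k * (k - 1) / 2)
      * (X : ℝ) ^ k) := by
  have hs0 : 0 < s := by nlinarith
  have hkR : (0 : ℝ) < k := by exact_mod_cast (by omega)
  set F : ℝ := (((k + s).factorial : ℕ) : ℝ) with hF
  have hF0 : 0 < F := by rw [hF]; exact_mod_cast Nat.factorial_pos _
  refine ⟨2 * (F ^ 2 * (k : ℝ) ^ k + (k : ℝ) ^ (2 * (k + s)) * (5 * k : ℝ) ^ (2 * k)), by positivity, ?_⟩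
  intro X p hX hp hpk hXp hY
  have : Nonempty (Fin s) := ⟨⟨0, hs0⟩⟩
  have h1 := recursion (ι := Fin s) (by omega) hp hpk hXp
  have h2 : J k (Fin (s + k)) X ≤ J k (Fin k ⊕ Fin s) X :=
    J_congr ((finCongr (by omega)).trans (finSumFinEquiv (m := k) (n := s)).symm) X
  have h3 := h2.trans h1
  rw [Fintype.card_fin] at h3
  have h4 : (J k (Fin (s + k)) X : ℝ) ≤ 2 * ((F ^ 2 * ((p : ℝ) ^ (2 * s) *
        (J k (Fin s) (X / p + 1) * (((k : ℝ) ^ k * (p : ℝ) ^ (k * (k - 1) / 2)) * (X : ℝ) ^ k)))) +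
      (p : ℝ) ^ (2 * (k - 1)) * (((k - 1 : ℕ) : ℝ) ^ (2 * (k + s)) *
        (J k (Fin s) (X / p + 1) * ((X / p + 1 : ℕ) : ℝ) ^ (2 * k)))) := by
    rw [hF]
    exact_mod_cast h3
  refine h4.trans ?_
  set Jv : ℝ := (J k (Fin s) (X / p + 1) : ℝ)
  set Y : ℝ := ((X / p + 1 : ℕ) : ℝ)
  set P : ℝ := (p : ℝ) with hP
  set x : ℝ := (X : ℝ) with hx
  have hx1 : 1 ≤ x := by rw [hx]; exact_mod_cast hX
  have hP1 : 1 ≤ P := by rw [hP]; exact_mod_cast hp.one_lt.le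
  have hJ0 : 0 ≤ Jv := Nat.cast_nonneg _
  have hY0 : 0 ≤ Y := Nat.cast_nonneg _
  have hxP : x ≤ P ^ k := by rw [hx, hP]; exact_mod_cast hXp
  have hbad : P ^ (2 * (k - 1)) * Y ^ (2 * k) ≤ (5 * k : ℝ) ^ (2 * k) *
      (P ^ (2 * s + k * (k - 1) / 2) * x ^ k) := by
    calc P ^ (2 * (k - 1)) * Y ^ (2 * k) ≤ P ^ (2 * k) * (5 * k * x / P) ^ (2 * k) := by
          gcongr
          omega
      _ = (5 * k : ℝ) ^ (2 * k) * (x ^ k * x ^ k) := by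
          rw [div_pow, mul_pow (5 * (k : ℝ)) x]
          field_simp
          ring
      _ ≤ (5 * k : ℝ) ^ (2 * k) * (P ^ (2 * s + k * (k - 1) / 2) * x ^ k) := by
          gcongr
          calc x ^ k ≤ (P ^ k) ^ k := by gcongr
            _ = P ^ (k * k) := by rw [pow_mul]
            _ ≤ P ^ (2 * s + k * (k - 1) / 2) := by
              apply pow_le_pow_right₀ hP1
              have h5 : 2 * (k * (k - 1) / 2) = k * (k - 1) :=
                Nat.mul_div_cancel' (Nat.even_mul_pred_self k).two_dvd
              obtain ⟨m, rfl⟩ : ∃ m, k = m + 1 := ⟨k - 1, by omega⟩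
              simp only [Nat.add_sub_cancel] at h5 ⊢
              nlinarith
  have hk1 : ((k - 1 : ℕ) : ℝ) ^ (2 * (k + s)) ≤ (k : ℝ) ^ (2 * (k + s)) := by
    gcongr
    omega
  have e1 : F ^ 2 * (P ^ (2 * s) * (Jv * ((↑k ^ k * P ^ (k * (k - 1) / 2)) * x ^ k)))
      = F ^ 2 * (k : ℝ) ^ k * (Jv * P ^ (2 * s + k * (k - 1) / 2) * x ^ k) := by
    rw [pow_add]; ring
  have e2 : P ^ (2 * (k - 1)) * (((k - 1 : ℕ) : ℝ) ^ (2 * (k + s)) * (Jv * Y ^ (2 * k)))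
      ≤ (k : ℝ) ^ (2 * (k + s)) * (5 * k : ℝ) ^ (2 * k) *
        (Jv * P ^ (2 * s + k * (k - 1) / 2) * x ^ k) := by
    calc P ^ (2 * (k - 1)) * (((k - 1 : ℕ) : ℝ) ^ (2 * (k + s)) * (Jv * Y ^ (2 * k)))
        = ((k - 1 : ℕ) : ℝ) ^ (2 * (k + s)) * Jv * (P ^ (2 * (k - 1)) * Y ^ (2 * k)) := by ring
      _ ≤ (k : ℝ) ^ (2 * (k + s)) * Jv * ((5 * k : ℝ) ^ (2 * k) *
          (P ^ (2 * s + k * (k - 1) / 2) * x ^ k)) := by gcongr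
      _ = _ := by ring
  rw [e1]
  linarith

/-- The hypothesis propagated by the induction. -/
def Hyp (k s : ℕ) (Δ : ℝ) : Prop := ∃ C : ℝ, 0 < C ∧ ∀ X : ℕ, 1 ≤ X →
  (J k (Fin s) X : ℝ) ≤ C * (X : ℝ) ^ (2 * (s : ℝ) - k * (k + 1) / 2 + Δ)

lemma hyp_step {k s : ℕ} {Δ : ℝ} (hk : 2 ≤ k) (hs : k * (k + 1) ≤ 4 * s) (hΔ0 : 0 ≤ Δ)
    (hΔ : Δ ≤ (k : ℝ) ^ 2) (h : Hyp k s Δ) : Hyp k (s + k) (Δ * (1 - 1 / k)) := by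
  obtain ⟨C, hC, h⟩ := h
  obtain ⟨D, hD, hrec⟩ := recursion' hk hs
  have hkR : (2 : ℝ) ≤ k := by exact_mod_cast hk
  have hk0 : (0 : ℝ) < k := by linarith
  have hsR : (k : ℝ) * (k + 1) ≤ 4 * s := by exact_mod_cast hs
  set E : ℝ := 2 * (s : ℝ) - k * (k + 1) / 2 + Δ with hE
  have hE0 : 0 ≤ E := by rw [hE]; linarith
  refine ⟨D * (C * (5 * k : ℝ) ^ E) * (2 * k : ℝ) ^ ((k : ℝ) ^ 2 - Δ), by positivity, ?_⟩
  intro X hX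
  obtain ⟨p, hp, hpk, hXp, hpx⟩ := exists_p hk hX
  set x : ℝ := (X : ℝ) with hx
  have hx1 : 1 ≤ x := by rw [hx]; exact_mod_cast hX
  have hx0 : 0 < x := by linarith
  set P : ℝ := (p : ℝ) with hP
  have hP1 : 1 ≤ P := by rw [hP]; exact_mod_cast hp.one_lt.le
  have hP0 : 0 < P := by linarith
  have hpX : P ≤ 2 * k * x := by
    refine hpx.trans ?_
    have : x ^ (1 / (k : ℝ)) ≤ x ^ (1 : ℝ) := by
      apply Real.rpow_le_rpow_of_exponent_le hx1
      rw [div_le_one hk0]; linarith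
    rw [Real.rpow_one] at this
    gcongr
  have hY : ((X / p + 1 : ℕ) : ℝ) ≤ 5 * k * X / p := by
    push_cast
    have h1 : ((X / p : ℕ) : ℝ) ≤ x / P := Nat.cast_div_le
    have h2 : 1 ≤ 2 * k * x / P := by rw [le_div_iff₀ hP0]; linarith
    have h3 : 5 * k * x / P = 2 * k * x / P + 3 * k * (x / P) := by ring
    have h4 : 0 ≤ x / P := by positivity
    have : x / P ≤ 3 * k * (x / P) := by nlinarith
    calc ((X / p : ℕ) : ℝ) + 1 ≤ x / P + 2 * k * x / P := add_le_add h1 h2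
      _ ≤ 5 * k * x / P := by rw [h3]; linarith
  have h1 := hrec X p hX hp hpk hXp hY
  have h2 : (J k (Fin s) (X / p + 1) : ℝ) ≤ C * ((5 * k : ℝ) ^ E * x ^ E * P ^ (-E)) := by
    refine (h _ (Nat.le_add_left 1 _)).trans ?_
    gcongr
    calc ((X / p + 1 : ℕ) : ℝ) ^ E ≤ (5 * k * x / P) ^ E :=
          Real.rpow_le_rpow (Nat.cast_nonneg _) hY hE0
      _ = _ := by
        rw [Real.div_rpow (by positivity) (by positivity), Real.mul_rpow (by positivity) (by positivity),
          Real.rpow_neg hP0.le]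
        rfl
  have h3 : P ^ (2 * s + k * (k - 1) / 2) = P ^ (2 * (s : ℝ) + k * ((k : ℝ) - 1) / 2) := by
    rw [← tri_cast, ← Real.rpow_natCast]
    congr 1
    push_cast
    ring
  have h4 : P ^ (-E) * P ^ (2 * (s : ℝ) + k * ((k : ℝ) - 1) / 2) ≤
      (2 * k : ℝ) ^ ((k : ℝ) ^ 2 - Δ) * x ^ (k - Δ / k) := by
    rw [← Real.rpow_add hP0]
    have e1 : -E + (2 * (s : ℝ) + k * ((k : ℝ) - 1) / 2) = (k : ℝ) ^ 2 - Δ := by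
      rw [hE]; ring
    rw [e1]
    calc P ^ ((k : ℝ) ^ 2 - Δ) ≤ (2 * k * x ^ (1 / (k : ℝ))) ^ ((k : ℝ) ^ 2 - Δ) :=
          Real.rpow_le_rpow hP0.le hpx (by linarith)
      _ = _ := by
        rw [Real.mul_rpow (by positivity) (by positivity), ← Real.rpow_mul hx0.le]
        congr 2
        field_simp
  calc (J k (Fin (s + k)) X : ℝ) ≤ D * (J k (Fin s) (X / p + 1) * P ^ (2 * s + k * (k - 1) / 2)
      * x ^ k) := h1
    _ ≤ D * (C * ((5 * k : ℝ) ^ E * x ^ E * P ^ (-E)) * P ^ (2 * s + k * (k - 1) / 2)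
      * x ^ k) := by gcongr
    _ = D * (C * (5 * k : ℝ) ^ E) * (x ^ E * x ^ k) *
        (P ^ (-E) * P ^ (2 * (s : ℝ) + k * ((k : ℝ) - 1) / 2)) := by rw [h3]; ring
    _ ≤ D * (C * (5 * k : ℝ) ^ E) * (x ^ E * x ^ k) *
        ((2 * k : ℝ) ^ ((k : ℝ) ^ 2 - Δ) * x ^ (k - Δ / k)) := by gcongr
    _ = D * (C * (5 * k : ℝ) ^ E) * (2 * k : ℝ) ^ ((k : ℝ) ^ 2 - Δ) *
        (x ^ E * x ^ (k : ℝ) * x ^ (k - Δ / k)) := by rw [Real.rpow_natCast]; ring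
    _ = _ := by
      rw [← Real.rpow_add hx0, ← Real.rpow_add hx0]
      congr 2
      rw [hE]
      push_cast
      field_simp
      ring

lemma hyp_iter {k : ℕ} (hk : 2 ≤ k) (r : ℕ) :
    Hyp k (k ^ 2 + r * k) (k * (k + 1) / 2 * (1 - 1 / k) ^ r) := by
  have hkR : (2 : ℝ) ≤ k := by exact_mod_cast hk
  induction r with
  | zero =>
    rw [zero_mul, add_zero, pow_zero, mul_one]
    refine ⟨1, one_pos, fun X hX => ?_⟩
    rw [sub_add_cancel, one_mul]
    have h1 : J k (Fin (k ^ 2)) X ≤ X ^ (2 * k ^ 2) := by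
      unfold J en
      refine (Finset.card_filter_le _ _).trans ?_
      rw [Finset.card_product, Fintype.card_piFinset]
      simp [two_mul, pow_add]
    have h2 : (J k (Fin (k ^ 2)) X : ℝ) ≤ (X : ℝ) ^ (2 * k ^ 2) := by exact_mod_cast h1
    rw [← Real.rpow_natCast] at h2
    have e : 2 * ((k ^ 2 : ℕ) : ℝ) = ((2 * k ^ 2 : ℕ) : ℝ) := by push_cast; ring
    rw [e]
    exact h2
  | succ r ih =>
    have h0 : 0 ≤ 1 - 1 / (k : ℝ) := by
      rw [sub_nonneg, div_le_one (by linarith)]; linarith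
    have h01 : 1 - 1 / (k : ℝ) ≤ 1 := by
      have : 0 ≤ 1 / (k : ℝ) := by positivity
      linarith
    have hp1 : (1 - 1 / (k : ℝ)) ^ r ≤ 1 := pow_le_one₀ h0 h01
    have hp0 : 0 ≤ (1 - 1 / (k : ℝ)) ^ r := pow_nonneg h0 r
    have := hyp_step hk (s := k ^ 2 + r * k) (by nlinarith) (by positivity) (by
      calc (k : ℝ) * (k + 1) / 2 * (1 - 1 / k) ^ r ≤ (k : ℝ) * (k + 1) / 2 * 1 := by gcongr
        _ ≤ (k : ℝ) ^ 2 := by nlinarith) ih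
    convert this using 1
    · ring
    · rw [pow_succ]; ring

theorem vmvt {k : ℕ} (hk : 2 ≤ k) : ∃ s : ℕ, k ^ 2 ≤ s ∧
    (s : ℝ) ≤ 8 * (k : ℝ) ^ 2 * Real.log k ∧ Hyp k s (1 / 4) := by
  have hkR : (2 : ℝ) ≤ k := by exact_mod_cast hk
  have hk0 : (0 : ℝ) < k := by linarith
  have hlog : 0.69 ≤ Real.log k := by
    have h1 := Real.log_two_gt_d9
    have h2 : Real.log 2 ≤ Real.log k := Real.log_le_log (by norm_num) hkR
    linarith
  set r : ℕ := ⌈4 * k * Real.log k⌉₊ with hr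
  refine ⟨k ^ 2 + r * k, by omega, ?_, ?_⟩
  · have h1 : (r : ℝ) < 4 * k * Real.log k + 1 := Nat.ceil_lt_add_one (by positivity)
    push_cast
    have h2 : (r : ℝ) * k ≤ (4 * k * Real.log k + 1) * k := by gcongr
    have h3 : (k : ℝ) ^ 2 * 0.69 ≤ (k : ℝ) ^ 2 * Real.log k := by gcongr
    nlinarith
  · obtain ⟨C, hC, h⟩ := hyp_iter hk r
    refine ⟨C, hC, fun X hX => (h X hX).trans ?_⟩
    have hx1 : (1 : ℝ) ≤ X := by exact_mod_cast hX
    gcongr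
    have h1 : 4 * k * Real.log k ≤ r := Nat.le_ceil _
    have h2 : 1 - 1 / (k : ℝ) ≤ Real.exp (-(1 / k)) := by
      have := Real.add_one_le_exp (-(1 / (k : ℝ)))
      linarith
    have h0 : 0 ≤ 1 - 1 / (k : ℝ) := by
      rw [sub_nonneg, div_le_one (by linarith)]; linarith
    have h3 : (1 - 1 / (k : ℝ)) ^ r ≤ Real.exp (-(4 * Real.log k)) := by
      calc (1 - 1 / (k : ℝ)) ^ r ≤ Real.exp (-(1 / k)) ^ r := by gcongr
        _ = Real.exp (r * -(1 / k)) := by rw [Real.exp_nat_mul]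
        _ ≤ _ := by
          apply Real.exp_le_exp.2
          rw [mul_neg, neg_le_neg_iff, mul_one_div, le_div_iff₀ hk0]
          linarith
    have h4 : Real.exp (-(4 * Real.log k)) = 1 / (k : ℝ) ^ 4 := by
      rw [Real.exp_neg, one_div]
      congr 1
      have := Real.exp_nat_mul (Real.log k) 4
      rw [Real.exp_log hk0] at this
      exact_mod_cast this
    rw [h4] at h3
    calc (k : ℝ) * (k + 1) / 2 * (1 - 1 / k) ^ r ≤ (k : ℝ) * (k + 1) / 2 * (1 / (k : ℝ) ^ 4) := by
          gcongr
      _ ≤ 1 / 4 := by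
        rw [mul_one_div, div_le_iff₀ (by positivity)]
        have : (4 : ℝ) ≤ (k : ℝ) ^ 2 := by nlinarith
        nlinarith [sq_nonneg ((k : ℝ) - 2)]

end VMV

namespace VMV

/-- Number of solutions with variables in `[0, M)`. -/
def cnt (P : Polynomial ℤ) (K M : ℕ) : ℕ :=
  en (Fintype.piFinset (fun _ : Fin K => Finset.range M)) (fun z => ∑ i, P.eval (z i : ℤ))

lemma eval_mom {d : ℕ} (P : Polynomial ℤ) (hP : P.natDegree = d + 1) (n : ℕ) :
    P.eval (n : ℤ) = P.coeff 0 + ∑ j : Fin (d + 1), P.coeff ((j : ℕ) + 1) * mom (d + 1) n j := by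
  rw [Polynomial.eval_eq_sum_range, hP, Finset.sum_range_succ', add_comm]
  congr 1
  · simp
  · exact (Fin.sum_univ_eq_sum_range (fun j => P.coeff (j + 1) * (n : ℤ) ^ (j + 1)) (d + 1)).symm

lemma sum_eval_mom {d s : ℕ} (P : Polynomial ℤ) (hP : P.natDegree = d + 1) (z : Fin s → ℕ) :
    ∑ i, P.eval (z i : ℤ) = s * P.coeff 0 +
      ∑ j : Fin (d + 1), P.coeff ((j : ℕ) + 1) * (∑ i, mom (d + 1) (z i)) j := by
  simp_rw [eval_mom P hP, Finset.sum_add_distrib, Finset.sum_apply, Finset.mul_sum]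
  congr 1
  · simp
  · rw [Finset.sum_comm]

lemma slicing {d s M : ℕ} (P : Polynomial ℤ) (hP : P.natDegree = d + 1) (hs : 1 ≤ s) (hM : 1 ≤ M) :
    cnt P s M ≤ (3 * s) ^ d * M ^ (d * (d + 1) / 2) * J (d + 1) (Fin s) M := by
  classical
  set T := Fintype.piFinset (fun _ : Fin s => Finset.range M) with hT
  set φ : (Fin s → ℕ) → (Fin (d + 1) → ℤ) := fun z => ∑ i, mom (d + 1) (z i) with hφ
  set S := (T ×ˢ T).filter
    (fun p => ∑ i, P.eval (p.1 i : ℤ) = ∑ i, P.eval (p.2 i : ℤ)) with hS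
  set V := S.image (fun p => φ p.1 - φ p.2) with hV
  have h1 : S.card ≤ V.card * en T φ := by
    have hfib : ∀ h ∈ V, (S.filter (fun p => φ p.1 - φ p.2 = h)).card ≤ en T φ := by
      intro h _
      refine le_trans (Finset.card_le_card ?_) (card_shift_le T φ h)
      intro p hp
      rw [Finset.mem_filter, hS, Finset.mem_filter] at hp
      rw [Finset.mem_filter]
      refine ⟨hp.1.1, ?_⟩
      rw [← hp.2]
      abel
    have hmaps : ∀ p ∈ S, (fun p => φ p.1 - φ p.2) p ∈ V := fun p hp =>
      Finset.mem_image_of_mem (fun p : (Fin s → ℕ) × (Fin s → ℕ) => φ p.1 - φ p.2) hp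
    have := Finset.card_le_mul_card_image_of_maps_to (s := S) (t := V) hmaps (en T φ) hfib
    rw [mul_comm]
    exact this
  have hbound : ∀ z ∈ T, ∀ j, 0 ≤ φ z j ∧ φ z j ≤ s * (M : ℤ) ^ ((j : ℕ) + 1) := by
    intro z hz j
    rw [hT, Fintype.mem_piFinset] at hz
    rw [hφ]
    simp only [mom_sum_apply]
    refine ⟨Finset.sum_nonneg fun i _ => by positivity, ?_⟩
    have : ∀ i ∈ (Finset.univ : Finset (Fin s)), (z i : ℤ) ^ ((j : ℕ) + 1) ≤ (M : ℤ) ^ ((j : ℕ) + 1) := by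
      intro i _
      have := Finset.mem_range.1 (hz i)
      gcongr
    simpa using Finset.sum_le_card_nsmul _ _ _ this
  have h2 : V.card ≤ (3 * s) ^ d * M ^ (d * (d + 1) / 2) := by
    set W := Fintype.piFinset (fun j : Fin d =>
      Finset.Icc (-(s * (M : ℤ) ^ ((j : ℕ) + 1))) (s * (M : ℤ) ^ ((j : ℕ) + 1))) with hW
    have h3 : V.card ≤ W.card := by
      refine Finset.card_le_card_of_injOn (fun h j => h j.castSucc) ?_ ?_
      · intro h hh
        rw [Finset.mem_coe, hV, Finset.mem_image] at hh
        obtain ⟨p, hp, rfl⟩ := hh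
        rw [hS, Finset.mem_filter, Finset.mem_product] at hp
        rw [Finset.mem_coe, hW, Fintype.mem_piFinset]
        intro j
        have a1 := hbound p.1 hp.1.1 j.castSucc
        have a2 := hbound p.2 hp.1.2 j.castSucc
        rw [Fin.val_castSucc] at a1 a2
        rw [Finset.mem_Icc]
        beta_reduce
        rw [Pi.sub_apply]
        constructor <;> linarith
      · have hker : ∀ h ∈ V, ∑ j : Fin (d + 1), P.coeff ((j : ℕ) + 1) * h j = 0 := by
          intro h hh
          rw [hV, Finset.mem_image] at hh
          obtain ⟨p, hp, rfl⟩ := hh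
          rw [hS, Finset.mem_filter, sum_eval_mom P hP, sum_eval_mom P hP] at hp
          simp only [Pi.sub_apply, mul_sub, Finset.sum_sub_distrib]
          have := hp.2
          linarith
        intro h hh h' hh' heq
        have e1 := hker h hh
        have e2 := hker h' hh'
        have e3 : ∀ j : Fin d, h j.castSucc = h' j.castSucc := fun j => congrFun heq j
        rw [Fin.sum_univ_castSucc] at e1 e2
        simp_rw [e3] at e1
        have e4 : P.coeff (d + 1) ≠ 0 := by
          rw [← hP]
          intro h0
          rw [Polynomial.coeff_natDegree, Polynomial.leadingCoeff_eq_zero] at h0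
          rw [h0] at hP
          simp at hP
        have e5 : h (Fin.last d) = h' (Fin.last d) := by
          have e6 : P.coeff (d + 1) * h (Fin.last d) = P.coeff (d + 1) * h' (Fin.last d) := by
            simp only [Fin.val_last] at e1 e2
            linarith
          exact mul_left_cancel₀ e4 e6
        funext j
        refine Fin.lastCases e5 e3 j
    refine h3.trans ?_
    rw [hW, Fintype.card_piFinset]
    have h4 : ∀ j ∈ (Finset.univ : Finset (Fin d)),
        (Finset.Icc (-(s * (M : ℤ) ^ ((j : ℕ) + 1))) (s * (M : ℤ) ^ ((j : ℕ) + 1))).card ≤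
        (3 * s) * M ^ ((j : ℕ) + 1) := by
      intro j _
      rw [Int.card_Icc]
      have : 1 ≤ s * M ^ ((j : ℕ) + 1) := Nat.mul_pos hs (pow_pos hM _)
      have e : ((s * M ^ ((j : ℕ) + 1) : ℕ) : ℤ) = s * (M : ℤ) ^ ((j : ℕ) + 1) := by push_cast; ring
      rw [← e, mul_assoc]
      omega
    refine (Finset.prod_le_prod' h4).trans ?_
    rw [Finset.prod_mul_distrib, Finset.prod_const, Finset.card_univ, Fintype.card_fin,
      Finset.prod_pow_eq_pow_sum]
    rw [Fin.sum_univ_eq_sum_range (fun j => j + 1) d]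
    have : ∑ j ∈ Finset.range d, (j + 1) = d * (d + 1) / 2 := by
      have := Finset.sum_range_id (d + 1)
      rw [Finset.sum_range_succ'] at this
      simp only [add_zero] at this
      rw [this, mul_comm]
      simp
    rw [this]
  exact h1.trans (Nat.mul_le_mul_right _ h2)

lemma slicing_real {k s : ℕ} (hk : 2 ≤ k) (hs : 1 ≤ s) (h : Hyp k s (1 / 4)) :
    ∃ C : ℝ, 0 < C ∧ ∀ P : Polynomial ℤ, P.natDegree = k → ∀ M : ℕ, 1 ≤ M →
      (cnt P s M : ℝ) ≤ C * (M : ℝ) ^ (2 * (s : ℝ) - k + 1 / 4) := by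
  obtain ⟨C, hC, h⟩ := h
  obtain ⟨d, rfl⟩ : ∃ d, k = d + 1 := ⟨k - 1, by omega⟩
  have hs0 : (0 : ℝ) < s := by exact_mod_cast hs
  refine ⟨(3 * s : ℝ) ^ d * C, by positivity, fun P hP M hM => ?_⟩
  have h1 := slicing P hP hs hM
  have hM0 : (0 : ℝ) < M := by exact_mod_cast hM
  have h2 : (cnt P s M : ℝ) ≤ (3 * s : ℝ) ^ d * (M : ℝ) ^ (d * (d + 1) / 2) *
      J (d + 1) (Fin s) M := by exact_mod_cast h1
  have h3 := tri_cast (d + 1)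
  rw [Nat.add_sub_cancel, mul_comm (d + 1) d] at h3
  refine h2.trans ?_
  calc (3 * s : ℝ) ^ d * (M : ℝ) ^ (d * (d + 1) / 2) * J (d + 1) (Fin s) M
      ≤ (3 * s : ℝ) ^ d * (M : ℝ) ^ (d * (d + 1) / 2) *
        (C * (M : ℝ) ^ (2 * (s : ℝ) - (d + 1 : ℕ) * ((d + 1 : ℕ) + 1) / 2 + 1 / 4)) := by
        gcongr
        exact h M hM
    _ = (3 * s : ℝ) ^ d * C * ((M : ℝ) ^ (((d * (d + 1) / 2 : ℕ) : ℝ)) *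
        (M : ℝ) ^ (2 * (s : ℝ) - (d + 1 : ℕ) * ((d + 1 : ℕ) + 1) / 2 + 1 / 4)) := by
        rw [Real.rpow_natCast]; ring
    _ = _ := by
        rw [← Real.rpow_add hM0, h3]
        congr 2
        push_cast
        ring

end VMV

namespace VMV
open Complex in
/-- The additive character `exp(2 pi i x)`. -/
noncomputable def ee (x : ℝ) : ℂ := Complex.exp (((2 * Real.pi * x : ℝ) : ℂ) * Complex.I)

lemma ee_add (x y : ℝ) : ee (x + y) = ee x * ee y := by
  unfold ee
  rw [← Complex.exp_add]
  congr 1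
  push_cast
  ring

lemma ee_zero : ee 0 = 1 := by simp [ee]

lemma norm_ee (x : ℝ) : ‖ee x‖ = 1 := by
  unfold ee
  exact Complex.norm_exp_ofReal_mul_I _

lemma ee_int (n : ℤ) : ee n = 1 := by
  unfold ee
  rw [Complex.exp_eq_one_iff]
  refine ⟨n, ?_⟩
  push_cast
  ring

lemma conj_ee (x : ℝ) : (starRingEnd ℂ) (ee x) = ee (-x) := by
  unfold ee
  rw [← Complex.exp_conj]
  congr 1
  rw [map_mul, Complex.conj_ofReal, Complex.conj_I]
  push_cast
  ring

lemma ee_sum {ι : Type*} (s : Finset ι) (f : ι → ℝ) : ee (∑ i ∈ s, f i) = ∏ i ∈ s, ee (f i) := by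
  classical
  induction s using Finset.induction_on with
  | empty => simp [ee_zero]
  | insert a s ha ih => rw [Finset.sum_insert ha, Finset.prod_insert ha, ee_add, ih]

lemma ee_add_int (x : ℝ) (n : ℤ) : ee (x + n) = ee x := by rw [ee_add, ee_int, mul_one]

lemma ee_natmul (x : ℝ) (n : ℕ) : ee (x * n) = ee x ^ n := by
  unfold ee
  rw [← Complex.exp_nat_mul]
  congr 1
  push_cast
  ring

/-- Dirichlet kernel. -/
noncomputable def DD (H : ℕ) (θ : ℝ) : ℂ := ∑ v ∈ Finset.Icc (0 : ℤ) H, ee (θ * v)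

lemma DD_eq (H : ℕ) (θ : ℝ) : DD H θ = ∑ v ∈ Finset.range (H + 1), ee θ ^ v := by
  unfold DD
  symm
  refine Finset.sum_nbij (fun v => (v : ℤ)) ?_ ?_ ?_ ?_
  · intro v hv
    rw [Finset.mem_range] at hv
    rw [Finset.mem_Icc]
    omega
  · intro a _ b _ h
    simpa using h
  · intro v hv
    rw [Finset.mem_coe, Finset.mem_Icc] at hv
    refine ⟨v.toNat, ?_, ?_⟩
    · rw [Finset.mem_coe, Finset.mem_range]; omega
    · simpa using hv.1
  · intro v _
    rw [← ee_natmul]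
    simp

lemma norm_DD_le (H : ℕ) (θ : ℝ) : ‖DD H θ‖ ≤ H + 1 := by
  rw [DD_eq]
  refine (norm_sum_le _ _).trans ?_
  simp [norm_ee]

lemma norm_ee_sub_one (x : ℝ) (hx : |x| ≤ 1 / 2) : 4 * |x| ≤ ‖ee x - 1‖ := by
  unfold ee
  rw [mul_comm _ Complex.I, Complex.norm_exp_I_mul_ofReal_sub_one]
  have h1 : 2 * Real.pi * x / 2 = Real.pi * x := by ring
  rw [h1, norm_mul, Real.norm_eq_abs, Real.norm_eq_abs, abs_two]
  have hpi := Real.pi_pos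
  have h2 : |Real.sin (Real.pi * x)| = Real.sin (Real.pi * |x|) := by
    rcases le_or_gt 0 x with h | h
    · rw [abs_of_nonneg h, abs_of_nonneg]
      apply Real.sin_nonneg_of_nonneg_of_le_pi (by positivity)
      rw [abs_of_nonneg h] at hx
      nlinarith
    · rw [abs_of_neg h, mul_neg, Real.sin_neg, abs_of_nonpos]
      rw [abs_of_neg h] at hx
      have : 0 ≤ Real.sin (Real.pi * (-x)) := by
        apply Real.sin_nonneg_of_nonneg_of_le_pi
        · nlinarith
        · nlinarith
      rw [mul_neg, Real.sin_neg] at this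
      linarith
  rw [h2]
  have h3 := Real.mul_le_sin (x := Real.pi * |x|) (by positivity) (by nlinarith)
  have h4 : 2 / Real.pi * (Real.pi * |x|) = 2 * |x| := by field_simp
  rw [h4] at h3
  linarith

lemma norm_DD_le_of_far (H : ℕ) (θ η : ℝ) (hη : 0 < η) (h : ∀ z : ℤ, η < |θ - z|) :
    ‖DD H θ‖ ≤ 1 / (2 * η) := by
  set x := θ - round θ with hx
  have hx1 : |x| ≤ 1 / 2 := abs_sub_round θ
  have hx2 : η < |x| := h _
  have hee : ee θ = ee x := by
    have : θ = x + (round θ : ℤ) := by rw [hx]; ring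
    conv_lhs => rw [this, ee_add_int]
  have h3 := norm_ee_sub_one x hx1
  have h4 := mul_geom_sum (ee x) (H + 1)
  rw [DD_eq, hee]
  have h5 : ‖ee x - 1‖ * ‖∑ v ∈ Finset.range (H + 1), ee x ^ v‖ ≤ 2 := by
    rw [← norm_mul, h4]
    refine (norm_sub_le _ _).trans ?_
    rw [norm_pow, norm_ee]
    norm_num
  rw [le_div_iff₀ (by positivity)]
  have h6 : 4 * η * ‖∑ v ∈ Finset.range (H + 1), ee x ^ v‖ ≤ 2 :=
    le_trans (mul_le_mul_of_nonneg_right (by linarith) (norm_nonneg _)) h5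
  linarith

/-- Bilinear (double large sieve) inequality. -/
lemma bilinear {ζ : Type*} {k : ℕ} (S : Finset ℕ) (T : Finset ζ) (φ : ζ → (Fin k → ℤ)) (H : Fin k → ℕ)
    (hφ : ∀ z ∈ T, ∀ j, 0 ≤ φ z j ∧ φ z j ≤ H j) (ω : ℕ → Fin k → ℝ) :
    (∑ n ∈ S, ‖∑ z ∈ T, ee (∑ j, ω n j * φ z j)‖) ^ 2 ≤
      en T φ * ∑ n ∈ S, ∑ m ∈ S, ∏ j, ‖DD (H j) (ω n j - ω m j)‖ := by
  classical
  set Box : Finset (Fin k → ℤ) := Fintype.piFinset (fun j => Finset.Icc (0 : ℤ) (H j)) with hBox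
  have hmem : ∀ z ∈ T, φ z ∈ Box := by
    intro z hz
    rw [hBox, Fintype.mem_piFinset]
    intro j
    rw [Finset.mem_Icc]
    exact hφ z hz j
  -- unimodular weights
  have hb : ∀ n, ∃ b : ℂ, ‖b‖ = 1 ∧ b * (∑ z ∈ T, ee (∑ j, ω n j * φ z j)) =
      (‖∑ z ∈ T, ee (∑ j, ω n j * φ z j)‖ : ℂ) := by
    intro n
    set w := ∑ z ∈ T, ee (∑ j, ω n j * φ z j)
    by_cases hw : w = 0
    · exact ⟨1, by simp, by simp [hw]⟩
    · have hw' : (‖w‖ : ℂ) ≠ 0 := by exact_mod_cast (norm_ne_zero_iff.2 hw)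
      refine ⟨(starRingEnd ℂ) w / ‖w‖, ?_, ?_⟩
      · rw [norm_div, RCLike.norm_conj]
        simp [hw]
      · rw [div_mul_eq_mul_div, Complex.conj_mul', sq, mul_div_assoc, div_self hw', mul_one]
  choose b hb1 hb2 using hb
  have hgroup : ∀ n, ∑ z ∈ T, ee (∑ j, ω n j * φ z j) =
      ∑ v ∈ Box, (rp T φ v : ℂ) * ee (∑ j, ω n j * v j) := by
    intro n
    rw [← Finset.sum_fiberwise_of_maps_to hmem]
    refine Finset.sum_congr rfl fun v _ => ?_
    unfold rp
    rw [Finset.sum_congr rfl (g := fun _ => ee (∑ j, ω n j * v j))]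
    · rw [Finset.sum_const, nsmul_eq_mul]
    · intro z hz
      rw [(Finset.mem_filter.1 hz).2]
  have h1 : ((∑ n ∈ S, ‖∑ z ∈ T, ee (∑ j, ω n j * φ z j)‖ : ℝ) : ℂ) =
      ∑ v ∈ Box, (rp T φ v : ℂ) * ∑ n ∈ S, b n * ee (∑ j, ω n j * v j) := by
    rw [Complex.ofReal_sum]
    simp_rw [← hb2, hgroup, Finset.mul_sum]
    rw [Finset.sum_comm]
    refine Finset.sum_congr rfl fun v _ => Finset.sum_congr rfl fun n _ => ?_
    ring
  have h2 : ∑ n ∈ S, ‖∑ z ∈ T, ee (∑ j, ω n j * φ z j)‖ ≤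
      ∑ v ∈ Box, (rp T φ v : ℝ) * ‖∑ n ∈ S, b n * ee (∑ j, ω n j * v j)‖ := by
    have h0 : 0 ≤ ∑ n ∈ S, ‖∑ z ∈ T, ee (∑ j, ω n j * φ z j)‖ :=
      Finset.sum_nonneg fun _ _ => norm_nonneg _
    calc ∑ n ∈ S, ‖∑ z ∈ T, ee (∑ j, ω n j * φ z j)‖
        = ‖((∑ n ∈ S, ‖∑ z ∈ T, ee (∑ j, ω n j * φ z j)‖ : ℝ) : ℂ)‖ := by
          rw [Complex.norm_real, Real.norm_of_nonneg h0]
      _ ≤ _ := by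
        rw [h1]
        refine (norm_sum_le _ _).trans (Finset.sum_le_sum fun v _ => ?_)
        rw [norm_mul, Complex.norm_natCast]
  have h3 : ∑ v ∈ Box, ‖∑ n ∈ S, b n * ee (∑ j, ω n j * v j)‖ ^ 2 ≤
      ∑ n ∈ S, ∑ m ∈ S, ∏ j, ‖DD (H j) (ω n j - ω m j)‖ := by
    have e1 : ((∑ v ∈ Box, ‖∑ n ∈ S, b n * ee (∑ j, ω n j * v j)‖ ^ 2 : ℝ) : ℂ) =
        ∑ n ∈ S, ∑ m ∈ S, b n * (starRingEnd ℂ) (b m) * ∏ j, DD (H j) (ω n j - ω m j) := by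
      rw [Complex.ofReal_sum]
      have e2 : ∀ v : Fin k → ℤ, ((‖∑ n ∈ S, b n * ee (∑ j, ω n j * v j)‖ ^ 2 : ℝ) : ℂ) =
          ∑ n ∈ S, ∑ m ∈ S, b n * (starRingEnd ℂ) (b m) * ∏ j, ee ((ω n j - ω m j) * v j) := by
        intro v
        rw [Complex.ofReal_pow, ← Complex.mul_conj', map_sum, Finset.sum_mul_sum]
        refine Finset.sum_congr rfl fun n _ => Finset.sum_congr rfl fun m _ => ?_
        rw [map_mul, conj_ee, ← ee_sum]
        have : ∑ j, (ω n j - ω m j) * v j = ∑ j, ω n j * v j + -∑ j, ω m j * v j := by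
          simp_rw [sub_mul, Finset.sum_sub_distrib]
          ring
        rw [this, ee_add]
        ring
      simp_rw [e2]
      rw [Finset.sum_comm]
      refine Finset.sum_congr rfl fun n _ => ?_
      rw [Finset.sum_comm]
      refine Finset.sum_congr rfl fun m _ => ?_
      rw [← Finset.mul_sum]
      congr 1
      unfold DD
      rw [Finset.prod_univ_sum]
    have h0 : 0 ≤ ∑ v ∈ Box, ‖∑ n ∈ S, b n * ee (∑ j, ω n j * v j)‖ ^ 2 :=
      Finset.sum_nonneg fun _ _ => by positivity
    rw [← Real.norm_of_nonneg h0, ← Complex.norm_real, e1]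
    refine (norm_sum_le _ _).trans (Finset.sum_le_sum fun n _ => ?_)
    refine (norm_sum_le _ _).trans (Finset.sum_le_sum fun m _ => ?_)
    rw [norm_mul, norm_mul, hb1, RCLike.norm_conj, hb1, norm_prod]
    simp
  calc (∑ n ∈ S, ‖∑ z ∈ T, ee (∑ j, ω n j * φ z j)‖) ^ 2
      ≤ (∑ v ∈ Box, (rp T φ v : ℝ) * ‖∑ n ∈ S, b n * ee (∑ j, ω n j * v j)‖) ^ 2 := by
        gcongr
    _ ≤ (∑ v ∈ Box, (rp T φ v : ℝ) ^ 2) *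
        ∑ v ∈ Box, ‖∑ n ∈ S, b n * ee (∑ j, ω n j * v j)‖ ^ 2 :=
        Finset.sum_mul_sq_le_sq_mul_sq _ _ _
    _ ≤ _ := by
        have h4 : (∑ v ∈ Box, (rp T φ v : ℝ) ^ 2) = en T φ := by
          rw [en_eq_sum T φ Box hmem]
          push_cast
          rfl
        rw [h4]
        gcongr

end VMV

namespace VMV

open Classical in
/-- Integers `m < M` with `φ m` close to an integer. -/
noncomputable def near (φ η : ℝ) (M : ℕ) : Finset ℕ :=
  (Finset.range M).filter (fun m => ∃ z : ℤ, |φ * m - z| ≤ η)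

lemma mem_near {φ η : ℝ} {M m : ℕ} : m ∈ near φ η M ↔ m < M ∧ ∃ z : ℤ, |φ * m - z| ≤ η := by
  classical
  unfold near
  rw [Finset.mem_filter, Finset.mem_range]

lemma near_step1 {φ η δ : ℝ} {M : ℕ} (hδ : 0 < δ)
    (hM : 2 < δ * M) (h : δ * M ≤ (near φ η M).card) :
    ∃ q : ℕ, 1 ≤ q ∧ (q : ℝ) ≤ 2 / δ ∧ ∃ a : ℤ, |q * φ - a| ≤ 2 * η := by
  classical
  set g := ⌈2 / δ⌉₊ with hg
  have hg1 : 2 / δ ≤ g := Nat.le_ceil _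
  have hg2 : (g : ℝ) < 2 / δ + 1 := Nat.ceil_lt_add_one (by positivity)
  have hg0 : (0 : ℝ) < g := lt_of_lt_of_le (by positivity) hg1
  have hg0' : 0 < g := by exact_mod_cast hg0
  have hcard : (Finset.range (M / g + 1)).card < (near φ η M).card := by
    rw [Finset.card_range]
    have h1 : ((M / g : ℕ) : ℝ) ≤ (M : ℝ) / g := Nat.cast_div_le
    have h2 : (M : ℝ) / g ≤ δ * M / 2 := by
      rw [div_le_iff₀ hg0]
      have : 2 ≤ g * δ := by rwa [div_le_iff₀ hδ] at hg1
      have hM0 : (0 : ℝ) ≤ M := Nat.cast_nonneg _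
      nlinarith
    have h3 : ((M / g + 1 : ℕ) : ℝ) < (near φ η M).card := by
      push_cast
      linarith
    exact_mod_cast h3
  obtain ⟨x, hx, y, hy, hne, heq⟩ := Finset.exists_ne_map_eq_of_card_lt_of_maps_to
    (f := fun m => m / g) hcard (by
      intro m hm
      rw [Finset.mem_coe, mem_near] at hm
      rw [Finset.mem_coe, Finset.mem_range]
      exact Nat.lt_succ_of_le (Nat.div_le_div_right hm.1.le))
  have key : ∀ x y : ℕ, x ∈ near φ η M → y ∈ near φ η M → x < y → x / g = y / g →
      ∃ q : ℕ, 1 ≤ q ∧ (q : ℝ) ≤ 2 / δ ∧ ∃ a : ℤ, |q * φ - a| ≤ 2 * η := by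
    intro x y hx hy hlt heq
    rw [mem_near] at hx hy
    obtain ⟨zx, hzx⟩ := hx.2
    obtain ⟨zy, hzy⟩ := hy.2
    have hdx := Nat.div_add_mod x g
    have hdy := Nat.div_add_mod y g
    have hmy := Nat.mod_lt y hg0'
    rw [heq] at hdx
    have hq : y - x + 1 ≤ g := by omega
    refine ⟨y - x, by omega, ?_, zy - zx, ?_⟩
    · have : ((y - x : ℕ) : ℝ) + 1 ≤ g := by exact_mod_cast hq
      linarith
    · rw [Nat.cast_sub hlt.le]
      push_cast
      have : ((y : ℝ) - x) * φ - (zy - zx) = (φ * y - zy) - (φ * x - zx) := by ring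
      rw [this]
      refine (abs_sub _ _).trans ?_
      linarith
  rcases lt_or_gt_of_ne hne with hlt | hlt
  · exact key x y hx hy hlt heq
  · exact key y x hy hx hlt heq.symm

lemma near_fiber {φ η θ : ℝ} {q : ℕ} {a : ℤ} (hη : 0 < η) (hθ : θ = q * φ - a)
    (hθ0 : θ ≠ 0) (hθη : |θ| ≤ 2 * η) (W : ℕ) (hW : W * |θ| + 2 * η < 1) (F : Finset ℕ)
    (hF : ∀ m ∈ F, ∃ z : ℤ, |φ * m - z| ≤ η)
    (hF2 : ∀ m ∈ F, ∀ m' ∈ F, m ≤ m' → ∃ t : ℕ, t < W ∧ m' = m + q * t) :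
    (F.card : ℝ) ≤ 4 * η / |θ| := by
  have hθp : 0 < |θ| := abs_pos.2 hθ0
  rcases F.eq_empty_or_nonempty with rfl | hne
  · simp; positivity
  set m0 := F.min' hne with hm0
  have hm0F : m0 ∈ F := F.min'_mem hne
  have h1 : ∀ m ∈ F, ∃ t : ℕ, (t : ℝ) ≤ 2 * η / |θ| ∧ m = m0 + q * t := by
    intro m hm
    obtain ⟨t, ht, hmt⟩ := hF2 m0 hm0F m hm (F.min'_le m hm)
    refine ⟨t, ?_, hmt⟩
    obtain ⟨z, hz⟩ := hF m hm
    obtain ⟨z0, hz0⟩ := hF m0 hm0F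
    have e1 : (φ * m - z) - (φ * m0 - z0) = θ * t + ((a * t - z + z0 : ℤ) : ℝ) := by
      rw [hmt, hθ]
      push_cast
      ring
    have e2 : |θ * t + ((a * t - z + z0 : ℤ) : ℝ)| ≤ 2 * η := by
      rw [← e1]
      refine (abs_sub _ _).trans ?_
      linarith
    have e3 : |θ * t| ≤ W * |θ| := by
      rw [abs_mul, Nat.abs_cast, mul_comm]
      gcongr
    have e4 : (a * t - z + z0 : ℤ) = 0 := by
      rw [← Int.abs_lt_one_iff]
      have : |((a * t - z + z0 : ℤ) : ℝ)| < 1 := by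
        have : ((a * t - z + z0 : ℤ) : ℝ) = (θ * t + ((a * t - z + z0 : ℤ) : ℝ)) - θ * t := by ring
        rw [this]
        refine lt_of_le_of_lt (abs_sub _ _) ?_
        linarith
      exact_mod_cast this
    rw [e4, Int.cast_zero, add_zero, abs_mul, Nat.abs_cast] at e2
    rw [le_div_iff₀ hθp]
    linarith
  have h2 : F ⊆ (Finset.range (⌊2 * η / |θ|⌋₊ + 1)).image (fun t => m0 + q * t) := by
    intro m hm
    obtain ⟨t, ht, hmt⟩ := h1 m hm
    rw [Finset.mem_image]
    exact ⟨t, Finset.mem_range.2 (Nat.lt_succ_of_le (Nat.le_floor ht)), hmt.symm⟩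
  have h3 := (Finset.card_le_card h2).trans Finset.card_image_le
  rw [Finset.card_range] at h3
  have h4 : (F.card : ℝ) ≤ (⌊2 * η / |θ|⌋₊ : ℝ) + 1 := by exact_mod_cast h3
  have h5 : (⌊2 * η / |θ|⌋₊ : ℝ) ≤ 2 * η / |θ| := Nat.floor_le (by positivity)
  have h6 : 1 ≤ 2 * η / |θ| := by rw [le_div_iff₀ hθp]; linarith
  have h7 : 4 * η / |θ| = 2 * η / |θ| + 2 * η / |θ| := by ring
  linarith

theorem near_lemma {φ η δ : ℝ} {M : ℕ} (hη : 0 < η) (hδ : 0 < δ) (hδ1 : δ ≤ 1)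
    (hηδ : η ≤ δ / 20)
    (hM : 2 < δ * M) (h : δ * M ≤ (near φ η M).card) :
    ∃ q : ℕ, 1 ≤ q ∧ (q : ℝ) ≤ 2 / δ ∧ ∃ a : ℤ, |q * φ - a| ≤ 10 * η * q / (δ * M) := by
  classical
  obtain ⟨q, hq1, hq2, a, ha⟩ := near_step1 hδ hM h
  refine ⟨q, hq1, hq2, a, ?_⟩
  set θ := q * φ - a with hθ
  have hM0 : (0 : ℝ) < M := by
    rcases (Nat.cast_nonneg (α := ℝ) M).eq_or_lt with h | h
    · rw [← h] at hM; simp at hM; linarith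
    · exact h
  by_cases hθ0 : θ = 0
  · rw [hθ0, abs_zero]; positivity
  have hθp : 0 < |θ| := abs_pos.2 hθ0
  have hqR : (1 : ℝ) ≤ q := by exact_mod_cast hq1
  set W := ⌊8 * η / (|θ| * δ)⌋₊ + 1 with hW
  have hW1 : 8 * η / (|θ| * δ) < W := by
    rw [hW]; push_cast; exact Nat.lt_floor_add_one _
  have hW2 : (W : ℝ) ≤ 8 * η / (|θ| * δ) + 1 := by
    rw [hW]; push_cast
    have := Nat.floor_le (show 0 ≤ 8 * η / (|θ| * δ) by positivity)
    linarith
  have hW0 : 0 < W := Nat.succ_pos _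
  have hWθ : W * |θ| + 2 * η < 1 := by
    have h1 : W * |θ| ≤ (8 * η / (|θ| * δ) + 1) * |θ| := by gcongr
    have h2 : (8 * η / (|θ| * δ) + 1) * |θ| = 8 * η / δ + |θ| := by field_simp
    have h3 : 8 * η / δ ≤ 8 / 20 := by rw [div_le_iff₀ hδ]; linarith
    linarith
  by_cases hcase : W * q ≤ M
  · exfalso
    have hWq : 0 < W * q := Nat.mul_pos hW0 hq1
    -- fibers
    have hmaps : ∀ m ∈ near φ η M, (fun m => (m / (W * q), m % q)) m ∈
        Finset.range (M / (W * q) + 1) ×ˢ Finset.range q := by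
      intro m hm
      rw [mem_near] at hm
      rw [Finset.mem_product, Finset.mem_range, Finset.mem_range]
      exact ⟨Nat.lt_succ_of_le (Nat.div_le_div_right hm.1.le), Nat.mod_lt _ hq1⟩
    have hfib : ∀ b ∈ Finset.range (M / (W * q) + 1) ×ˢ Finset.range q,
        (((near φ η M).filter (fun m => (m / (W * q), m % q) = b)).card : ℝ) ≤ 4 * η / |θ| := by
      intro b _
      refine near_fiber hη hθ hθ0 ha W hWθ _ ?_ ?_
      · intro m hm
        exact (mem_near.1 (Finset.mem_filter.1 hm).1).2
      · intro m hm m' hm' hle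
        have e1 := (Finset.mem_filter.1 hm).2
        have e2 := (Finset.mem_filter.1 hm').2
        rw [← e2, Prod.mk.injEq] at e1
        have d1 := Nat.div_add_mod m (W * q)
        have d2 := Nat.div_add_mod m' (W * q)
        rw [e1.1] at d1
        have l2 := Nat.mod_lt m' hWq
        have hdvd : q ∣ m' - m := (Nat.modEq_iff_dvd' hle).1 e1.2
        obtain ⟨t, ht⟩ := hdvd
        refine ⟨t, ?_, by omega⟩
        have : q * t < W * q := by omega
        rw [mul_comm W q] at this
        exact Nat.lt_of_mul_lt_mul_left this
    have hcard : ((near φ η M).card : ℝ) ≤ ((M / (W * q) : ℕ) + 1) * q * (4 * η / |θ|) := by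
      rw [Finset.card_eq_sum_card_fiberwise hmaps]
      push_cast
      refine (Finset.sum_le_sum hfib).trans ?_
      rw [Finset.sum_const, Finset.card_product, Finset.card_range, Finset.card_range, nsmul_eq_mul]
      push_cast
      exact le_rfl
    have hWR : (0 : ℝ) < W := by exact_mod_cast hW0
    have h1 : ((M / (W * q) : ℕ) : ℝ) ≤ (M : ℝ) / (W * q) := by
      have := Nat.cast_div_le (α := ℝ) (m := M) (n := W * q)
      push_cast at this
      exact this
    have h2 : (1 : ℝ) ≤ (M : ℝ) / (W * q) := by
      rw [le_div_iff₀ (by positivity), one_mul]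
      exact_mod_cast hcase
    have h3 : ((near φ η M).card : ℝ) ≤ (2 * (M / (W * q))) * q * (4 * η / |θ|) := by
      refine hcard.trans ?_
      gcongr
      linarith
    have h4 : (2 * ((M : ℝ) / (W * q))) * q * (4 * η / |θ|) = 8 * η / |θ| * M / W := by
      field_simp
      ring
    have h5 : 8 * η / |θ| * M / W < δ * M := by
      rw [div_lt_iff₀ hWR]
      have : 8 * η / |θ| < δ * W := by
        have e : 8 * η / (|θ| * δ) = 8 * η / |θ| / δ := by rw [div_div]
        rw [e, div_lt_iff₀ hδ] at hW1
        linarith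
      nlinarith
    linarith
  · push Not at hcase
    have h1 : (M : ℝ) < W * q := by exact_mod_cast hcase
    have h2 : (W : ℝ) ≤ 10 * η / (|θ| * δ) := by
      have : 1 ≤ 2 * η / (|θ| * δ) := by
        rw [le_div_iff₀ (by positivity)]
        nlinarith
      have e : 10 * η / (|θ| * δ) = 8 * η / (|θ| * δ) + 2 * η / (|θ| * δ) := by ring
      linarith
    have h3 : (M : ℝ) ≤ 10 * η / (|θ| * δ) * q := h1.le.trans (by gcongr)
    rw [le_div_iff₀ (by positivity)]
    rw [div_mul_eq_mul_div, le_div_iff₀ (by positivity)] at h3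
    linarith

end VMV

namespace VMV

/-- The exponential sum. -/
noncomputable def fs (P : Polynomial ℤ) (α : ℝ) (M : ℕ) : ℂ :=
  ∑ n ∈ Finset.range M, ee (α * (P.eval (n : ℤ) : ℤ))

lemma norm_shift (g : ℕ → ℂ) (hg : ∀ n, ‖g n‖ = 1) (M t : ℕ) :
    ‖∑ n ∈ Finset.range M, g (n + t) - ∑ n ∈ Finset.range M, g n‖ ≤ 2 * t := by
  have h1 := Finset.sum_range_add g t M
  have h2 := Finset.sum_range_add g M t
  rw [add_comm M t, h1] at h2
  have h3 : ∑ n ∈ Finset.range M, g (n + t) - ∑ n ∈ Finset.range M, g n =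
      ∑ x ∈ Finset.range t, g (M + x) - ∑ n ∈ Finset.range t, g n := by
    simp_rw [add_comm _ t]
    linear_combination h2
  rw [h3]
  have hb : ∀ a : ℕ, ‖∑ x ∈ Finset.range t, g (a + x)‖ ≤ t := by
    intro a
    refine (norm_sum_le _ _).trans ?_
    simp [hg]
  have hb0 := hb 0
  simp only [zero_add] at hb0
  refine (norm_sub_le _ _).trans ?_
  linarith [hb M]

lemma shift_avg (g : ℕ → ℂ) (hg : ∀ n, ‖g n‖ = 1) (M h L : ℕ) (δ : ℝ)
    (hL : 8 * (h * L : ℝ) ≤ δ * M) (hf : δ * M ≤ ‖∑ n ∈ Finset.range M, g n‖) :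
    δ / 2 * L * M ≤ ∑ n ∈ Finset.range M, ‖∑ j ∈ Finset.range L, g (n + h * j)‖ := by
  set F := ∑ n ∈ Finset.range M, g n with hF
  have hδM : 0 ≤ δ * M := le_trans (by positivity) hL
  have h1 : ‖∑ n ∈ Finset.range M, ∑ j ∈ Finset.range L, g (n + h * j) - L * F‖ ≤ L * (δ * M / 2) := by
    rw [Finset.sum_comm]
    have : (L : ℂ) * F = ∑ j ∈ Finset.range L, F := by simp
    rw [this, ← Finset.sum_sub_distrib]
    refine (norm_sum_le _ _).trans ?_
    have h2 : ∀ j ∈ Finset.range L, ‖∑ n ∈ Finset.range M, g (n + h * j) - F‖ ≤ δ * M / 2 := by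
      intro j hj
      refine (norm_shift g hg M (h * j)).trans ?_
      have hj' : (j : ℝ) ≤ L := by exact_mod_cast (Finset.mem_range.1 hj).le
      have : (h : ℝ) * j ≤ h * L := by gcongr
      push_cast
      linarith
    refine (Finset.sum_le_card_nsmul _ _ _ h2).trans ?_
    simp
  have h3 : ‖(L : ℂ) * F‖ = L * ‖F‖ := by rw [norm_mul, Complex.norm_natCast]
  have h4 : L * ‖F‖ ≤ ‖∑ n ∈ Finset.range M, ∑ j ∈ Finset.range L, g (n + h * j)‖ + L * (δ * M / 2) := by
    rw [← h3]
    have := norm_sub_norm_le ((L : ℂ) * F)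
      (∑ n ∈ Finset.range M, ∑ j ∈ Finset.range L, g (n + h * j))
    rw [norm_sub_rev] at this
    linarith
  have h5 : (L : ℝ) * (δ * M) ≤ L * ‖F‖ := by gcongr
  have h6 := norm_sum_le (Finset.range M) (fun n => ∑ j ∈ Finset.range L, g (n + h * j))
  have h7 : δ / 2 * L * M = L * (δ * M) - L * (δ * M / 2) := by ring
  linarith

/-- Taylor coefficients. -/
noncomputable def tc (P : Polynomial ℤ) (h n i : ℕ) : ℤ :=
  (Polynomial.taylor (n : ℤ) P).coeff (i + 1) * (h : ℤ) ^ (i + 1)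

lemma eval_taylor {d : ℕ} (P : Polynomial ℤ) (hP : P.natDegree = d + 1) (n h j : ℕ) :
    P.eval ((n + h * j : ℕ) : ℤ) = P.eval (n : ℤ) + ∑ i : Fin (d + 1), tc P h n i * mom (d + 1) j i := by
  have h1 := Polynomial.taylor_eval (n : ℤ) P ((h : ℤ) * j)
  have h2 : ((n + h * j : ℕ) : ℤ) = (h : ℤ) * j + n := by push_cast; ring
  rw [h2, ← h1, Polynomial.eval_eq_sum_range, Polynomial.natDegree_taylor, hP,
    Finset.sum_range_succ', add_comm]
  congr 1
  · rw [Polynomial.taylor_coeff_zero]; simp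
  · rw [← Fin.sum_univ_eq_sum_range (fun i => (Polynomial.taylor (n : ℤ) P).coeff (i + 1) *
      ((h : ℤ) * j) ^ (i + 1)) (d + 1)]
    refine Finset.sum_congr rfl fun i _ => ?_
    unfold tc mom
    rw [mul_pow]
    ring

lemma tc_sub {e : ℕ} (P : Polynomial ℤ) (hP : P.natDegree = e + 2) (h n m : ℕ) :
    tc P h n e - tc P h m e = (e + 2) * P.leadingCoeff * (h : ℤ) ^ (e + 1) * ((n : ℤ) - m) := by
  have key : ∀ n : ℕ, (Polynomial.taylor (n : ℤ) P).coeff (e + 1) =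
      P.coeff (e + 1) + (e + 2) * P.leadingCoeff * n := by
    intro n
    rw [Polynomial.taylor_coeff, Polynomial.eval_eq_sum_range' (n := 2)]
    · rw [Finset.sum_range_succ, Finset.sum_range_one, Polynomial.hasseDeriv_coeff,
        Polynomial.hasseDeriv_coeff, Polynomial.leadingCoeff, hP]
      have : 1 + (e + 1) = e + 2 := by ring
      rw [this, zero_add, Nat.choose_self, Nat.choose_succ_self_right]
      push_cast
      ring
    · have := Polynomial.natDegree_hasseDeriv_le P (e + 1)
      omega
  unfold tc
  rw [key, key]
  ring

lemma sum_pow_eq {d s : ℕ} (P : Polynomial ℤ) (hP : P.natDegree = d + 1) (α : ℝ) (n h L : ℕ) :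
    ‖∑ j ∈ Finset.range L, ee (α * (P.eval ((n + h * j : ℕ) : ℤ) : ℤ))‖ ^ s =
    ‖∑ z ∈ Fintype.piFinset (fun _ : Fin s => Finset.range L),
      ee (∑ j : Fin (d + 1), (α * tc P h n j) * ((∑ i, mom (d + 1) (z i)) j : ℤ))‖ := by
  rw [← norm_pow, Finset.sum_pow', ← one_mul ‖∑ z ∈ _, ee (∑ j, _)‖,
    ← norm_ee (s * (α * (P.eval (n : ℤ) : ℤ))), ← norm_mul, Finset.mul_sum]
  congr 1
  refine Finset.sum_congr rfl fun z _ => ?_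
  rw [← ee_sum, ← ee_add]
  congr 1
  simp_rw [eval_taylor P hP]
  push_cast
  simp_rw [mul_add, Finset.sum_add_distrib, Finset.sum_apply, Finset.mul_sum]
  congr 1
  · simp
  · rw [Finset.sum_comm]
    push_cast
    refine Finset.sum_congr rfl fun j _ => ?_
    rw [Finset.mul_sum]
    refine Finset.sum_congr rfl fun i _ => ?_
    ring

end VMV

namespace VMV

lemma DD_double_sum (H M : ℕ) (φ η : ℝ) (hη : 0 < η) :
    ∑ n ∈ Finset.range M, ∑ m ∈ Finset.range M, ‖DD H (φ * ((n : ℝ) - m))‖ ≤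
      M * (2 * (near φ η M).card * (H + 1) + M / (2 * η)) := by
  classical
  have hrow : ∀ n ∈ Finset.range M, ∑ m ∈ Finset.range M, ‖DD H (φ * ((n : ℝ) - m))‖ ≤
      2 * (near φ η M).card * (H + 1) + M / (2 * η) := by
    intro n hn
    rw [Finset.mem_range] at hn
    set B := (Finset.range M).filter (fun m => (n - m) + (m - n) ∈ near φ η M) with hB
    have hterm : ∀ m ∈ Finset.range M, ‖DD H (φ * ((n : ℝ) - m))‖ ≤
        (if m ∈ B then ((H : ℝ) + 1) else 0) + 1 / (2 * η) := by
      intro m hm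
      split_ifs with hmB
      · have := norm_DD_le H (φ * ((n : ℝ) - m))
        have h2 : 0 ≤ 1 / (2 * η) := by positivity
        linarith
      · rw [zero_add]
        refine norm_DD_le_of_far H _ η hη ?_
        intro z
        by_contra hcon
        push Not at hcon
        apply hmB
        rw [hB, Finset.mem_filter]
        refine ⟨hm, ?_⟩
        rw [Finset.mem_range] at hm
        rw [mem_near]
        refine ⟨by omega, ?_⟩
        rcases le_total m n with hle | hle
        · refine ⟨z, ?_⟩
          rw [Nat.sub_eq_zero_of_le hle, add_zero, Nat.cast_sub hle]
          exact hcon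
        · refine ⟨-z, ?_⟩
          rw [Nat.sub_eq_zero_of_le hle, zero_add, Nat.cast_sub hle, ← abs_neg]
          have : -(φ * ((m : ℝ) - n) - ((-z : ℤ) : ℝ)) = φ * ((n : ℝ) - m) - z := by
            push_cast
            ring
          rw [this]
          exact hcon
    refine (Finset.sum_le_sum hterm).trans ?_
    rw [Finset.sum_add_distrib, Finset.sum_const, Finset.card_range, nsmul_eq_mul, ← Finset.sum_filter,
      Finset.sum_const, nsmul_eq_mul]
    have hBc : ((Finset.range M).filter (fun m => m ∈ B)).card ≤ 2 * (near φ η M).card := by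
      have hsub : (Finset.range M).filter (fun m => m ∈ B) ⊆
          (B.filter (fun m => m ≤ n)) ∪ (B.filter (fun m => ¬ m ≤ n)) := by
        rw [Finset.filter_union_filter_not_eq]
        intro m hm
        exact (Finset.mem_filter.1 hm).2
      refine (Finset.card_le_card hsub).trans ((Finset.card_union_le _ _).trans ?_)
      rw [two_mul]
      refine Nat.add_le_add ?_ ?_
      · refine Finset.card_le_card_of_injOn (fun m => (n - m) + (m - n)) ?_ ?_
        · intro m hm
          exact (Finset.mem_filter.1 (Finset.mem_filter.1 hm).1).2
        · intro a ha b hb hab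
          have h1 := (Finset.mem_filter.1 ha).2
          have h2 := (Finset.mem_filter.1 hb).2
          simp only at hab
          omega
      · refine Finset.card_le_card_of_injOn (fun m => (n - m) + (m - n)) ?_ ?_
        · intro m hm
          exact (Finset.mem_filter.1 (Finset.mem_filter.1 hm).1).2
        · intro a ha b hb hab
          have h1 := (Finset.mem_filter.1 ha).2
          have h2 := (Finset.mem_filter.1 hb).2
          simp only at hab
          omega
    have hBc' : (((Finset.range M).filter (fun m => m ∈ B)).card : ℝ) ≤ 2 * (near φ η M).card := by
      exact_mod_cast hBc
    have : (M : ℝ) * (1 / (2 * η)) = M / (2 * η) := by ring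
    rw [this]
    gcongr
  refine (Finset.sum_le_card_nsmul _ _ _ hrow).trans ?_
  rw [Finset.card_range, nsmul_eq_mul]

lemma prod_bound {e s L : ℕ} (hs : 1 ≤ s) (hL : 1 ≤ L) (x : Fin (e + 2) → ℝ) (j0 : Fin (e + 2))
    (hj0 : (j0 : ℕ) = e) :
    (∏ j : Fin (e + 2), ‖DD (s * L ^ ((j : ℕ) + 1)) (x j)‖) * (L : ℝ) ^ (e + 1) ≤
      (2 * s : ℝ) ^ (e + 2) * (L : ℝ) ^ ((e + 3) * (e + 2) / 2) * ‖DD (s * L ^ (e + 1)) (x j0)‖ := by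
  classical
  have hsR : (1 : ℝ) ≤ s := by exact_mod_cast hs
  have hLR : (1 : ℝ) ≤ L := by exact_mod_cast hL
  rw [← Finset.mul_prod_erase Finset.univ _ (Finset.mem_univ j0), hj0]
  have h1 : ∏ j ∈ Finset.univ.erase j0, ‖DD (s * L ^ ((j : ℕ) + 1)) (x j)‖ ≤
      ∏ j ∈ Finset.univ.erase j0, (2 * s * (L : ℝ) ^ ((j : ℕ) + 1)) := by
    refine Finset.prod_le_prod (fun _ _ => norm_nonneg _) fun j _ => ?_
    refine (norm_DD_le _ _).trans ?_
    push_cast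
    have : (1 : ℝ) ≤ s * (L : ℝ) ^ ((j : ℕ) + 1) := by
      have := one_le_pow₀ hLR (n := (j : ℕ) + 1)
      nlinarith
    linarith
  have h2 : (∏ j ∈ Finset.univ.erase j0, (2 * s * (L : ℝ) ^ ((j : ℕ) + 1))) * (L : ℝ) ^ (e + 1) ≤
      ∏ j : Fin (e + 2), (2 * s * (L : ℝ) ^ ((j : ℕ) + 1)) := by
    rw [← Finset.mul_prod_erase Finset.univ (fun j : Fin (e + 2) => (2 * s * (L : ℝ) ^ ((j : ℕ) + 1)))
      (Finset.mem_univ j0), hj0, mul_comm]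
    refine mul_le_mul_of_nonneg_right ?_ (Finset.prod_nonneg fun _ _ => by positivity)
    have : (0 : ℝ) ≤ (L : ℝ) ^ (e + 1) := by positivity
    nlinarith
  have h3 : ∏ j : Fin (e + 2), (2 * s * (L : ℝ) ^ ((j : ℕ) + 1)) =
      (2 * s : ℝ) ^ (e + 2) * (L : ℝ) ^ ((e + 3) * (e + 2) / 2) := by
    rw [Finset.prod_mul_distrib, Finset.prod_const, Finset.card_univ, Fintype.card_fin,
      Finset.prod_pow_eq_pow_sum, Fin.sum_univ_eq_sum_range (fun j => j + 1) (e + 2)]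
    have : ∑ j ∈ Finset.range (e + 2), (j + 1) = (e + 3) * (e + 2) / 2 := by
      have := Finset.sum_range_id (e + 3)
      rw [Finset.sum_range_succ'] at this
      simp only [add_zero] at this
      rw [this]
      simp
    rw [this]
  rw [← h3]
  calc ‖DD (s * L ^ (e + 1)) (x j0)‖ * (∏ j ∈ Finset.univ.erase j0,
        ‖DD (s * L ^ ((j : ℕ) + 1)) (x j)‖) * (L : ℝ) ^ (e + 1)
      ≤ ‖DD (s * L ^ (e + 1)) (x j0)‖ * (∏ j ∈ Finset.univ.erase j0,
        (2 * s * (L : ℝ) ^ ((j : ℕ) + 1))) * (L : ℝ) ^ (e + 1) := by gcongr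
    _ = ‖DD (s * L ^ (e + 1)) (x j0)‖ * ((∏ j ∈ Finset.univ.erase j0,
        (2 * s * (L : ℝ) ^ ((j : ℕ) + 1))) * (L : ℝ) ^ (e + 1)) := by ring
    _ ≤ ‖DD (s * L ^ (e + 1)) (x j0)‖ * ∏ j : Fin (e + 2), (2 * s * (L : ℝ) ^ ((j : ℕ) + 1)) := by
        gcongr
    _ = _ := by ring

lemma core1 {e s : ℕ} (hs : 1 ≤ s) (P : Polynomial ℤ) (hP : P.natDegree = e + 2) (α δ η : ℝ)
    (M h L : ℕ) (hM : 1 ≤ M) (hL : 1 ≤ L) (hδ : 0 < δ) (hη : 0 < η)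
    (hhL : 8 * (h * L : ℝ) ≤ δ * M) (hf : δ * M ≤ ‖fs P α M‖) :
    (M * (δ / 2 * L) ^ s) ^ 2 * (L : ℝ) ^ (e + 1) ≤
      J (e + 2) (Fin s) L * ((2 * s : ℝ) ^ (e + 2) * (L : ℝ) ^ ((e + 3) * (e + 2) / 2)) *
      (M * (2 * (near (α * (e + 2) * P.leadingCoeff * (h : ℝ) ^ (e + 1)) η M).card *
        ((s * L ^ (e + 1) : ℕ) + 1) + M / (2 * η))) := by
  classical
  set φ := α * (e + 2) * P.leadingCoeff * (h : ℝ) ^ (e + 1) with hφ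
  have hMR : (0 : ℝ) < M := by exact_mod_cast hM
  have h1 := shift_avg (fun n => ee (α * (P.eval (n : ℤ) : ℤ))) (fun n => norm_ee _) M h L δ hhL hf
  set S := fun n => ‖∑ j ∈ Finset.range L, ee (α * (P.eval ((n + h * j : ℕ) : ℤ) : ℤ))‖ with hS
  have h2 : M * (δ / 2 * L) ^ s ≤ ∑ n ∈ Finset.range M, S n ^ s := by
    obtain ⟨s', rfl⟩ : ∃ s', s = s' + 1 := ⟨s - 1, by omega⟩
    have h3 := pow_sum_div_card_le_sum_pow (s := Finset.range M) (f := S) (fun n _ => norm_nonneg _) s'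
    rw [Finset.card_range] at h3
    refine le_trans ?_ h3
    rw [le_div_iff₀ (by positivity)]
    calc (M : ℝ) * (δ / 2 * L) ^ (s' + 1) * (M : ℝ) ^ s' = (δ / 2 * L * M) ^ (s' + 1) := by
          rw [mul_pow _ (M : ℝ)]; ring
      _ ≤ _ := by
          refine pow_le_pow_left₀ (by positivity) ?_ _
          exact h1
  have h3 := bilinear (Finset.range M) (Fintype.piFinset (fun _ : Fin s => Finset.range L))
    (fun z => ∑ i, mom (e + 2) (z i)) (fun j => s * L ^ ((j : ℕ) + 1)) (by
      intro z hz j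
      rw [Fintype.mem_piFinset] at hz
      simp only [mom_sum_apply]
      refine ⟨Finset.sum_nonneg fun i _ => by positivity, ?_⟩
      have : ∀ i ∈ (Finset.univ : Finset (Fin s)),
          (z i : ℤ) ^ ((j : ℕ) + 1) ≤ (L : ℤ) ^ ((j : ℕ) + 1) := by
        intro i _
        have := Finset.mem_range.1 (hz i)
        gcongr
      simpa using Finset.sum_le_card_nsmul _ _ _ this) (fun n j => α * tc P h n j)
  have h4 : ∑ n ∈ Finset.range M, ‖∑ z ∈ Fintype.piFinset (fun _ : Fin s => Finset.range L),
      ee (∑ j : Fin (e + 2), (α * tc P h n j) * ((∑ i, mom (e + 2) (z i)) j : ℤ))‖ =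
      ∑ n ∈ Finset.range M, S n ^ s :=
    Finset.sum_congr rfl fun n _ => (sum_pow_eq P hP α n h L).symm
  rw [h4] at h3
  have h5 : (M * (δ / 2 * L) ^ s) ^ 2 ≤ (∑ n ∈ Finset.range M, S n ^ s) ^ 2 :=
    pow_le_pow_left₀ (by positivity) h2 2
  have h6 := h5.trans h3
  have h7 : (∑ n ∈ Finset.range M, ∑ m ∈ Finset.range M, ∏ j : Fin (e + 2),
      ‖DD (s * L ^ ((j : ℕ) + 1)) (α * tc P h n j - α * tc P h m j)‖) * (L : ℝ) ^ (e + 1) ≤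
      (2 * s : ℝ) ^ (e + 2) * (L : ℝ) ^ ((e + 3) * (e + 2) / 2) *
      ∑ n ∈ Finset.range M, ∑ m ∈ Finset.range M, ‖DD (s * L ^ (e + 1)) (φ * ((n : ℝ) - m))‖ := by
    rw [Finset.sum_mul, Finset.mul_sum]
    refine Finset.sum_le_sum fun n _ => ?_
    rw [Finset.sum_mul, Finset.mul_sum]
    refine Finset.sum_le_sum fun m _ => ?_
    refine (prod_bound hs hL _ ⟨e, by omega⟩ rfl).trans ?_
    have : α * tc P h n e - α * tc P h m e = φ * ((n : ℝ) - m) := by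
      rw [← mul_sub, ← Int.cast_sub, tc_sub P hP, hφ]
      push_cast
      ring
    rw [this]
  have h8 := DD_double_sum (s * L ^ (e + 1)) M φ η hη
  have hJ : (J (e + 2) (Fin s) L : ℝ) = (en (Fintype.piFinset (fun _ : Fin s => Finset.range L))
    (fun z => ∑ i, mom (e + 2) (z i)) : ℕ) := rfl
  rw [← hJ] at h6
  calc (M * (δ / 2 * L) ^ s) ^ 2 * (L : ℝ) ^ (e + 1)
      ≤ J (e + 2) (Fin s) L * (∑ n ∈ Finset.range M, ∑ m ∈ Finset.range M, ∏ j : Fin (e + 2),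
      ‖DD (s * L ^ ((j : ℕ) + 1)) (α * tc P h n j - α * tc P h m j)‖) * (L : ℝ) ^ (e + 1) := by
        gcongr
    _ = J (e + 2) (Fin s) L * ((∑ n ∈ Finset.range M, ∑ m ∈ Finset.range M, ∏ j : Fin (e + 2),
      ‖DD (s * L ^ ((j : ℕ) + 1)) (α * tc P h n j - α * tc P h m j)‖) * (L : ℝ) ^ (e + 1)) := by ring
    _ ≤ J (e + 2) (Fin s) L * ((2 * s : ℝ) ^ (e + 2) * (L : ℝ) ^ ((e + 3) * (e + 2) / 2) *
      ∑ n ∈ Finset.range M, ∑ m ∈ Finset.range M, ‖DD (s * L ^ (e + 1)) (φ * ((n : ℝ) - m))‖) := by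
        gcongr
    _ ≤ J (e + 2) (Fin s) L * ((2 * s : ℝ) ^ (e + 2) * (L : ℝ) ^ ((e + 3) * (e + 2) / 2) *
      (M * (2 * (near φ η M).card * ((s * L ^ (e + 1) : ℕ) + 1) + M / (2 * η)))) := by gcongr
    _ = _ := by ring

end VMV

namespace VMV

set_option maxHeartbeats 1000000 in
lemma core2 {e s : ℕ} (hs : 1 ≤ s) (hH : Hyp (e + 2) s (1 / 4)) : ∃ D : ℝ, 1 ≤ D ∧
    ∀ P : Polynomial ℤ, P.natDegree = e + 2 → ∀ (α y : ℝ) (M h l : ℕ), 1 ≤ M → 1 ≤ l → 0 < y →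
    8 * y * (h * (l : ℝ) ^ 4) ≤ M → M / y ≤ ‖fs P α M‖ →
    1 / (D * l * y ^ (2 * s)) * M ≤ (near (α * (e + 2) * P.leadingCoeff * (h : ℝ) ^ (e + 1))
      (D * l * y ^ (2 * s) / (l : ℝ) ^ (4 * (e + 1))) M).card := by
  obtain ⟨C, hC, hJ⟩ := hH
  have hsR : (1 : ℝ) ≤ s := by exact_mod_cast hs
  set C2 : ℝ := C * (2 * s : ℝ) ^ (e + 2) with hC2
  have hC20 : 0 < C2 := by positivity
  refine ⟨8 * s * C2 * 4 ^ s + 1, by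
    have : 0 ≤ 8 * s * C2 * 4 ^ s := by positivity
    linarith, ?_⟩
  intro P hP α y M h l hM hl hy hhl hf
  set D : ℝ := 8 * s * C2 * 4 ^ s + 1 with hD
  have hD0 : 0 < D := by rw [hD]; positivity
  have hlR : (1 : ℝ) ≤ l := by exact_mod_cast hl
  have hl0 : (0 : ℝ) < l := by linarith
  have hMR : (1 : ℝ) ≤ M := by exact_mod_cast hM
  set u : ℝ := y ^ (2 * s) with hu
  have hu0 : 0 < u := by positivity
  set Λ : ℝ := (l : ℝ) ^ (4 * (e + 1)) with hΛ
  have hΛ1 : 1 ≤ Λ := one_le_pow₀ hlR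
  set η : ℝ := D * l * u / Λ with hη
  have hη0 : 0 < η := by positivity
  have hL : 1 ≤ l ^ 4 := Nat.one_le_pow _ _ hl
  have h1 := core1 hs P hP α (1 / y) η M h (l ^ 4) hM hL (by positivity) hη0 (by
    push_cast
    rw [one_div_mul_eq_div, le_div_iff₀ hy]
    linarith) (by rw [one_div_mul_eq_div]; exact hf)
  set Nn : ℝ := ((near (α * (e + 2) * P.leadingCoeff * (h : ℝ) ^ (e + 1)) η M).card : ℝ) with hNn
  have hNn0 : 0 ≤ Nn := Nat.cast_nonneg _
  have hLc : ((l ^ 4 : ℕ) : ℝ) = (l : ℝ) ^ 4 := by push_cast; rfl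
  have hLΛ : ((l : ℝ) ^ 4) ^ (e + 1) = Λ := by rw [hΛ, pow_mul]
  -- mean value bound
  have h2 : (J (e + 2) (Fin s) (l ^ 4) : ℝ) * ((l : ℝ) ^ 4) ^ ((e + 3) * (e + 2) / 2) ≤
      C * (((l : ℝ) ^ 4) ^ (2 * s) * l) := by
    have h3 := hJ (l ^ 4) hL
    rw [hLc] at h3
    have hX0 : (0 : ℝ) < (l : ℝ) ^ 4 := by positivity
    have h4 : ((l : ℝ) ^ 4) ^ ((e + 3) * (e + 2) / 2) = ((l : ℝ) ^ 4) ^ ((e + 3 : ℝ) * (e + 2) / 2) := by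
      rw [← Real.rpow_natCast _ ((e + 3) * (e + 2) / 2)]
      congr 1
      have := tri_cast (e + 3)
      simp only [Nat.add_succ_sub_one] at this
      rw [this]
      push_cast
      ring
    rw [h4]
    calc (J (e + 2) (Fin s) (l ^ 4) : ℝ) * ((l : ℝ) ^ 4) ^ ((e + 3 : ℝ) * (e + 2) / 2)
        ≤ (C * ((l : ℝ) ^ 4) ^ (2 * (s : ℝ) - ((e + 2 : ℕ) : ℝ) * (((e + 2 : ℕ) : ℝ) + 1) / 2 + 1 / 4)) *
          ((l : ℝ) ^ 4) ^ ((e + 3 : ℝ) * (e + 2) / 2) := by gcongr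
      _ = C * (((l : ℝ) ^ 4) ^ (((2 * s : ℕ) : ℝ)) * ((l : ℝ) ^ 4) ^ (1 / 4 : ℝ)) := by
          rw [mul_assoc, ← Real.rpow_add hX0, ← Real.rpow_add hX0]
          congr 2
          push_cast
          ring
      _ = _ := by
          rw [Real.rpow_natCast]
          congr 2
          rw [← Real.rpow_natCast (l : ℝ) 4, ← Real.rpow_mul hl0.le]
          norm_num
  rw [hLc, hLΛ] at h1
  have hcast : ((s * (l ^ 4) ^ (e + 1) : ℕ) : ℝ) = s * Λ := by
    push_cast
    rw [hLΛ]
  rw [hcast] at h1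
  set R : ℝ := M * (2 * Nn * (s * Λ + 1) + M / (2 * η)) with hR
  have hR0 : 0 ≤ R := by positivity
  set Z : ℝ := ((l : ℝ) ^ 4) ^ (2 * s) with hZ
  have hZ0 : 0 < Z := by positivity
  have h3 : (M * (1 / y / 2 * (l : ℝ) ^ 4) ^ s) ^ 2 * Λ ≤ C2 * (Z * l) * R := by
    refine h1.trans ?_
    calc (J (e + 2) (Fin s) (l ^ 4) : ℝ) * ((2 * s : ℝ) ^ (e + 2) *
          ((l : ℝ) ^ 4) ^ ((e + 3) * (e + 2) / 2)) * R
        = ((J (e + 2) (Fin s) (l ^ 4) : ℝ) * ((l : ℝ) ^ 4) ^ ((e + 3) * (e + 2) / 2)) *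
          (2 * s : ℝ) ^ (e + 2) * R := by ring
      _ ≤ (C * (Z * l)) * (2 * s : ℝ) ^ (e + 2) * R := by gcongr
      _ = _ := by rw [hC2]; ring
  have h4 : (M * (1 / y / 2 * (l : ℝ) ^ 4) ^ s) ^ 2 = (M : ℝ) ^ 2 * (Z / (4 ^ s * u)) := by
    rw [hZ, hu, mul_pow, ← pow_mul, mul_comm s 2, mul_pow, div_div, div_pow, one_pow, mul_pow,
      pow_mul 2 2 s, show (2 : ℝ) ^ 2 = 4 by norm_num]
    ring
  rw [h4] at h3
  have h5 : (M : ℝ) ^ 2 * Λ ≤ 4 ^ s * u * C2 * l * R := by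
    have h6 : (M : ℝ) ^ 2 * (Z / (4 ^ s * u)) * Λ = (M : ℝ) ^ 2 * Λ * Z / (4 ^ s * u) := by ring
    rw [h6, div_le_iff₀ (by positivity)] at h3
    refine le_of_mul_le_mul_right ?_ hZ0
    linarith
  have h6 : M * Λ ≤ 4 ^ s * u * C2 * l * (4 * s * Λ * Nn + M / (2 * η)) := by
    have hM0 : (0 : ℝ) < M := by linarith
    refine le_of_mul_le_mul_left ?_ hM0
    have h7 : R ≤ M * (4 * s * Λ * Nn + M / (2 * η)) := by
      rw [hR]
      refine mul_le_mul_of_nonneg_left (add_le_add ?_ le_rfl) hM0.le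
      have h1s : (1 : ℝ) ≤ s * Λ := one_le_mul_of_one_le_of_one_le hsR hΛ1
      calc 2 * Nn * (s * Λ + 1) ≤ 2 * Nn * (s * Λ + s * Λ) := by gcongr
        _ = 4 * s * Λ * Nn := by ring
    calc (M : ℝ) * (M * Λ) = (M : ℝ) ^ 2 * Λ := by ring
      _ ≤ _ := h5
      _ ≤ 4 ^ s * u * C2 * l * (M * (4 * s * Λ * Nn + M / (2 * η))) := by gcongr
      _ = _ := by ring
  have h7 : 4 ^ s * u * C2 * l * (M / (2 * η)) ≤ M * Λ / 2 := by
    have : 4 ^ s * u * C2 * l * (M / (2 * η)) = (4 ^ s * C2 / D) * (M * Λ / 2) := by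
      rw [hη]
      field_simp
    rw [this]
    have h8 : 4 ^ s * C2 / D ≤ 1 := by
      rw [div_le_one hD0, hD]
      have h10 : 0 < 4 ^ s * C2 := by positivity
      have h11 : 4 ^ s * C2 * 1 ≤ 4 ^ s * C2 * s := by gcongr
      have h12 : 8 * s * C2 * 4 ^ s = 8 * (4 ^ s * C2 * s) := by ring
      rw [h12]
      linarith
    have h13 : 0 ≤ M * Λ / 2 := by positivity
    exact mul_le_of_le_one_left h13 h8
  have h8 : M * Λ ≤ (D * l * u * Nn) * Λ := by
    have h9 : 4 ^ s * u * C2 * l * (4 * s * Λ * Nn) = (D - 1) / 2 * (l * u * Nn) * Λ := by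
      rw [hD]; ring
    rw [mul_add, h9] at h6
    have h10 : 0 ≤ l * u * Nn * Λ := by positivity
    have h11 : (D - 1) / 2 * (l * u * Nn) * Λ = (D * l * u * Nn * Λ - l * u * Nn * Λ) / 2 := by ring
    rw [h11] at h6
    linarith
  have h9 := le_of_mul_le_mul_right h8 (by linarith)
  rw [one_div_mul_eq_div, div_le_iff₀ (by positivity)]
  linarith

lemma bootstrap (lam κ Q : ℝ) (d H : ℕ) (hQ : 1 ≤ Q) (hH : 1 ≤ H)
    (h : ∀ h : ℕ, 1 ≤ h → h ≤ H → ∃ q : ℕ, 1 ≤ q ∧ (q : ℝ) ≤ Q ∧ ∃ a : ℤ,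
      |q * (lam * (h : ℝ) ^ d) - a| ≤ κ)
    (hsmall : (1 + 2 ^ d * Q) * κ * Q < 1) :
    ∃ q : ℕ, 1 ≤ q ∧ (q : ℝ) ≤ Q ∧ ∃ a : ℤ, |q * lam - a| * (H : ℝ) ^ d ≤ Q * κ := by
  obtain ⟨q1, hq1, hq1Q, a1, ha1⟩ := h 1 le_rfl hH
  refine ⟨q1, hq1, hq1Q, a1, ?_⟩
  have hq1R : (1 : ℝ) ≤ q1 := by exact_mod_cast hq1
  have hq10 : (0 : ℝ) < q1 := by linarith
  set β := lam - a1 / q1 with hβ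
  have hβ1 : q1 * lam - a1 = q1 * β := by rw [hβ]; field_simp
  have key : ∀ h : ℕ, 1 ≤ h → h ≤ H → |β| * (h : ℝ) ^ d ≤ κ := by
    intro m hm
    induction m, hm using Nat.le_induction with
    | base =>
      intro _
      simp only [Nat.cast_one, one_pow, mul_one] at ha1 ⊢
      rw [hβ1, abs_mul, abs_of_pos hq10] at ha1
      have : 0 ≤ |β| := abs_nonneg _
      nlinarith
    | succ m hm ih =>
      intro hmH
      have ih' := ih (by omega)
      obtain ⟨q, hq, hqQ, a, ha⟩ := h (m + 1) (by omega) hmH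
      have hqR : (1 : ℝ) ≤ q := by exact_mod_cast hq
      have hmR : (1 : ℝ) ≤ m := by exact_mod_cast hm
      set t : ℝ := ((m + 1 : ℕ) : ℝ) ^ d with ht
      have ht0 : 0 ≤ t := by positivity
      have h1 : |β| * t ≤ 2 ^ d * κ := by
        have : t ≤ 2 ^ d * (m : ℝ) ^ d := by
          rw [ht, ← mul_pow]
          refine pow_le_pow_left₀ (by positivity) ?_ d
          push_cast
          linarith
        calc |β| * t ≤ |β| * (2 ^ d * (m : ℝ) ^ d) := by gcongr
          _ = 2 ^ d * (|β| * (m : ℝ) ^ d) := by ring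
          _ ≤ _ := by gcongr
      set I : ℤ := q * a1 * ((m + 1 : ℕ) : ℤ) ^ d - a * q1 with hI
      have hIR : (I : ℝ) = q1 * ((q * (lam * t) - a) - q * (β * t)) := by
        rw [hI, hβ, ht]
        push_cast
        field_simp
        ring
      have hI0 : I = 0 := by
        rw [← Int.abs_lt_one_iff]
        have : |(I : ℝ)| < 1 := by
          rw [hIR, abs_mul, abs_of_pos hq10]
          have h2 : |(q * (lam * t) - a) - q * (β * t)| ≤ κ + Q * (2 ^ d * κ) := by
            refine (abs_sub _ _).trans (add_le_add ha ?_)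
            rw [abs_mul, abs_mul, Nat.abs_cast, abs_of_nonneg ht0]
            gcongr
          calc (q1 : ℝ) * |(q * (lam * t) - a) - q * (β * t)| ≤ Q * (κ + Q * (2 ^ d * κ)) := by gcongr
            _ = (1 + 2 ^ d * Q) * κ * Q := by ring
            _ < 1 := hsmall
        exact_mod_cast this
      rw [hI0, Int.cast_zero] at hIR
      have h3 : (q * (lam * t) - a) = q * (β * t) := by
        have := (mul_eq_zero.1 hIR.symm).resolve_left hq10.ne'
        linarith
      rw [h3, abs_mul, abs_mul, Nat.abs_cast, abs_of_nonneg ht0] at ha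
      have : 0 ≤ |β| * t := by positivity
      nlinarith
  have h1 := key H hH le_rfl
  rw [hβ1, abs_mul, abs_of_pos hq10, mul_assoc]
  have : 0 ≤ |β| * (H : ℝ) ^ d := by positivity
  gcongr

end VMV

namespace VMV

set_option maxHeartbeats 1000000 in
lemma weyl {e s : ℕ} (hs : e + 1 ≤ s) (hH : Hyp (e + 2) s (1 / 4)) : ∃ C : ℝ, 1 ≤ C ∧
    ∀ P : Polynomial ℤ, P.natDegree = e + 2 → ∀ (α y : ℝ) (M : ℕ), 1 ≤ y →
    C * y ^ (20 * s) ≤ M → M / y ≤ ‖fs P α M‖ →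
    ∃ q : ℕ, 1 ≤ q ∧ (q : ℝ) ≤ C * y ^ (4 * s) ∧ ∃ a : ℤ,
      |q * (α * (e + 2) * P.leadingCoeff) - a| ≤ C * y ^ (17 * s) / (M : ℝ) ^ (e + 2) := by
  obtain ⟨D, hD, hcore⟩ := core2 (by omega) hH
  set d := e + 1 with hd
  set C : ℝ := 2 ^ d * 16 ^ d * 10 * 12 ^ 5 * D ^ 8 with hC
  have h2d : (1 : ℝ) ≤ 2 ^ d := one_le_pow₀ (by norm_num)
  have h16d : (1 : ℝ) ≤ 16 ^ d := one_le_pow₀ (by norm_num)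
  have hD8 : (1 : ℝ) ≤ D ^ 8 := one_le_pow₀ hD
  have hCbig : (2 : ℝ) ^ d * 16 ^ d ≤ 2 ^ d * 16 ^ d * D ^ 8 := le_mul_of_one_le_right (by positivity) hD8
  have hC1 : 1 ≤ C := by
    have : (1 : ℝ) ≤ 2 ^ d * 16 ^ d := one_le_mul_of_one_le_of_one_le h2d h16d
    rw [hC]
    have h : (2 : ℝ) ^ d * 16 ^ d * 10 * 12 ^ 5 * D ^ 8 = (2 ^ d * 16 ^ d * D ^ 8) * (10 * 12 ^ 5) := by ring
    rw [h]
    linarith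
  refine ⟨C, hC1, ?_⟩
  intro P hP α y M hy hM hf
  have hD0 : 0 < D := by linarith
  have hy0 : 0 < y := by linarith
  set Y : ℝ := y ^ s with hY
  have hY1 : 1 ≤ Y := one_le_pow₀ hy
  have hY0 : 0 < Y := by linarith
  have hyd : y ^ d ≤ Y := pow_le_pow_right₀ hy hs
  have hyY : y ≤ Y := by
    calc y = y ^ 1 := (pow_one y).symm
      _ ≤ Y := pow_le_pow_right₀ hy (by omega)
  have e20 : y ^ (20 * s) = Y ^ 20 := by rw [hY, ← pow_mul, mul_comm]
  have e4 : y ^ (4 * s) = Y ^ 4 := by rw [hY, ← pow_mul, mul_comm]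
  have e17 : y ^ (17 * s) = Y ^ 17 := by rw [hY, ← pow_mul, mul_comm]
  have e2 : y ^ (2 * s) = Y ^ 2 := by rw [hY, ← pow_mul, mul_comm]
  rw [e20] at hM
  rw [e4, e17]
  -- the general size comparison
  have hcmp : ∀ (c : ℝ) (i j : ℕ), i ≤ 8 → j ≤ 20 → 0 ≤ c → c ≤ 2 ^ d * 16 ^ d * 10 * 12 ^ 5 →
      c * D ^ i * Y ^ j ≤ M := by
    intro c i j hi hj hc hcc
    refine le_trans ?_ hM
    rw [hC]
    gcongr
  have h216 : (1 : ℝ) ≤ 2 ^ d * 16 ^ d := one_le_mul_of_one_le_of_one_le h2d h16d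
  set x0 : ℝ := 5 * D * Y ^ 2 with hx0
  have hx05 : 5 ≤ x0 := by
    have : 1 ≤ D * Y ^ 2 := one_le_mul_of_one_le_of_one_le hD (one_le_pow₀ hY1)
    rw [hx0]; linarith
  set l : ℕ := ⌈x0⌉₊ with hl
  have hl1 : x0 ≤ l := Nat.le_ceil _
  have hl2 : (l : ℝ) ≤ 6 * D * Y ^ 2 := by
    have : (l : ℝ) < x0 + 1 := Nat.ceil_lt_add_one (by linarith)
    have : x0 = 5 * (D * Y ^ 2) := by rw [hx0]; ring
    linarith
  have hlR : (1 : ℝ) ≤ l := by linarith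
  have hlN : 1 ≤ l := by exact_mod_cast hlR
  have hl0 : (0 : ℝ) < l := by linarith
  have hM0 : (0 : ℝ) < M := by
    have := hcmp 1 0 0 (by norm_num) (by norm_num) zero_le_one (by linarith)
    simp at this
    exact_mod_cast this
  have hMN : 1 ≤ M := by exact_mod_cast hM0
  set W : ℝ := D * l * Y ^ 2 with hW
  have hW1 : 1 ≤ W := one_le_mul_of_one_le_of_one_le (one_le_mul_of_one_le_of_one_le hD hlR) (one_le_pow₀ hY1)
  have hW0 : 0 < W := by linarith
  have hW6 : W ≤ 6 * D ^ 2 * Y ^ 4 := by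
    calc W ≤ D * (6 * D * Y ^ 2) * Y ^ 2 := by rw [hW]; gcongr
      _ = _ := by ring
  set Q : ℝ := 12 * D ^ 2 * Y ^ 4 with hQ
  have hWQ : 2 * W ≤ Q := by rw [hQ]; linarith
  have hQ0 : 0 < Q := by linarith
  set η : ℝ := W / (l : ℝ) ^ (4 * d) with hη
  have hη0 : 0 < η := by positivity
  have hηl : η * (l : ℝ) ^ (4 * d) = W := by rw [hη]; field_simp
  have hηW : η * W ≤ 1 / 20 := by
    have h1 : 20 * W ^ 2 ≤ (l : ℝ) ^ (4 * d) := by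
      calc 20 * W ^ 2 ≤ 25 * W ^ 2 := by gcongr; norm_num
        _ = (l : ℝ) ^ 2 * x0 ^ 2 := by rw [hW, hx0]; ring
        _ ≤ (l : ℝ) ^ 2 * (l : ℝ) ^ 2 := by gcongr
        _ = (l : ℝ) ^ 4 := by ring
        _ ≤ _ := pow_le_pow_right₀ hlR (by omega)
    rw [hη, div_mul_eq_mul_div, div_le_iff₀ (by positivity)]
    linarith
  set κ : ℝ := 10 * η * Q * W / M with hκ
  have hκ0 : 0 < κ := by positivity
  have hκM : κ * M = 10 * (η * W) * Q := by rw [hκ]; field_simp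
  -- hmax
  set B : ℝ := 8 * y * (l : ℝ) ^ 4 with hB
  have hB0 : 0 < B := by positivity
  have hBM : B ≤ M := by
    have h1 := hcmp (8 * 6 ^ 4) 4 9 (by norm_num) (by norm_num) (by norm_num) (by linarith)
    refine le_trans ?_ h1
    calc B ≤ 8 * Y * (6 * D * Y ^ 2) ^ 4 := by rw [hB]; gcongr
      _ = _ := by ring
  set H : ℕ := ⌊(M : ℝ) / B⌋₊ with hHdef
  have hH1 : 1 ≤ H := by
    rw [hHdef, Nat.one_le_floor_iff, le_div_iff₀ hB0]
    linarith
  have hHle : (H : ℝ) * B ≤ M := by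
    rw [← le_div_iff₀ hB0]
    exact Nat.floor_le (by positivity)
  have hHge : (M : ℝ) ≤ H * (2 * B) := by
    have h1 : (M : ℝ) / B < H + 1 := Nat.lt_floor_add_one _
    rw [div_lt_iff₀ hB0] at h1
    have h2 : (1 : ℝ) ≤ H := by exact_mod_cast hH1
    have h3 : 1 * B ≤ H * B := by gcongr
    linarith
  have hboot := bootstrap (α * (e + 2) * P.leadingCoeff) κ Q d H (by linarith) hH1 (by
    intro h hh1 hhH
    have h1 : 8 * y * (h * (l : ℝ) ^ 4) ≤ M := by
      have h2 : (h : ℝ) * B ≤ H * B := by gcongr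
      calc 8 * y * (h * (l : ℝ) ^ 4) = h * B := by rw [hB]; ring
        _ ≤ M := h2.trans hHle
    have h2 := hcore P hP α y M h l hMN hlN hy0 h1 hf
    rw [e2] at h2
    obtain ⟨q, hq, hq2, a, ha⟩ := near_lemma hη0 (δ := 1 / W) (by positivity)
      (by rw [div_le_one hW0]; exact hW1)
      (by
        rw [div_div, le_div_iff₀ (by positivity)]
        linarith)
      (by
        rw [one_div_mul_eq_div, lt_div_iff₀ hW0]
        have h3 := hcmp 13 2 4 (by norm_num) (by norm_num) (by norm_num) (by linarith)
        have h4 : 0 < D ^ 2 * Y ^ 4 := by positivity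
        linarith) h2
    have hqQ : (q : ℝ) ≤ Q := by
      refine hq2.trans (le_trans (le_of_eq ?_) hWQ)
      field_simp
    refine ⟨q, hq, hqQ, a, ha.trans ?_⟩
    calc 10 * η * q / (1 / W * M) = 10 * η * q * W / M := by field_simp
      _ ≤ κ := by rw [hκ]; gcongr) (by
    have h1 : (1 + 2 ^ d * Q) * κ * Q * M < 1 * M := by
      have hQ1 : 1 ≤ 2 ^ d * Q := one_le_mul_of_one_le_of_one_le h2d (by linarith)
      have h3 := hcmp (2 ^ d * 12 ^ 3 * 2) 6 12 (by norm_num) (by norm_num) (by positivity) (by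
        have : (2 : ℝ) ^ d * 12 ^ 3 * 2 = 2 ^ d * 1 * (12 ^ 3 * 2) := by ring
        have h5 : (2 : ℝ) ^ d * 16 ^ d * 10 * 12 ^ 5 = 2 ^ d * 16 ^ d * (10 * 12 ^ 5) := by ring
        rw [this, h5]
        exact mul_le_mul (mul_le_mul_of_nonneg_left h16d (by positivity)) (by norm_num) (by norm_num)
          (by positivity))
      have h4 : 0 < 2 ^ d * Q ^ 3 := by positivity
      calc (1 + 2 ^ d * Q) * κ * Q * M = (1 + 2 ^ d * Q) * (κ * M) * Q := by ring
        _ ≤ (2 ^ d * Q + 2 ^ d * Q) * (10 * (1 / 20) * Q) * Q := by rw [hκM]; gcongr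
        _ = 2 ^ d * Q ^ 3 := by ring
        _ < 2 * (2 ^ d * Q ^ 3) := by linarith
        _ = 2 ^ d * 12 ^ 3 * 2 * D ^ 6 * Y ^ 12 := by rw [hQ]; ring
        _ ≤ 1 * M := by linarith
    exact lt_of_mul_lt_mul_right h1 hM0.le)
  obtain ⟨q, hq, hqQ, a, ha⟩ := hboot
  refine ⟨q, hq, ?_, a, ?_⟩
  · refine hqQ.trans ?_
    rw [hQ, hC]
    have h1 : (12 : ℝ) ≤ 2 ^ d * 16 ^ d * 10 * 12 ^ 5 := by linarith
    have h2 : D ^ 2 ≤ D ^ 8 := pow_le_pow_right₀ hD (by norm_num)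
    gcongr
  · have hH0 : (0 : ℝ) < H := by exact_mod_cast hH1
    set X := |q * (α * (e + 2) * P.leadingCoeff) - a| with hX
    have hX0 : 0 ≤ X := abs_nonneg _
    rw [le_div_iff₀ (by positivity)]
    have hed : e + 2 = d + 1 := by omega
    rw [hed, pow_succ]
    calc X * ((M : ℝ) ^ d * M) ≤ X * ((H * (2 * B)) ^ d * M) := by gcongr
      _ = (X * H ^ d) * ((2 * B) ^ d * M) := by rw [mul_pow (H : ℝ)]; ring
      _ ≤ (Q * κ) * ((2 * B) ^ d * M) := by gcongr
      _ = Q * (κ * M) * (2 * B) ^ d := by ring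
      _ = 10 * Q ^ 2 * W * (η * (l : ℝ) ^ (4 * d)) * 16 ^ d * y ^ d := by
          rw [hκM, hB, pow_mul, show 2 * (8 * y * (l : ℝ) ^ 4) = 16 * y * (l : ℝ) ^ 4 by ring, mul_pow, mul_pow]
          ring
      _ = 10 * Q ^ 2 * W * W * 16 ^ d * y ^ d := by rw [hηl]
      _ ≤ 10 * Q ^ 2 * Q * Q * 16 ^ d * Y := by
          have : W ≤ Q := by linarith
          gcongr
      _ = 1 * 16 ^ d * 10 * 12 ^ 4 * D ^ 8 * Y ^ 17 := by rw [hQ]; ring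
      _ ≤ C * Y ^ 17 := by
          rw [hC]
          gcongr
          · norm_num
          · norm_num

end VMV

namespace VMV

lemma ee_eq_one {x : ℝ} (h : ee x = 1) : ∃ n : ℤ, x = n := by
  unfold ee at h
  rw [Complex.exp_eq_one_iff] at h
  obtain ⟨n, hn⟩ := h
  refine ⟨n, ?_⟩
  have h1 : (((2 * Real.pi * x : ℝ) : ℂ)) * Complex.I = ((n * (2 * Real.pi) : ℝ) : ℂ) * Complex.I := by
    rw [hn]; push_cast; ring
  have h2 := mul_right_cancel₀ Complex.I_ne_zero h1
  have h3 : 2 * Real.pi * x = n * (2 * Real.pi) := by exact_mod_cast h2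
  have := Real.pi_pos
  have h4 : 2 * Real.pi * x = 2 * Real.pi * n := by linarith
  exact mul_left_cancel₀ (by positivity) h4

lemma geom_ee (N : ℕ) (hN : 1 ≤ N) (m : ℤ) :
    ∑ t ∈ Finset.range N, ee ((t : ℝ) / N * m) = if (N : ℤ) ∣ m then (N : ℂ) else 0 := by
  have hN0 : (N : ℝ) ≠ 0 := by positivity
  have h1 : ∀ t : ℕ, ee ((t : ℝ) / N * m) = ee (m / N) ^ t := by
    intro t
    rw [← ee_natmul]
    congr 1
    ring
  simp_rw [h1]
  split_ifs with h
  · obtain ⟨c, rfl⟩ := h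
    have : ((((N : ℤ) * c : ℤ) : ℝ) / N) = c := by push_cast; field_simp
    rw [this, ee_int]
    simp
  · have h2 : ee ((m : ℝ) / N) ≠ 1 := by
      intro h3
      obtain ⟨n, hn⟩ := ee_eq_one h3
      apply h
      refine ⟨n, ?_⟩
      rw [div_eq_iff hN0] at hn
      have : m = n * N := by exact_mod_cast hn
      rw [this, mul_comm]
    rw [geom_sum_eq h2, ← ee_natmul, div_mul_cancel₀ _ hN0, ee_int]
    simp

lemma orth {ι : Type*} (T : Finset ι) (φ : ι → ℤ) (N : ℕ) (hN : 1 ≤ N) :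
    ∑ t ∈ Finset.range N, ‖∑ z ∈ T, ee ((t : ℝ) / N * φ z)‖ ^ 2 =
      (N : ℝ) * ((T ×ˢ T).filter (fun p => (N : ℤ) ∣ φ p.1 - φ p.2)).card := by
  have key : ((∑ t ∈ Finset.range N, ‖∑ z ∈ T, ee ((t : ℝ) / N * φ z)‖ ^ 2 : ℝ) : ℂ) =
      ((N : ℝ) * ((T ×ˢ T).filter (fun p => (N : ℤ) ∣ φ p.1 - φ p.2)).card : ℝ) := by
    push_cast
    have h1 : ∀ t : ℕ, ((‖∑ z ∈ T, ee ((t : ℝ) / N * φ z)‖ : ℂ)) ^ 2 =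
        ∑ p ∈ T ×ˢ T, ee ((t : ℝ) / N * ((φ p.1 - φ p.2 : ℤ) : ℝ)) := by
      intro t
      rw [← Complex.mul_conj', map_sum, Finset.sum_mul_sum, Finset.sum_product]
      refine Finset.sum_congr rfl fun z _ => Finset.sum_congr rfl fun w _ => ?_
      rw [conj_ee, ← ee_add]
      congr 1
      push_cast
      ring
    simp_rw [h1]
    rw [Finset.sum_comm]
    simp_rw [geom_ee N hN]
    rw [← Finset.sum_filter, Finset.sum_const, nsmul_eq_mul, mul_comm]
  exact_mod_cast key

lemma fs_pow (P : Polynomial ℤ) (α : ℝ) (K M : ℕ) :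
    fs P α M ^ K = ∑ z ∈ Fintype.piFinset (fun _ : Fin K => Finset.range M),
      ee (α * ((∑ i, P.eval (z i : ℤ) : ℤ) : ℝ)) := by
  unfold fs
  rw [Finset.sum_pow']
  refine Finset.sum_congr rfl fun z _ => ?_
  rw [← ee_sum]
  congr 1
  push_cast
  rw [Finset.mul_sum]

lemma norm_fs_le (P : Polynomial ℤ) (α : ℝ) (M : ℕ) : ‖fs P α M‖ ≤ M := by
  unfold fs
  refine (norm_sum_le _ _).trans ?_
  simp [norm_ee]

lemma cnt_le (P : Polynomial ℤ) (K M N : ℕ) (hN : 1 ≤ N) :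
    (N : ℝ) * cnt P K M ≤ ∑ t ∈ Finset.range N, ‖fs P ((t : ℝ) / N) M‖ ^ (2 * K) := by
  have h := orth (Fintype.piFinset (fun _ : Fin K => Finset.range M)) (fun z => ∑ i, P.eval (z i : ℤ)) N hN
  have h2 : ∀ t ∈ Finset.range N, ‖fs P ((t : ℝ) / N) M‖ ^ (2 * K) =
      ‖∑ z ∈ Fintype.piFinset (fun _ : Fin K => Finset.range M),
      ee ((t : ℝ) / N * ((∑ i, P.eval (z i : ℤ) : ℤ) : ℝ))‖ ^ 2 := by
    intro t _
    rw [← fs_pow, norm_pow, ← pow_mul, mul_comm]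
  rw [Finset.sum_congr rfl h2, h]
  gcongr
  unfold cnt en
  refine Finset.card_le_card ?_
  intro p hp
  rw [Finset.mem_filter] at hp ⊢
  refine ⟨hp.1, ?_⟩
  have := hp.2
  simp only at this ⊢
  rw [this]
  simp

lemma cnt_eq (P : Polynomial ℤ) (K M : ℕ) : ∃ N0 : ℕ, 1 ≤ N0 ∧ ∀ N : ℕ, N0 ≤ N →
    ∑ t ∈ Finset.range N, ‖fs P ((t : ℝ) / N) M‖ ^ (2 * K) = (N : ℝ) * cnt P K M := by
  set T := Fintype.piFinset (fun _ : Fin K => Finset.range M) with hT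
  set φ : (Fin K → ℕ) → ℤ := fun z => ∑ i, P.eval (z i : ℤ) with hφ
  refine ⟨1 + ∑ p ∈ T ×ˢ T, (φ p.1 - φ p.2).natAbs, by omega, ?_⟩
  intro N hN
  have h := orth T φ N (by omega)
  have h2 : ∀ t ∈ Finset.range N, ‖fs P ((t : ℝ) / N) M‖ ^ (2 * K) =
      ‖∑ z ∈ T, ee ((t : ℝ) / N * φ z)‖ ^ 2 := by
    intro t _
    rw [← fs_pow, norm_pow, ← pow_mul, mul_comm]
  rw [Finset.sum_congr rfl h2, h]
  congr 2
  unfold cnt en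
  congr 1
  refine Finset.filter_congr ?_
  intro p hp
  constructor
  · intro hd
    have h3 : (φ p.1 - φ p.2).natAbs < N := by
      have := Finset.single_le_sum (f := fun p : (Fin K → ℕ) × (Fin K → ℕ) => (φ p.1 - φ p.2).natAbs)
        (fun _ _ => Nat.zero_le _) hp
      omega
    have h4 := Int.eq_zero_of_dvd_of_natAbs_lt_natAbs hd (by simpa using h3)
    have : φ p.1 = φ p.2 := by omega
    exact this
  · intro he
    have : φ p.1 = φ p.2 := he
    rw [this]
    simp

lemma card_le_of_diam (S : Finset ℕ) (L : ℝ) (hL : 0 ≤ L)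
    (h : ∀ t ∈ S, ∀ u ∈ S, (t : ℝ) - u ≤ L) : (S.card : ℝ) ≤ L + 1 := by
  rcases S.eq_empty_or_nonempty with rfl | hS
  · simp; linarith
  · have h1 : S ⊆ Finset.Icc (S.min' hS) (S.max' hS) := fun t ht =>
      Finset.mem_Icc.2 ⟨Finset.min'_le _ _ ht, Finset.le_max' _ _ ht⟩
    have h2 := Finset.card_le_card h1
    rw [Nat.card_Icc] at h2
    have h3 := h _ (S.max'_mem hS) _ (S.min'_mem hS)
    have h4 : S.min' hS ≤ S.max' hS := Finset.min'_le _ _ (S.max'_mem hS)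
    have h5 : S.card + S.min' hS ≤ S.max' hS + 1 := by omega
    have h6 : (S.card : ℝ) + S.min' hS ≤ S.max' hS + 1 := by exact_mod_cast h5
    linarith

open Classical in
lemma major_count (b : ℤ) (hb : b ≠ 0) (N : ℕ) (hN : 1 ≤ N) (η : ℝ) (hη : 0 ≤ η) :
    (((Finset.range N).filter (fun t : ℕ => ∃ a : ℤ, |(t : ℝ) / N * b - a| ≤ η)).card : ℝ) ≤
      10 * η * N + 5 * |(b : ℝ)| := by
  have hNR : (1 : ℝ) ≤ N := by exact_mod_cast hN
  have hN0 : (0 : ℝ) < N := by linarith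
  set β : ℝ := |(b : ℝ)| with hβ
  have hb1 : (1 : ℝ) ≤ β := by
    have : 1 ≤ |b| := Int.one_le_abs hb
    rw [hβ]; exact_mod_cast this
  have hb0 : 0 < β := by linarith
  rcases le_or_gt η 1 with h1 | h1
  · set I : Finset ℤ := Finset.Icc (-(|b| + 1)) (|b| + 1) with hI
    have hIc : (I.card : ℝ) = 2 * β + 3 := by
      rw [hI, Int.card_Icc]
      have h2 : ((|b| + 1 + 1 - -(|b| + 1)).toNat : ℤ) = 2 * |b| + 3 := by
        rw [Int.toNat_of_nonneg (by have := abs_nonneg b; linarith)]; ring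
      have h3 : (((|b| + 1 + 1 - -(|b| + 1)).toNat : ℤ) : ℝ) = 2 * β + 3 := by
        rw [h2, hβ]; push_cast; ring
      exact_mod_cast h3
    have hsub : (Finset.range N).filter (fun t : ℕ => ∃ a : ℤ, |(t : ℝ) / N * b - a| ≤ η) ⊆
        I.biUnion (fun a => (Finset.range N).filter (fun t : ℕ => |(t : ℝ) / N * b - a| ≤ η)) := by
      intro t ht
      rw [Finset.mem_filter] at ht
      obtain ⟨ht1, a, ha⟩ := ht
      rw [Finset.mem_biUnion]
      refine ⟨a, ?_, Finset.mem_filter.2 ⟨ht1, ha⟩⟩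
      have htN : (t : ℝ) / N ≤ 1 := by
        rw [div_le_one hN0]
        exact_mod_cast (Finset.mem_range.1 ht1).le
      have h2 : |(t : ℝ) / N * b| ≤ β := by
        rw [abs_mul, abs_of_nonneg (by positivity)]
        exact mul_le_of_le_one_left hb0.le htN
      have h3 : |(a : ℝ)| ≤ β + 1 := by
        have h4 : (a : ℝ) = (t : ℝ) / N * b - ((t : ℝ) / N * b - a) := by ring
        rw [h4]
        refine (abs_sub _ _).trans ?_
        linarith
      have h5 : |a| ≤ |b| + 1 := by
        rw [hβ] at h3; exact_mod_cast h3
      rw [hI, Finset.mem_Icc]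
      exact abs_le.1 h5
    have hone : ∀ a ∈ I, (((Finset.range N).filter (fun t : ℕ => |(t : ℝ) / N * b - a| ≤ η)).card : ℝ) ≤
        2 * η * N / β + 1 := by
      intro a _
      refine card_le_of_diam _ _ (by positivity) ?_
      intro t ht u hu
      rw [Finset.mem_filter] at ht hu
      have h2 : |((t : ℝ) - u) / N * b| ≤ 2 * η := by
        have h4 : ((t : ℝ) - u) / N * b = ((t : ℝ) / N * b - a) - ((u : ℝ) / N * b - a) := by ring
        rw [h4]
        refine (abs_sub _ _).trans ?_
        linarith [ht.2, hu.2]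
      rw [abs_mul, abs_div, Nat.abs_cast] at h2
      refine (le_abs_self _).trans ?_
      rw [le_div_iff₀ hb0]
      rw [div_mul_eq_mul_div, div_le_iff₀ hN0] at h2
      exact h2
    calc _ ≤ ((I.biUnion (fun a => (Finset.range N).filter
            (fun t : ℕ => |(t : ℝ) / N * b - a| ≤ η))).card : ℝ) := by
          exact_mod_cast Finset.card_le_card hsub
      _ ≤ ∑ a ∈ I, (((Finset.range N).filter (fun t : ℕ => |(t : ℝ) / N * b - a| ≤ η)).card : ℝ) := by
          exact_mod_cast Finset.card_biUnion_le
      _ ≤ ∑ a ∈ I, (2 * η * N / β + 1) := Finset.sum_le_sum hone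
      _ = (2 * β + 3) * (2 * η * N / β + 1) := by
          rw [Finset.sum_const, nsmul_eq_mul, hIc]
      _ ≤ (5 * β) * (2 * η * N / β + 1) := by
          gcongr
          linarith
      _ = 10 * η * N + 5 * β := by field_simp; ring
  · have h2 : (((Finset.range N).filter (fun t : ℕ => ∃ a : ℤ, |(t : ℝ) / N * b - a| ≤ η)).card : ℝ) ≤ N := by
      have := Finset.card_filter_le (Finset.range N) (fun t : ℕ => ∃ a : ℤ, |(t : ℝ) / N * b - a| ≤ η)
      rw [Finset.card_range] at this
      exact_mod_cast this
    have h3 : 1 * (N : ℝ) ≤ η * N := by gcongr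
    linarith

open Classical in
lemma major_count' (b : ℤ) (hb : b ≠ 0) (N : ℕ) (hN : 1 ≤ N) (η Q : ℝ) (hη : 0 ≤ η) (hQ : 0 ≤ Q)
    (hbig : Q * |(b : ℝ)| ≤ η * N) :
    (((Finset.range N).filter (fun t : ℕ => ∃ q : ℕ, 1 ≤ q ∧ (q : ℝ) ≤ Q ∧
      ∃ a : ℤ, |q * ((t : ℝ) / N * b) - a| ≤ η)).card : ℝ) ≤ 15 * Q * η * N := by
  have hsub : (Finset.range N).filter (fun t : ℕ => ∃ q : ℕ, 1 ≤ q ∧ (q : ℝ) ≤ Q ∧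
      ∃ a : ℤ, |q * ((t : ℝ) / N * b) - a| ≤ η) ⊆ (Finset.Icc 1 ⌊Q⌋₊).biUnion (fun q =>
        (Finset.range N).filter (fun t : ℕ => ∃ a : ℤ, |(t : ℝ) / N * ((q * b : ℤ) : ℝ) - a| ≤ η)) := by
    intro t ht
    rw [Finset.mem_filter] at ht
    obtain ⟨ht1, q, hq1, hqQ, a, ha⟩ := ht
    rw [Finset.mem_biUnion]
    refine ⟨q, Finset.mem_Icc.2 ⟨hq1, Nat.le_floor hqQ⟩, Finset.mem_filter.2 ⟨ht1, a, ?_⟩⟩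
    convert ha using 2
    push_cast
    ring
  calc _ ≤ (((Finset.Icc 1 ⌊Q⌋₊).biUnion (fun q =>
        (Finset.range N).filter (fun t : ℕ => ∃ a : ℤ, |(t : ℝ) / N * ((q * b : ℤ) : ℝ) - a| ≤ η))).card : ℝ) := by
        exact_mod_cast Finset.card_le_card hsub
    _ ≤ ∑ q ∈ Finset.Icc 1 ⌊Q⌋₊, (((Finset.range N).filter
          (fun t : ℕ => ∃ a : ℤ, |(t : ℝ) / N * ((q * b : ℤ) : ℝ) - a| ≤ η)).card : ℝ) := by
        exact_mod_cast Finset.card_biUnion_le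
    _ ≤ ∑ q ∈ Finset.Icc 1 ⌊Q⌋₊, (15 * η * N) := by
        refine Finset.sum_le_sum fun q hq => ?_
        rw [Finset.mem_Icc] at hq
        have hqQ : (q : ℝ) ≤ Q := (Nat.le_floor_iff hQ).1 hq.2
        have h1 := major_count (q * b) (mul_ne_zero (by omega) hb) N hN η hη
        refine h1.trans ?_
        push_cast
        rw [abs_mul, Nat.abs_cast]
        have : (q : ℝ) * |(b : ℝ)| ≤ Q * |(b : ℝ)| := by gcongr
        linarith
    _ = ⌊Q⌋₊ * (15 * η * N) := by
        rw [Finset.sum_const, nsmul_eq_mul, Nat.card_Icc]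
        simp
    _ ≤ Q * (15 * η * N) := by
        gcongr
        exact Nat.floor_le hQ
    _ = _ := by ring

end VMV

namespace VMV

lemma sum_inv_sq_le (M : ℕ) : ∑ j ∈ Finset.Icc 1 M, 1 / (j : ℝ) ^ 2 ≤ 2 := by
  have h : ∀ M : ℕ, 1 ≤ M → ∑ j ∈ Finset.Icc 1 M, 1 / (j : ℝ) ^ 2 ≤ 2 - 1 / (M : ℝ) := by
    intro M hM
    induction M, hM using Nat.le_induction with
    | base => norm_num
    | succ n hn ih =>
      rw [Finset.sum_Icc_succ_top (by omega)]
      have hn0 : (0 : ℝ) < n := by exact_mod_cast hn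
      have h2 : 1 / ((n + 1 : ℕ) : ℝ) ^ 2 ≤ 1 / n - 1 / ((n + 1 : ℕ) : ℝ) := by
        push_cast
        rw [div_sub_div _ _ hn0.ne' (by positivity), div_le_div_iff₀ (by positivity) (by positivity)]
        nlinarith
      linarith
  rcases Nat.eq_zero_or_pos M with rfl | hM
  · simp
  · have := h M hM
    have : (0 : ℝ) ≤ 1 / M := by positivity
    linarith [h M hM]

set_option maxHeartbeats 1000000 in
open Classical in
lemma main_mean {e s : ℕ} (hs : e + 2 ≤ s) (hH : Hyp (e + 2) s (1 / 4)) (P : Polynomial ℤ)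
    (hP : P.natDegree = e + 2) : ∃ C0 : ℝ, 0 < C0 ∧ ∀ M : ℕ, 1 ≤ M → ∃ N : ℕ, 1 ≤ N ∧
      (∑ t ∈ Finset.range N, ‖fs P ((t : ℝ) / N) M‖ ^ (40 * s)) * (M : ℝ) ^ (e + 2) ≤
        C0 * N * (M : ℝ) ^ (40 * s) := by
  obtain ⟨C, hC1, hweyl⟩ := weyl (by omega) hH
  obtain ⟨C1, hC10, hsl⟩ := slicing_real (by omega) (by omega) hH
  have hC0 : 0 < C := by linarith
  refine ⟨C * C1 + 30 * C ^ 2 * 2 ^ (21 * s), by positivity, ?_⟩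
  intro M hM
  have hMR : (1 : ℝ) ≤ M := by exact_mod_cast hM
  have hM0 : (0 : ℝ) < M := by linarith
  set b : ℤ := (e + 2) * P.leadingCoeff with hb
  have hb0 : b ≠ 0 := by
    refine mul_ne_zero (by omega) ?_
    intro h
    rw [Polynomial.leadingCoeff_eq_zero] at h
    rw [h] at hP
    simp at hP
  obtain ⟨N0, hN0, hNeq⟩ := cnt_eq P s M
  set N1 : ℕ := ⌈(2 * M : ℝ) ^ (4 * s) * |(b : ℝ)| * (M : ℝ) ^ (e + 2)⌉₊ with hN1
  set N := N0 + N1 with hN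
  have hN1' : (2 * M : ℝ) ^ (4 * s) * |(b : ℝ)| * (M : ℝ) ^ (e + 2) ≤ N := by
    refine (Nat.le_ceil _).trans ?_
    rw [hN]; push_cast
    have : (0 : ℝ) ≤ N0 := Nat.cast_nonneg _
    linarith
  have hNone : 1 ≤ N := by omega
  have hNpos : (0 : ℝ) < N := by exact_mod_cast hNone
  refine ⟨N, hNone, ?_⟩
  set Q : ℕ → ℝ := fun j => C * (2 * j : ℝ) ^ (4 * s) with hQ
  set η : ℕ → ℝ := fun j => C * (2 * j : ℝ) ^ (17 * s) / (M : ℝ) ^ (e + 2) with hη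
  set S : ℕ → Finset ℕ := fun j => (Finset.range N).filter (fun t : ℕ => ∃ q : ℕ, 1 ≤ q ∧ (q : ℝ) ≤ Q j ∧
      ∃ a : ℤ, |q * ((t : ℝ) / N * b) - a| ≤ η j) with hS
  -- pointwise bound
  have hpt : ∀ t ∈ Finset.range N, ‖fs P ((t : ℝ) / N) M‖ ^ (40 * s) ≤
      C * (M : ℝ) ^ (38 * s - 1) * ‖fs P ((t : ℝ) / N) M‖ ^ (2 * s) +
      ∑ j ∈ Finset.Icc 1 M, (if t ∈ S j then ((M : ℝ) / j) ^ (40 * s) else 0) := by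
    intro t ht
    set f := ‖fs P ((t : ℝ) / N) M‖ with hf
    have hf0 : 0 ≤ f := norm_nonneg _
    have hfM : f ≤ M := norm_fs_le _ _ _
    have hsum0 : 0 ≤ ∑ j ∈ Finset.Icc 1 M, (if t ∈ S j then ((M : ℝ) / j) ^ (40 * s) else 0) :=
      Finset.sum_nonneg fun j _ => by split_ifs <;> positivity
    rcases hf0.eq_or_lt with h0 | hfpos
    · rw [← h0, zero_pow (by omega)]
      positivity
    set y := (M : ℝ) / f with hy
    have hy1 : 1 ≤ y := by rw [hy, le_div_iff₀ hfpos]; linarith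
    have hy0 : 0 < y := by linarith
    have hfy : f = M / y := by rw [hy]; field_simp
    rcases lt_or_ge (M : ℝ) (C * y ^ (20 * s)) with hmin | hmaj
    · have h1 : f ^ (20 * s) ≤ C * (M : ℝ) ^ (20 * s - 1) := by
        have h2 : (M : ℝ) ^ (20 * s) = (M : ℝ) ^ (20 * s - 1) * M := by
          rw [← pow_succ]; congr 1; omega
        rw [hfy, div_pow, div_le_iff₀ (by positivity), h2]
        calc (M : ℝ) ^ (20 * s - 1) * M ≤ (M : ℝ) ^ (20 * s - 1) * (C * y ^ (20 * s)) := by gcongr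
          _ = _ := by ring
      have h3 : f ^ (40 * s) = f ^ (2 * s) * f ^ (20 * s) * f ^ (18 * s) := by
        rw [← pow_add, ← pow_add]; congr 1; ring
      have h4 : (M : ℝ) ^ (38 * s - 1) = (M : ℝ) ^ (20 * s - 1) * (M : ℝ) ^ (18 * s) := by
        rw [← pow_add]; congr 1; omega
      have h5 : f ^ (40 * s) ≤ C * (M : ℝ) ^ (38 * s - 1) * f ^ (2 * s) := by
        rw [h3, h4]
        calc f ^ (2 * s) * f ^ (20 * s) * f ^ (18 * s)
            ≤ f ^ (2 * s) * (C * (M : ℝ) ^ (20 * s - 1)) * (M : ℝ) ^ (18 * s) := by gcongr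
          _ = _ := by ring
      linarith
    · obtain ⟨q, hq1, hqQ, a, ha⟩ := hweyl P hP ((t : ℝ) / N) y M hy1 hmaj hfy.ge
      set j := ⌊y⌋₊ with hj
      have hj1 : 1 ≤ j := by rw [hj, Nat.one_le_floor_iff]; exact hy1
      have hjR : (1 : ℝ) ≤ j := by exact_mod_cast hj1
      have hjy : (j : ℝ) ≤ y := Nat.floor_le hy0.le
      have hyj : y ≤ 2 * j := by
        have : y < j + 1 := Nat.lt_floor_add_one _
        linarith
      have hjM : j ≤ M := by
        have h1 : y ≤ y ^ (20 * s) := by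
          calc y = y ^ 1 := (pow_one y).symm
            _ ≤ _ := pow_le_pow_right₀ hy1 (by omega)
        have h2 : 1 * y ^ (20 * s) ≤ C * y ^ (20 * s) := by gcongr
        have : (j : ℝ) ≤ M := by linarith
        exact_mod_cast this
      have htS : t ∈ S j := by
        rw [hS]
        refine Finset.mem_filter.2 ⟨ht, q, hq1, ?_, a, ?_⟩
        · refine hqQ.trans ?_
          simp only [hQ]
          gcongr
        · have h1 : (t : ℝ) / N * (b : ℝ) = (t : ℝ) / N * (e + 2) * P.leadingCoeff := by
            rw [hb]; push_cast; ring
          rw [h1]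
          refine ha.trans ?_
          simp only [hη]
          gcongr
      have h2 := Finset.single_le_sum
        (f := fun j => if t ∈ S j then ((M : ℝ) / j) ^ (40 * s) else 0) (s := Finset.Icc 1 M)
        (fun j _ => by split_ifs <;> positivity) (Finset.mem_Icc.2 ⟨hj1, hjM⟩)
      simp only [htS, if_true] at h2
      have h3 : f ^ (40 * s) ≤ ((M : ℝ) / j) ^ (40 * s) := by
        rw [hfy]
        gcongr
      have h4 : 0 ≤ C * (M : ℝ) ^ (38 * s - 1) * f ^ (2 * s) := by positivity
      linarith
  -- size of major sets
  have hSc : ∀ j ∈ Finset.Icc 1 M, ((S j).card : ℝ) * (M : ℝ) ^ (e + 2) ≤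
      15 * C ^ 2 * 2 ^ (21 * s) * (j : ℝ) ^ (21 * s) * N := by
    intro j hj
    rw [Finset.mem_Icc] at hj
    have hjR : (1 : ℝ) ≤ j := by exact_mod_cast hj.1
    have hjM : (j : ℝ) ≤ M := by exact_mod_cast hj.2
    have hη0 : 0 ≤ η j := by simp only [hη]; positivity
    have hQ0 : 0 ≤ Q j := by simp only [hQ]; positivity
    have h1 := major_count' b hb0 N hNone (η j) (Q j) hη0 hQ0 (by
      simp only [hQ, hη]
      rw [div_mul_eq_mul_div, le_div_iff₀ (by positivity)]
      have h2 : (1 : ℝ) ≤ (2 * j : ℝ) ^ (17 * s) := one_le_pow₀ (by linarith)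
      calc C * (2 * j : ℝ) ^ (4 * s) * |(b : ℝ)| * (M : ℝ) ^ (e + 2)
          ≤ C * (2 * M : ℝ) ^ (4 * s) * |(b : ℝ)| * (M : ℝ) ^ (e + 2) := by gcongr
        _ = C * 1 * ((2 * M : ℝ) ^ (4 * s) * |(b : ℝ)| * (M : ℝ) ^ (e + 2)) := by ring
        _ ≤ C * (2 * j : ℝ) ^ (17 * s) * N := by gcongr)
    calc ((S j).card : ℝ) * (M : ℝ) ^ (e + 2) ≤ (15 * Q j * η j * N) * (M : ℝ) ^ (e + 2) := by gcongr
      _ = 15 * C ^ 2 * ((2 * j : ℝ) ^ (4 * s) * (2 * j : ℝ) ^ (17 * s)) * N := by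
          simp only [hQ, hη]
          field_simp
      _ = _ := by
          rw [← pow_add, show 4 * s + 17 * s = 21 * s by ring, mul_pow]
          ring
  -- slicing bound
  have hslice : (cnt P s M : ℝ) * (M : ℝ) ^ (e + 2) ≤ C1 * (M : ℝ) ^ (2 * s + 1) := by
    have h1 := hsl P hP M hM
    calc (cnt P s M : ℝ) * (M : ℝ) ^ (e + 2)
        ≤ C1 * (M : ℝ) ^ (2 * (s : ℝ) - ((e + 2 : ℕ) : ℝ) + 1 / 4) * (M : ℝ) ^ (e + 2) := by gcongr
      _ = C1 * (M : ℝ) ^ (2 * (s : ℝ) + 1 / 4) := by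
          rw [mul_assoc, ← Real.rpow_natCast (M : ℝ) (e + 2), ← Real.rpow_add hM0]
          congr 2
          ring
      _ ≤ C1 * (M : ℝ) ^ (((2 * s + 1 : ℕ) : ℝ)) := by
          gcongr
          push_cast; linarith
      _ = _ := by rw [Real.rpow_natCast]
  have hminor : C * (M : ℝ) ^ (38 * s - 1) * (N * cnt P s M) * (M : ℝ) ^ (e + 2) ≤
      C * C1 * N * (M : ℝ) ^ (40 * s) := by
    have h1 : (M : ℝ) ^ (40 * s) = (M : ℝ) ^ (38 * s - 1) * (M : ℝ) ^ (2 * s + 1) := by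
      rw [← pow_add]; congr 1; omega
    calc C * (M : ℝ) ^ (38 * s - 1) * (N * cnt P s M) * (M : ℝ) ^ (e + 2)
        = C * (M : ℝ) ^ (38 * s - 1) * N * (cnt P s M * (M : ℝ) ^ (e + 2)) := by ring
      _ ≤ C * (M : ℝ) ^ (38 * s - 1) * N * (C1 * (M : ℝ) ^ (2 * s + 1)) := by gcongr
      _ = _ := by rw [h1]; ring
  have hmajor : (∑ j ∈ Finset.Icc 1 M, ((S j).card : ℝ) * ((M : ℝ) / j) ^ (40 * s)) * (M : ℝ) ^ (e + 2) ≤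
      30 * C ^ 2 * 2 ^ (21 * s) * N * (M : ℝ) ^ (40 * s) := by
    rw [Finset.sum_mul]
    calc ∑ j ∈ Finset.Icc 1 M, ((S j).card : ℝ) * ((M : ℝ) / j) ^ (40 * s) * (M : ℝ) ^ (e + 2)
        ≤ ∑ j ∈ Finset.Icc 1 M, (15 * C ^ 2 * 2 ^ (21 * s) * N * (M : ℝ) ^ (40 * s)) * (1 / (j : ℝ) ^ 2) := by
          refine Finset.sum_le_sum fun j hj => ?_
          have h1 := hSc j hj
          rw [Finset.mem_Icc] at hj
          have hjR : (1 : ℝ) ≤ j := by exact_mod_cast hj.1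
          have hj0 : (0 : ℝ) < j := by linarith
          have h2 : (j : ℝ) ^ (21 * s) / (j : ℝ) ^ (40 * s) ≤ 1 / (j : ℝ) ^ 2 := by
            rw [div_le_div_iff₀ (by positivity) (by positivity), one_mul, ← pow_add]
            exact pow_le_pow_right₀ hjR (by omega)
          calc ((S j).card : ℝ) * ((M : ℝ) / j) ^ (40 * s) * (M : ℝ) ^ (e + 2)
              = ((S j).card : ℝ) * (M : ℝ) ^ (e + 2) * ((M : ℝ) / j) ^ (40 * s) := by ring
            _ ≤ 15 * C ^ 2 * 2 ^ (21 * s) * (j : ℝ) ^ (21 * s) * N * ((M : ℝ) / j) ^ (40 * s) := by gcongr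
            _ = (15 * C ^ 2 * 2 ^ (21 * s) * N * (M : ℝ) ^ (40 * s)) *
                ((j : ℝ) ^ (21 * s) / (j : ℝ) ^ (40 * s)) := by rw [div_pow]; ring
            _ ≤ _ := by gcongr
      _ = (15 * C ^ 2 * 2 ^ (21 * s) * N * (M : ℝ) ^ (40 * s)) *
          ∑ j ∈ Finset.Icc 1 M, (1 / (j : ℝ) ^ 2) := by rw [Finset.mul_sum]
      _ ≤ (15 * C ^ 2 * 2 ^ (21 * s) * N * (M : ℝ) ^ (40 * s)) * 2 := by
          gcongr
          exact sum_inv_sq_le M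
      _ = _ := by ring
  have hsum : ∑ t ∈ Finset.range N, ‖fs P ((t : ℝ) / N) M‖ ^ (40 * s) ≤
      C * (M : ℝ) ^ (38 * s - 1) * (N * cnt P s M) +
      ∑ j ∈ Finset.Icc 1 M, ((S j).card : ℝ) * ((M : ℝ) / j) ^ (40 * s) := by
    refine (Finset.sum_le_sum hpt).trans (le_of_eq ?_)
    rw [Finset.sum_add_distrib, ← Finset.mul_sum, hNeq N (by omega), Finset.sum_comm]
    congr 1
    refine Finset.sum_congr rfl fun j _ => ?_
    rw [← Finset.sum_filter, Finset.sum_const, nsmul_eq_mul]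
    congr 3
    ext t
    simp only [Finset.mem_filter, hS]
    exact ⟨fun h => h.2, fun h => ⟨h.1, h⟩⟩
  calc (∑ t ∈ Finset.range N, ‖fs P ((t : ℝ) / N) M‖ ^ (40 * s)) * (M : ℝ) ^ (e + 2)
      ≤ (C * (M : ℝ) ^ (38 * s - 1) * (N * cnt P s M) +
      ∑ j ∈ Finset.Icc 1 M, ((S j).card : ℝ) * ((M : ℝ) / j) ^ (40 * s)) * (M : ℝ) ^ (e + 2) := by gcongr
    _ ≤ C * C1 * N * (M : ℝ) ^ (40 * s) + 30 * C ^ 2 * 2 ^ (21 * s) * N * (M : ℝ) ^ (40 * s) := by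
        rw [add_mul]
        exact add_le_add hminor hmajor
    _ = _ := by ring

lemma cnt_bound {e s : ℕ} (hs : e + 2 ≤ s) (hH : Hyp (e + 2) s (1 / 4)) (P : Polynomial ℤ)
    (hP : P.natDegree = e + 2) : ∃ C0 : ℝ, 0 < C0 ∧ ∀ M K : ℕ, 20 * s ≤ K →
      (cnt P K M : ℝ) ≤ C0 * (M : ℝ) ^ (2 * K - (e + 2)) := by
  obtain ⟨C0, hC0, h⟩ := main_mean hs hH P hP
  refine ⟨C0, hC0, ?_⟩
  intro M K hK
  rcases Nat.eq_zero_or_pos M with rfl | hM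
  · have : cnt P K 0 = 0 := by
      unfold cnt en
      have hne : Nonempty (Fin K) := ⟨⟨0, by omega⟩⟩
      rw [Finset.range_zero, Fintype.piFinset_empty]
      simp
    rw [this]
    simp only [Nat.cast_zero]
    positivity
  obtain ⟨N, hN, hb⟩ := h M hM
  have hN0 : (0 : ℝ) < N := by exact_mod_cast hN
  have hM0 : (0 : ℝ) < M := by exact_mod_cast hM
  have h1 : (N : ℝ) * cnt P K M ≤
      (M : ℝ) ^ (2 * K - 40 * s) * ∑ t ∈ Finset.range N, ‖fs P ((t : ℝ) / N) M‖ ^ (40 * s) := by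
    refine (cnt_le P K M N hN).trans ?_
    rw [Finset.mul_sum]
    refine Finset.sum_le_sum fun t _ => ?_
    have h2 : 2 * K = (2 * K - 40 * s) + 40 * s := by omega
    conv_lhs => rw [h2, pow_add]
    gcongr
    exact norm_fs_le _ _ _
  have h2 : (N * (M : ℝ) ^ (e + 2)) * cnt P K M ≤ (N * (M : ℝ) ^ (e + 2)) * (C0 * (M : ℝ) ^ (2 * K - (e + 2))) := by
    calc (N * (M : ℝ) ^ (e + 2)) * cnt P K M = (N * cnt P K M) * (M : ℝ) ^ (e + 2) := by ring
      _ ≤ ((M : ℝ) ^ (2 * K - 40 * s) * ∑ t ∈ Finset.range N, ‖fs P ((t : ℝ) / N) M‖ ^ (40 * s)) *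
          (M : ℝ) ^ (e + 2) := by gcongr
      _ = (M : ℝ) ^ (2 * K - 40 * s) * ((∑ t ∈ Finset.range N, ‖fs P ((t : ℝ) / N) M‖ ^ (40 * s)) *
          (M : ℝ) ^ (e + 2)) := by ring
      _ ≤ (M : ℝ) ^ (2 * K - 40 * s) * (C0 * N * (M : ℝ) ^ (40 * s)) := by gcongr
      _ = C0 * N * ((M : ℝ) ^ (2 * K - 40 * s) * (M : ℝ) ^ (40 * s)) := by ring
      _ = C0 * N * ((M : ℝ) ^ (e + 2) * (M : ℝ) ^ (2 * K - (e + 2))) := by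
          rw [← pow_add, ← pow_add]
          congr 2
          omega
      _ = _ := by ring
  exact le_of_mul_le_mul_left h2 (by positivity)

end VMV

namespace VMV

lemma card_eq_cnt (P : Polynomial ℤ) (K M : ℕ) :
    Nat.card {p : (Fin K → ℕ) × (Fin K → ℕ) //
            (∀ i, p.1 i ∈ Finset.Icc 1 M) ∧ (∀ i, p.2 i ∈ Finset.Icc 1 M) ∧
            ∑ i, P.eval (p.1 i : ℤ) = ∑ i, P.eval (p.2 i : ℤ)} =
      cnt (P.comp (Polynomial.X + Polynomial.C 1)) K M := by
  classical
  set T := Fintype.piFinset (fun _ : Fin K => Finset.Icc 1 M) with hT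
  have h1 : Nat.card {p : (Fin K → ℕ) × (Fin K → ℕ) //
            (∀ i, p.1 i ∈ Finset.Icc 1 M) ∧ (∀ i, p.2 i ∈ Finset.Icc 1 M) ∧
            ∑ i, P.eval (p.1 i : ℤ) = ∑ i, P.eval (p.2 i : ℤ)} =
      en T (fun z => ∑ i, P.eval (z i : ℤ)) := by
    unfold en
    rw [← Nat.card_eq_finsetCard]
    refine Nat.card_congr (Equiv.subtypeEquivRight ?_)
    intro p
    rw [Finset.mem_filter, Finset.mem_product, hT, Fintype.mem_piFinset, Fintype.mem_piFinset, and_assoc]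
  rw [h1]
  have hev : ∀ m : ℤ, (P.comp (Polynomial.X + Polynomial.C 1)).eval m = P.eval (m + 1) := by
    intro m; simp [Polynomial.eval_comp]
  unfold cnt
  apply le_antisymm
  · refine en_le_of_map _ _ _ _ (fun z i => z i - 1) ?_ ?_ ?_
    · intro z hz w hw h
      rw [Finset.mem_coe, hT, Fintype.mem_piFinset] at hz hw
      funext i
      have h2 := congrFun h i
      have h3 := Finset.mem_Icc.1 (hz i)
      have h4 := Finset.mem_Icc.1 (hw i)
      simp only at h2
      omega
    · intro z hz
      rw [hT, Fintype.mem_piFinset] at hz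
      rw [Fintype.mem_piFinset]
      intro i
      have h3 := Finset.mem_Icc.1 (hz i)
      rw [Finset.mem_range]
      omega
    · intro z hz
      rw [hT, Fintype.mem_piFinset] at hz
      refine Finset.sum_congr rfl fun i _ => ?_
      have h3 := Finset.mem_Icc.1 (hz i)
      rw [hev]
      congr 1
      push_cast [Nat.cast_sub h3.1]
      ring
  · refine en_le_of_map _ _ _ _ (fun z i => z i + 1) ?_ ?_ ?_
    · intro z _ w _ h
      funext i
      have h2 := congrFun h i
      simp only at h2
      omega
    · intro z hz
      rw [Fintype.mem_piFinset] at hz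
      rw [hT, Fintype.mem_piFinset]
      intro i
      have h3 := Finset.mem_range.1 (hz i)
      rw [Finset.mem_Icc]
      omega
    · intro z _
      refine Finset.sum_congr rfl fun i _ => ?_
      rw [hev]
      push_cast
      rfl

lemma cnt_trivial (P : Polynomial ℤ) (K M : ℕ) : cnt P K M ≤ M ^ (2 * K) := by
  unfold cnt en
  refine (Finset.card_filter_le _ _).trans ?_
  rw [Finset.card_product, Fintype.card_piFinset]
  simp only [Finset.card_range, Finset.prod_const, Finset.card_univ, Fintype.card_fin]
  rw [← pow_add, two_mul]

lemma cnt_linear (P : Polynomial ℤ) (hP : P.natDegree = 1) (K M : ℕ) : cnt P K M ≤ M ^ (2 * K - 1) := by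
  classical
  rcases K with _ | K
  · have := cnt_trivial P 0 M
    simpa using this
  have hinj : ∀ a b : ℤ, P.eval a = P.eval b → a = b := by
    intro a b h
    have hA : P.coeff 1 ≠ 0 := by
      have h1 : P.leadingCoeff ≠ 0 := by
        intro h0
        rw [Polynomial.leadingCoeff_eq_zero] at h0
        rw [h0] at hP
        simp at hP
      rwa [Polynomial.leadingCoeff, hP] at h1
    rw [Polynomial.eval_eq_sum_range, Polynomial.eval_eq_sum_range, hP] at h
    simp only [Finset.sum_range_succ, Finset.range_zero, Finset.sum_empty, pow_zero, pow_one,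
      zero_add, mul_one] at h
    have h2 : P.coeff 1 * a = P.coeff 1 * b := by linarith
    exact mul_left_cancel₀ hA h2
  unfold cnt en
  have hc : M ^ (2 * (K + 1) - 1) = ((Fintype.piFinset (fun _ : Fin K => Finset.range M)) ×ˢ
      (Fintype.piFinset (fun _ : Fin (K + 1) => Finset.range M))).card := by
    rw [Finset.card_product, Fintype.card_piFinset, Fintype.card_piFinset]
    simp only [Finset.card_range, Finset.prod_const, Finset.card_univ, Fintype.card_fin]
    rw [← pow_add]
    congr 1
    omega
  rw [hc]
  refine Finset.card_le_card_of_injOn (fun p => (Fin.tail p.1, p.2)) ?_ ?_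
  · intro p hp
    rw [Finset.mem_coe, Finset.mem_filter, Finset.mem_product, Fintype.mem_piFinset] at hp
    rw [Finset.mem_coe, Finset.mem_product, Fintype.mem_piFinset]
    exact ⟨fun i => hp.1.1 i.succ, hp.1.2⟩
  · intro p hp r hr h
    rw [Finset.mem_coe, Finset.mem_filter] at hp hr
    simp only [Prod.mk.injEq] at h
    obtain ⟨h1, h2⟩ := h
    have e1 := hp.2
    have e2 := hr.2
    rw [h2, ← e2] at e1
    beta_reduce at e1
    rw [Fin.sum_univ_succ, Fin.sum_univ_succ] at e1
    have h3 : ∀ i : Fin K, p.1 i.succ = r.1 i.succ := fun i => congrFun h1 i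
    simp only [h3] at e1
    have h4 := hinj _ _ (add_right_cancel e1)
    have h5 : p.1 0 = r.1 0 := by exact_mod_cast h4
    refine Prod.ext ?_ h2
    funext i
    refine Fin.cases h5 h3 i

end VMV

theorem count_polynomial_diophantine_solutions :
    ∃ C : ℝ, 0 < C ∧ ∀ (P : Polynomial ℤ) (k : ℕ), P.natDegree = k →
      ∃ C₀ : ℝ, 0 < C₀ ∧ ∀ M K : ℕ, (K : ℝ) ≥ C * (k : ℝ) ^ 2 * Real.log k →
        (Nat.card {p : (Fin K → ℕ) × (Fin K → ℕ) //
            (∀ i, p.1 i ∈ Finset.Icc 1 M) ∧ (∀ i, p.2 i ∈ Finset.Icc 1 M) ∧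
            ∑ i, P.eval (p.1 i : ℤ) = ∑ i, P.eval (p.2 i : ℤ)} : ℝ)
          ≤ C₀ * (M : ℝ) ^ (2 * K - k) := by
  refine ⟨160, by norm_num, ?_⟩
  intro P k hk
  have hdeg : (P.comp (Polynomial.X + Polynomial.C 1)).natDegree = k := by
    rw [Polynomial.natDegree_comp, Polynomial.natDegree_X_add_C, mul_one, hk]
  rcases k with _ | _ | e
  · refine ⟨1, one_pos, fun M K _ => ?_⟩
    rw [VMV.card_eq_cnt, one_mul]
    exact_mod_cast VMV.cnt_trivial _ K M
  · refine ⟨1, one_pos, fun M K _ => ?_⟩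
    rw [VMV.card_eq_cnt, one_mul]
    exact_mod_cast VMV.cnt_linear _ hdeg K M
  · obtain ⟨s, hs, hs8, hH⟩ := VMV.vmvt (k := e + 2) (by omega)
    have hes : e + 2 ≤ s := le_trans (Nat.le_self_pow (by norm_num) _) hs
    obtain ⟨C0, hC0, h⟩ := VMV.cnt_bound hes hH _ hdeg
    refine ⟨C0, hC0, fun M K hK => ?_⟩
    rw [VMV.card_eq_cnt]
    refine h M K ?_
    have h1 : ((20 * s : ℕ) : ℝ) ≤ K := by
      push_cast at hK hs8 ⊢
      have h2 : ((e : ℝ) + 1 + 1) = e + 2 := by ring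
      rw [h2] at hK
      linarith
    exact_mod_cast h1
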